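/- Let k be a number field, t transcendental over k, K a finite extension of k(t), and S a nonempty finite set of primes of K, with ring of S-integers O_{K,S}. Let T be any non-constant element of O_{K,S} (i.e., T is transcendental over k). Then the set ℤ[T] = {P(T) : P ∈ ℤ[X]} ⊆ O_{K,S} is Diophantine over O_{K,S}. -/

import Mathlib

/-- A Diophantine definition data. -/
def IsDiophantine {R : Type*} [CommRing R] {n : ℕ} (A : Set (Fin n → R)) : Prop :=
  ∃ (m : ℕ) (f : MvPolynomial (Fin n ⊕ Fin m) R),
    ∀ t : Fin n → R, t ∈ A ↔ ∃ x : Fin m → R, MvPolynomial.eval (Sum.elim t x) f = 0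

def HasSingleFoldDiophantineDefinition {R : Type*} [CommRing R] {n : ℕ}
    (A : Set (Fin n → R)) : Prop :=
  ∃ (m : ℕ) (f : MvPolynomial (Fin n ⊕ Fin m) R),
    ∀ t : Fin n → R, t ∈ A ↔ ∃! x : Fin m → R, MvPolynomial.eval (Sum.elim t x) f = 0

def HasFiniteFoldDiophantineDefinition {R : Type*} [CommRing R] {n : ℕ}
    (A : Set (Fin n → R)) : Prop :=
  ∃ (m : ℕ) (f : MvPolynomial (Fin n ⊕ Fin m) R),
    (∀ t : Fin n → R, t ∈ A ↔ ∃ x : Fin m → R, MvPolynomial.eval (Sum.elim t x) f = 0) ∧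
    ∀ t : Fin n → R, {x : Fin m → R | MvPolynomial.eval (Sum.elim t x) f = 0}.Finite

/-- A prime of the function field `K` over the constant field `k`, given by its
normalized `ℤ`-valued valuation (with the junk convention `ord 0 = 0`). -/
structure FFPrime (k K : Type*) [Field k] [Field K] [Algebra k K] where
  ord : K → ℤ
  ord_zero' : ord 0 = 0
  ord_mul : ∀ {x y : K}, x ≠ 0 → y ≠ 0 → ord (x * y) = ord x + ord y
  min_le_ord_add : ∀ {x y : K}, x ≠ 0 → y ≠ 0 → x + y ≠ 0 → min (ord x) (ord y) ≤ ord (x + y)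
  ord_algebraMap : ∀ {c : k}, c ≠ 0 → ord (algebraMap k K c) = 0
  exists_uniformizer : ∃ u : K, u ≠ 0 ∧ ord u = 1

namespace FFPrime

variable {k K : Type*} [Field k] [Field K] [Algebra k K]

/-- The image of `a` in the residue field of the prime `v` is a square. -/
def ResidueIsSquare (v : FFPrime k K) (a : K) : Prop :=
  ∃ b : K, 0 ≤ v.ord b ∧ (a = b ^ 2 ∨ 1 ≤ v.ord (a - b ^ 2))

/-- The prime `v` has degree one: its residue field is (identified with) `k`. -/
def DegreeOne (v : FFPrime k K) : Prop :=
  ∀ x : K, 0 ≤ v.ord x →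
    ∃ c : k, x = algebraMap k K c ∨ 1 ≤ v.ord (x - algebraMap k K c)

theorem ord_one (v : FFPrime k K) : v.ord 1 = 0 := by
  have := v.ord_algebraMap (one_ne_zero (α := k))
  simpa using this

theorem ord_neg (v : FFPrime k K) {x : K} (hx : x ≠ 0) : v.ord (-x) = v.ord x := by
  have h : (-1 : K) ≠ 0 := by norm_num
  have hm : (-x) = (-1) * x := by ring
  have h1 : v.ord (-1 : K) = 0 := by
    have heq : ((algebraMap k K) (-1 : k)) = (-1 : K) := by simp
    have h2 := v.ord_algebraMap (c := (-1 : k)) (by norm_num)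
    rwa [heq] at h2
  rw [hm, v.ord_mul h hx, h1, zero_add]

end FFPrime

/-- The ring of `S`-integers of `K`. -/
def SIntegers {k K : Type*} [Field k] [Field K] [Algebra k K]
    (S : Set (FFPrime k K)) : Subring K where
  carrier := {x | ∀ v : FFPrime k K, v ∉ S → 0 ≤ v.ord x}
  zero_mem' := by intro v hv; rw [v.ord_zero']
  one_mem' := by intro v hv; rw [v.ord_one]
  add_mem' := by
    intro x y hx hy v hv
    by_cases hx0 : x = 0
    · simpa [hx0] using hy v hv
    by_cases hy0 : y = 0
    · simpa [hy0] using hx v hv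
    by_cases hxy : x + y = 0
    · rw [hxy, v.ord_zero']
    · exact le_trans (le_min (hx v hv) (hy v hv)) (v.min_le_ord_add hx0 hy0 hxy)
  mul_mem' := by
    intro x y hx hy v hv
    by_cases hx0 : x = 0
    · simp [hx0, v.ord_zero']
    by_cases hy0 : y = 0
    · simp [hy0, v.ord_zero']
    rw [v.ord_mul hx0 hy0]
    exact add_nonneg (hx v hv) (hy v hv)
  neg_mem' := by
    intro x hx v hv
    by_cases hx0 : x = 0
    · simp [hx0, v.ord_zero']
    rw [v.ord_neg hx0]
    exact hx v hv

namespace DiophSys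

open MvPolynomial

/-- A function of an environment that is given by a polynomial. -/
def PolyFun {R : Type*} [CommRing R] {ι : Type} (f : (ι → R) → R) : Prop :=
  ∃ p : MvPolynomial ι R, ∀ ρ, f ρ = eval ρ p

/-- A relation between the entries of an environment that is defined by a finite system of
polynomial equations with existentially quantified unknowns. -/
def DS {R : Type*} [CommRing R] {ι : Type} (P : (ι → R) → Prop) : Prop :=
  ∃ (m : ℕ) (E : List (MvPolynomial (ι ⊕ Fin m) R)),
    ∀ ρ, P ρ ↔ ∃ x : Fin m → R, ∀ f ∈ E, eval (Sum.elim ρ x) f = 0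

section

variable {R : Type*} [CommRing R] {ι : Type}

namespace PolyFun

variable {f g : (ι → R) → R}

theorem const (c : R) : PolyFun (fun _ : ι → R => c) := ⟨C c, by simp⟩

theorem proj (i : ι) : PolyFun (fun ρ : ι → R => ρ i) := ⟨X i, by simp⟩

theorem add (hf : PolyFun f) (hg : PolyFun g) : PolyFun (fun ρ => f ρ + g ρ) := by
  obtain ⟨p, hp⟩ := hf
  obtain ⟨q, hq⟩ := hg
  exact ⟨p + q, by simp [hp, hq]⟩

theorem mul (hf : PolyFun f) (hg : PolyFun g) : PolyFun (fun ρ => f ρ * g ρ) := by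
  obtain ⟨p, hp⟩ := hf
  obtain ⟨q, hq⟩ := hg
  exact ⟨p * q, by simp [hp, hq]⟩

theorem sub (hf : PolyFun f) (hg : PolyFun g) : PolyFun (fun ρ => f ρ - g ρ) := by
  obtain ⟨p, hp⟩ := hf
  obtain ⟨q, hq⟩ := hg
  exact ⟨p - q, by simp [hp, hq]⟩

theorem neg (hf : PolyFun f) : PolyFun (fun ρ => -f ρ) := by
  obtain ⟨p, hp⟩ := hf
  exact ⟨-p, by simp [hp]⟩

theorem pow (hf : PolyFun f) (n : ℕ) : PolyFun (fun ρ => f ρ ^ n) := by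
  obtain ⟨p, hp⟩ := hf
  exact ⟨p ^ n, by simp [hp]⟩

theorem prod {κ : Type*} (s : Finset κ) {F : κ → (ι → R) → R} (h : ∀ i ∈ s, PolyFun (F i)) :
    PolyFun (fun ρ => ∏ i ∈ s, F i ρ) := by
  classical
  induction s using Finset.induction_on with
  | empty => simpa using const 1
  | insert i s hi ih =>
    simp only [Finset.prod_insert hi]
    exact (h i (by simp)).mul (ih fun j hj => h j (by simp [hj]))

theorem lift (hf : PolyFun f) : PolyFun (fun ρ : Option ι → R => f (fun i => ρ (some i))) := by
  obtain ⟨p, hp⟩ := hf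
  exact ⟨rename some p, fun ρ => by simp only [hp, eval_rename]; rfl⟩

end PolyFun

namespace DS

variable {P Q : (ι → R) → Prop}

theorem congr (hP : DS P) (h : ∀ ρ, Q ρ ↔ P ρ) : DS Q := by
  obtain ⟨m, E, hE⟩ := hP
  exact ⟨m, E, fun ρ => (h ρ).trans (hE ρ)⟩

theorem eq {f g : (ι → R) → R} (hf : PolyFun f) (hg : PolyFun g) : DS (fun ρ => f ρ = g ρ) := by
  obtain ⟨p, hp⟩ := hf
  obtain ⟨q, hq⟩ := hg
  refine ⟨0, [rename Sum.inl (p - q)], fun ρ => ?_⟩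
  have : ∀ x : Fin 0 → R, (Sum.elim ρ x) ∘ Sum.inl = ρ := fun x => by ext; rfl
  simp [eval_rename, this, hp, hq, sub_eq_zero]

theorem and (hP : DS P) (hQ : DS Q) : DS (fun ρ => P ρ ∧ Q ρ) := by
  obtain ⟨m, E, hE⟩ := hP
  obtain ⟨n, F, hF⟩ := hQ
  refine ⟨m + n, E.map (rename (Sum.map id (Fin.castAdd n))) ++
    F.map (rename (Sum.map id (Fin.natAdd m))), fun ρ => ?_⟩
  have h1 : ∀ x : Fin (m + n) → R, Sum.elim ρ x ∘ Sum.map id (Fin.castAdd n) =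
      Sum.elim ρ (fun i => x (Fin.castAdd n i)) := by
    intro x; ext (i | i) <;> rfl
  have h2 : ∀ x : Fin (m + n) → R, Sum.elim ρ x ∘ Sum.map id (Fin.natAdd m) =
      Sum.elim ρ (fun i => x (Fin.natAdd m i)) := by
    intro x; ext (i | i) <;> rfl
  simp only [hE, hF]
  constructor
  · rintro ⟨⟨x, hx⟩, ⟨y, hy⟩⟩
    refine ⟨Fin.append x y, ?_⟩
    simp only [List.mem_append, List.mem_map]
    rintro f (⟨p, hp, rfl⟩ | ⟨p, hp, rfl⟩)
    · rw [eval_rename, h1]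
      simpa using hx p hp
    · rw [eval_rename, h2]
      simpa using hy p hp
  · rintro ⟨x, hx⟩
    refine ⟨⟨fun i => x (Fin.castAdd n i), fun p hp => ?_⟩,
      ⟨fun i => x (Fin.natAdd m i), fun p hp => ?_⟩⟩
    · rw [← h1, ← eval_rename]
      exact hx _ (by simp only [List.mem_append, List.mem_map]; exact Or.inl ⟨p, hp, rfl⟩)
    · rw [← h2, ← eval_rename]
      exact hx _ (by simp only [List.mem_append, List.mem_map]; exact Or.inr ⟨p, hp, rfl⟩)

theorem ex {P : (ι → R) → R → Prop}
    (hP : DS (fun ρ : Option ι → R => P (fun i => ρ (some i)) (ρ none))) :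
    DS (fun ρ => ∃ x, P ρ x) := by
  obtain ⟨m, E, hE⟩ := hP
  let φ : Option ι ⊕ Fin m → ι ⊕ Fin (m + 1) :=
    Sum.elim (fun o => o.elim (Sum.inr 0) Sum.inl) (fun i => Sum.inr i.succ)
  have key : ∀ (ρ : ι → R) (x : R) (y : Fin m → R),
      Sum.elim ρ (Fin.cons x y : Fin (m + 1) → R) ∘ φ =
      Sum.elim (fun o : Option ι => o.elim x ρ) y := by
    intro ρ x y
    ext ((_ | i) | i) <;> simp [φ]
  refine ⟨m + 1, E.map (rename φ), fun ρ => ?_⟩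
  constructor
  · rintro ⟨x, hx⟩
    obtain ⟨y, hy⟩ := (hE (fun o : Option ι => o.elim x ρ)).1 hx
    refine ⟨Fin.cons x y, ?_⟩
    simp only [List.mem_map]
    rintro f ⟨p, hp, rfl⟩
    rw [eval_rename, key]
    exact hy p hp
  · rintro ⟨z, hz⟩
    refine ⟨z 0, (hE (fun o : Option ι => o.elim (z 0) ρ)).2 ⟨Fin.tail z, fun p hp => ?_⟩⟩
    rw [← key, ← eval_rename, Fin.cons_self_tail]
    exact hz _ (List.mem_map.2 ⟨p, hp, rfl⟩)

theorem forall_finset {κ : Type*} (s : Finset κ) {P : κ → (ι → R) → Prop}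
    (h : ∀ i ∈ s, DS (P i)) : DS (fun ρ => ∀ i ∈ s, P i ρ) := by
  classical
  induction s using Finset.induction_on with
  | empty =>
    exact (eq (PolyFun.const (0 : R)) (PolyFun.const 0)).congr (by simp)
  | insert i s hi ih =>
    exact ((h i (by simp)).and (ih fun j hj => h j (by simp [hj]))).congr (by simp)

/-- If `α` is not a square then `f² - α g² = 0` combines two equations into one. -/
theorem isDiophantine {n : ℕ} (α : R) (hα : ∀ x y : R, x ^ 2 = α * y ^ 2 → x = 0 ∧ y = 0)
    {P : (Fin n → R) → Prop} (hP : DS P) : IsDiophantine {ρ | P ρ} := by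
  obtain ⟨m, E, hE⟩ := hP
  have comb : ∀ E : List (MvPolynomial (Fin n ⊕ Fin m) R), ∃ f : MvPolynomial (Fin n ⊕ Fin m) R,
      ∀ σ, eval σ f = 0 ↔ ∀ g ∈ E, eval σ g = 0 := by
    intro E
    induction E with
    | nil => exact ⟨0, by simp⟩
    | cons g E ih =>
      obtain ⟨f, hf⟩ := ih
      refine ⟨g ^ 2 - C α * f ^ 2, fun σ => ?_⟩
      simp only [map_sub, map_pow, map_mul, eval_C, List.mem_cons, forall_eq_or_imp, ← hf]
      constructor
      · intro h
        exact hα _ _ (sub_eq_zero.1 h)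
      · rintro ⟨h1, h2⟩
        simp [h1, h2]
  obtain ⟨f, hf⟩ := comb E
  exact ⟨m, f, fun ρ => (hE ρ).trans (by simp only [hf])⟩

end DS

/-- Diophantine unary relations. -/
def D1 (P : R → Prop) : Prop :=
  ∀ {ι : Type} {f : (ι → R) → R}, PolyFun f → DS (fun ρ => P (f ρ))

/-- Diophantine binary relations. -/
def D2 (P : R → R → Prop) : Prop :=
  ∀ {ι : Type} {f g : (ι → R) → R}, PolyFun f → PolyFun g → DS (fun ρ => P (f ρ) (g ρ))

/-- Diophantine ternary relations. -/
def D3 (P : R → R → R → Prop) : Prop :=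
  ∀ {ι : Type} {f g h : (ι → R) → R}, PolyFun f → PolyFun g → PolyFun h →
    DS (fun ρ => P (f ρ) (g ρ) (h ρ))

/-- Diophantine quaternary relations. -/
def D4 (P : R → R → R → R → Prop) : Prop :=
  ∀ {ι : Type} {f g h k : (ι → R) → R}, PolyFun f → PolyFun g → PolyFun h → PolyFun k →
    DS (fun ρ => P (f ρ) (g ρ) (h ρ) (k ρ))

end

end DiophSys

namespace FFPrime

open scoped WithZero

section

variable {k K : Type*} [Field k] [Field K] [Algebra k K] (v : FFPrime k K)

theorem ord_inv {x : K} (hx : x ≠ 0) : v.ord x⁻¹ = -v.ord x := by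
  have h := v.ord_mul hx (inv_ne_zero hx)
  rw [mul_inv_cancel₀ hx, v.ord_one] at h
  omega

theorem ord_pow {x : K} (hx : x ≠ 0) (n : ℕ) : v.ord (x ^ n) = n * v.ord x := by
  induction n with
  | zero => simp [v.ord_one]
  | succ n ih =>
    rw [pow_succ, v.ord_mul (pow_ne_zero n hx) hx, ih]
    push_cast
    ring

theorem ord_zpow {x : K} (hx : x ≠ 0) (n : ℤ) : v.ord (x ^ n) = n * v.ord x := by
  obtain ⟨m, rfl | rfl⟩ := n.eq_nat_or_neg
  · simpa using v.ord_pow hx m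
  · rw [zpow_neg, v.ord_inv (zpow_ne_zero _ hx)]
    simpa using v.ord_pow hx m

theorem ord_neg' (x : K) : v.ord (-x) = v.ord x := by
  rcases eq_or_ne x 0 with rfl | hx
  · simp
  · exact v.ord_neg hx

theorem ord_prod {ι : Type*} (s : Finset ι) (f : ι → K) (hf : ∀ i ∈ s, f i ≠ 0) :
    v.ord (∏ i ∈ s, f i) = ∑ i ∈ s, v.ord (f i) := by
  classical
  induction s using Finset.induction_on with
  | empty => simp [v.ord_one]
  | insert i s hi ih =>
    rw [Finset.prod_insert hi, Finset.sum_insert hi, v.ord_mul (hf i (by simp)), ih]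
    · exact fun j hj => hf j (by simp [hj])
    · exact Finset.prod_ne_zero_iff.2 fun j hj => hf j (by simp [hj])

/-- The order with the convention that the order of `0` is infinite. -/
def Le (n : ℤ) (x : K) : Prop := x = 0 ∨ n ≤ v.ord x

variable {v}

theorem le_zero_iff {x : K} : v.Le 0 x ↔ 0 ≤ v.ord x := by
  refine ⟨?_, Or.inr⟩
  rintro (rfl | h)
  · rw [v.ord_zero']
  · exact h

theorem Le.ord_le {n : ℤ} {x : K} (h : v.Le n x) (hx : x ≠ 0) : n ≤ v.ord x :=
  h.resolve_left hx

theorem Le.zero (n : ℤ) : v.Le n 0 := Or.inl rfl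

theorem Le.refl (x : K) : v.Le (v.ord x) x := Or.inr le_rfl

theorem Le.mono {m n : ℤ} {x : K} (h : v.Le n x) (hmn : m ≤ n) : v.Le m x :=
  h.imp id hmn.trans

theorem Le.add {n : ℤ} {x y : K} (hx : v.Le n x) (hy : v.Le n y) : v.Le n (x + y) := by
  rcases eq_or_ne x 0 with rfl | hx0
  · simpa using hy
  rcases eq_or_ne y 0 with rfl | hy0
  · simpa using hx
  rcases eq_or_ne (x + y) 0 with h | h
  · exact Or.inl h
  · exact Or.inr ((le_min (hx.ord_le hx0) (hy.ord_le hy0)).trans (v.min_le_ord_add hx0 hy0 h))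

theorem Le.neg {n : ℤ} {x : K} (hx : v.Le n x) : v.Le n (-x) :=
  hx.imp (by simp) (by rw [v.ord_neg']; exact id)

theorem Le.sub {n : ℤ} {x y : K} (hx : v.Le n x) (hy : v.Le n y) : v.Le n (x - y) :=
  sub_eq_add_neg x y ▸ hx.add hy.neg

theorem Le.mul {m n : ℤ} {x y : K} (hx : v.Le m x) (hy : v.Le n y) : v.Le (m + n) (x * y) := by
  rcases eq_or_ne x 0 with rfl | hx0
  · simp [Le]
  rcases eq_or_ne y 0 with rfl | hy0
  · simp [Le]
  exact Or.inr ((add_le_add (hx.ord_le hx0) (hy.ord_le hy0)).trans_eq (v.ord_mul hx0 hy0).symm)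

theorem Le.pow {m : ℤ} {x : K} (hx : v.Le m x) (n : ℕ) : v.Le (n * m) (x ^ n) := by
  induction n with
  | zero => right; simp [v.ord_one]
  | succ n ih =>
    have := ih.mul hx
    rw [pow_succ]
    convert this using 1
    push_cast
    ring

theorem Le.sum {ι : Type*} {n : ℤ} (s : Finset ι) {f : ι → K} (h : ∀ i ∈ s, v.Le n (f i)) :
    v.Le n (∑ i ∈ s, f i) := by
  classical
  induction s using Finset.induction_on with
  | empty => simp [Le]
  | insert i s hi ih =>
    rw [Finset.sum_insert hi]
    exact (h i (by simp)).add (ih fun j hj => h j (by simp [hj]))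

theorem le_algebraMap (c : k) : v.Le 0 (algebraMap k K c) := by
  rcases eq_or_ne c 0 with rfl | hc
  · simp [Le]
  · exact Or.inr (v.ord_algebraMap hc).ge

/-- The ultrametric inequality is an equality when the orders differ. -/
theorem ord_add_eq {x y : K} (hx : x ≠ 0) (hy : v.Le (v.ord x + 1) y) :
    x + y ≠ 0 ∧ v.ord (x + y) = v.ord x := by
  have h0 : x + y ≠ 0 := by
    intro h
    have : y = -x := by linear_combination h
    have := hy.ord_le (by simpa [this])
    simp_all [v.ord_neg']
  refine ⟨h0, le_antisymm ?_ (((Le.refl x).add (hy.mono (by omega))).ord_le h0)⟩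
  by_contra! hlt
  have h1 : v.Le (v.ord x + 1) (x + y) := Or.inr hlt
  have := (h1.sub hy).ord_le (by simpa using hx)
  simp at this

variable (v)

/-- The valuation ring of a prime. -/
def valuationSubring : ValuationSubring K where
  carrier := {x | 0 ≤ v.ord x}
  zero_mem' := v.ord_zero'.ge
  one_mem' := v.ord_one.ge
  add_mem' := fun hx hy => le_zero_iff.1 ((le_zero_iff.2 hx).add (le_zero_iff.2 hy))
  mul_mem' := fun hx hy => le_zero_iff.1 (((le_zero_iff.2 hx).mul (le_zero_iff.2 hy)).mono le_rfl)
  neg_mem' := fun hx => le_zero_iff.1 (le_zero_iff.2 hx).neg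
  mem_or_inv_mem' := fun x => by
    rcases eq_or_ne x 0 with rfl | hx
    · exact Or.inl v.ord_zero'.ge
    · have := v.ord_inv hx
      rcases le_total 0 (v.ord x) with h | h
      · exact Or.inl h
      · right
        change 0 ≤ v.ord x⁻¹
        omega

theorem mem_valuationSubring {x : K} : x ∈ v.valuationSubring ↔ 0 ≤ v.ord x := Iff.rfl

/-- The valuation ring is integrally closed. -/
theorem ord_nonneg_of_isIntegral {A : Type*} [CommRing A] [Algebra A K]
    (hA : ∀ c : A, 0 ≤ v.ord (algebraMap A K c)) {y : K} (hy : IsIntegral A y) :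
    0 ≤ v.ord y := by
  let f : A →+* v.valuationSubring := (algebraMap A K).codRestrict v.valuationSubring.toSubring hA
  have h1 : IsIntegral v.valuationSubring y := by
    obtain ⟨p, hp, hpy⟩ := hy
    refine ⟨p.map f, hp.map f, ?_⟩
    rw [Polynomial.eval₂_map]
    exact hpy
  obtain ⟨z, rfl⟩ := IsIntegrallyClosed.isIntegral_iff.1 h1
  exact z.2

theorem ord_nonneg_of_mem_adjoin {x : K} (hx : 0 ≤ v.ord x) {y : K}
    (hy : y ∈ Algebra.adjoin k {x}) : 0 ≤ v.ord y := by
  have : Algebra.adjoin k {x} ≤ ({ v.valuationSubring.toSubring with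
      algebraMap_mem' := fun c => le_zero_iff.1 (le_algebraMap c) } : Subalgebra k K) :=
    Algebra.adjoin_le (Set.singleton_subset_iff.2 hx)
  exact this hy

theorem ord_nonneg_of_isIntegral_adjoin {x : K} (hx : 0 ≤ v.ord x) {y : K}
    (hy : IsIntegral (Algebra.adjoin k {x}) y) : 0 ≤ v.ord y :=
  v.ord_nonneg_of_isIntegral (fun c => v.ord_nonneg_of_mem_adjoin hx c.2) hy

/-- Elements algebraic over the constants have order zero. -/
theorem ord_eq_zero_of_isAlgebraic {x : K} (hx : IsAlgebraic k x) : v.ord x = 0 := by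
  have h : ∀ y : K, IsAlgebraic k y → 0 ≤ v.ord y := fun y hy =>
    v.ord_nonneg_of_isIntegral (fun c => le_zero_iff.1 (le_algebraMap c)) hy.isIntegral
  rcases eq_or_ne x 0 with rfl | hx0
  · exact v.ord_zero'
  · have h1 := h x hx
    have h2 := h x⁻¹ hx.inv
    rw [v.ord_inv hx0] at h2
    omega

end

section

variable {F L : Type*} [Field F] [Field L] [Algebra F L]

open IsDedekindDomain

/-- The prime of a function field given by a maximal ideal of a Dedekind subring. -/
noncomputable def ofHeightOne {B : Type*} [CommRing B] [IsDedekindDomain B] [Algebra B L]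
    [IsFractionRing B L] [Algebra F B] [IsScalarTower F B L] (w : HeightOneSpectrum B) :
    FFPrime F L where
  ord x := -(WithZero.log (w.valuation L x))
  ord_zero' := by simp
  ord_mul := by
    intro x y hx hy
    rw [map_mul, WithZero.log_mul (by simpa using hx) (by simpa using hy)]
    ring
  min_le_ord_add := by
    intro x y hx hy hxy
    have h := (w.valuation L).map_add x y
    rcases le_max_iff.1 h with h | h
    · exact min_le_iff.2 (Or.inl (neg_le_neg (WithZero.log_le_log (by simpa using hxy)
        (by simpa using hx) |>.2 h)))
    · exact min_le_iff.2 (Or.inr (neg_le_neg (WithZero.log_le_log (by simpa using hxy)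
        (by simpa using hy) |>.2 h)))
  ord_algebraMap := by
    intro c hc
    have h : ∀ c : F, w.valuation L (algebraMap F L c) ≤ 1 := fun c => by
      rw [IsScalarTower.algebraMap_apply F B L]
      exact w.valuation_le_one _
    have h1 : w.valuation L (algebraMap F L c) = 1 := by
      refine le_antisymm (h c) ?_
      have := h c⁻¹
      rw [map_inv₀, map_inv₀] at this
      exact (inv_le_one₀ (by simpa [zero_lt_iff] using hc)).1 this
    rw [h1]
    simp
  exists_uniformizer := by
    obtain ⟨π, hπ⟩ := w.valuation_exists_uniformizer L
    refine ⟨π, ?_, ?_⟩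
    · rintro rfl
      rw [map_zero] at hπ
      exact WithZero.exp_ne_zero hπ.symm
    · rw [hπ]
      simp

theorem ord_ofHeightOne {B : Type*} [CommRing B] [IsDedekindDomain B] [Algebra B L]
    [IsFractionRing B L] [Algebra F B] [IsScalarTower F B L] (w : HeightOneSpectrum B) (x : L) :
    (ofHeightOne (F := F) w : FFPrime F L).ord x = -(WithZero.log (w.valuation L x)) := rfl

theorem ord_ofHeightOne_nonneg {B : Type*} [CommRing B] [IsDedekindDomain B] [Algebra B L]
    [IsFractionRing B L] [Algebra F B] [IsScalarTower F B L] (w : HeightOneSpectrum B) {x : L}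
    (hx : w.valuation L x ≤ 1) : 0 ≤ (ofHeightOne (F := F) w : FFPrime F L).ord x := by
  rw [ord_ofHeightOne, Left.nonneg_neg_iff]
  rcases eq_or_ne x 0 with rfl | h0
  · simp
  · simpa using (WithZero.log_le_log (by simpa using h0) one_ne_zero).2 hx

theorem ord_ofHeightOne_neg {B : Type*} [CommRing B] [IsDedekindDomain B] [Algebra B L]
    [IsFractionRing B L] [Algebra F B] [IsScalarTower F B L] (w : HeightOneSpectrum B) {x : L}
    (hx : 1 < w.valuation L x) : (ofHeightOne (F := F) w : FFPrime F L).ord x < 0 := by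
  rw [ord_ofHeightOne, Left.neg_neg_iff]
  have h0 : w.valuation L x ≠ 0 := fun h => by simp [h] at hx
  simpa using (WithZero.log_lt_log one_ne_zero h0).2 hx

end

end FFPrime

open IntermediateField.algebraAdjoinAdjoin in
/-- The ring of functions integral over `F[x]` is a Dedekind ring with fraction field `L`. -/
theorem isDedekindDomain_integralClosure_adjoin {F L : Type*} [Field F] [CharZero F] [Field L]
    [Algebra F L] {x : L} (hx : Transcendental F x)
    (hfin : FiniteDimensional (IntermediateField.adjoin F {x}) L) :
    IsDedekindDomain (integralClosure (Algebra.adjoin F {x}) L) ∧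
    IsFractionRing (integralClosure (Algebra.adjoin F {x}) L) L := by
  have hpid : IsPrincipalIdealRing (Algebra.adjoin F {x}) :=
    IsPrincipalIdealRing.of_surjective (Polynomial.algEquivOfTranscendental F x hx).toRingEquiv
      (Polynomial.algEquivOfTranscendental F x hx).surjective
  have : CharZero (IntermediateField.adjoin F {x}) :=
    charZero_of_injective_algebraMap (algebraMap F _).injective
  refine ⟨integralClosure.isDedekindDomain _ (IntermediateField.adjoin F {x}) L, ?_⟩
  exact IsIntegralClosure.isFractionRing_of_finite_extension (Algebra.adjoin F {x})
    (IntermediateField.adjoin F {x}) L _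

theorem FFPrime.exists_ord_neg {F L : Type*} [Field F] [CharZero F] [Field L]
    [Algebra F L] {x : L} (hx : Transcendental F x)
    (hfin : FiniteDimensional (IntermediateField.adjoin F {x}) L) {y : L}
    (hy : ¬ IsIntegral (Algebra.adjoin F {x}) y) :
    ∃ v : FFPrime F L, 0 ≤ v.ord x ∧ v.ord y < 0 := by
  obtain ⟨h1, h2⟩ := isDedekindDomain_integralClosure_adjoin hx hfin
  have : ∃ w : IsDedekindDomain.HeightOneSpectrum (integralClosure (Algebra.adjoin F {x}) L),
      1 < w.valuation L y := by
    by_contra! h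
    obtain ⟨z, rfl⟩ := IsDedekindDomain.HeightOneSpectrum.mem_integers_of_valuation_le_one L y h
    exact hy z.2
  obtain ⟨w, hw⟩ := this
  refine ⟨ofHeightOne w, ord_ofHeightOne_nonneg w ?_, ord_ofHeightOne_neg w hw⟩
  exact w.valuation_le_one ⟨x, isIntegral_algebraMap
    (x := (⟨x, Algebra.subset_adjoin rfl⟩ : Algebra.adjoin F {x}))⟩

/-- `L` is an algebraic function field in one variable over `F`. -/
structure IsFunctionField (F L : Type*) [Field F] [Field L] [Algebra F L] : Prop where
  essFinite : Algebra.EssFiniteType F L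
  trdeg_eq : Algebra.trdeg F L = 1

namespace IsFunctionField

open IntermediateField.algebraAdjoinAdjoin

variable {F L : Type*} [Field F] [Field L] [Algebra F L]

theorem isAlgebraic (h : IsFunctionField F L) {x : L} (hx : Transcendental F x) :
    Algebra.IsAlgebraic (IntermediateField.adjoin F {x}) L := by
  have h1 : AlgebraicIndependent F (fun _ : Unit => x) :=
    (algebraicIndependent_unique_type_iff (ι := Unit)).2 hx
  have h2 : IsTranscendenceBasis F (fun _ : Unit => x) := by
    refine h1.isTranscendenceBasis_of_lift_trdeg_le_of_finite ?_
    rw [h.trdeg_eq]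
    simp
  have h3 := h2.isAlgebraic_field
  rwa [Set.range_const] at h3

theorem finiteDimensional (h : IsFunctionField F L) {x : L} (hx : Transcendental F x) :
    FiniteDimensional (IntermediateField.adjoin F {x}) L := by
  have := h.isAlgebraic hx
  have := h.essFinite
  have h2 : Algebra.EssFiniteType (IntermediateField.adjoin F {x}) L :=
    Algebra.EssFiniteType.of_comp F _ L
  obtain ⟨s, hs⟩ := IntermediateField.fg_top (IntermediateField.adjoin F {x}) L
  have h3 : FiniteDimensional (IntermediateField.adjoin F {x})
      (IntermediateField.adjoin (IntermediateField.adjoin F {x}) (s : Set L)) :=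
    IntermediateField.finiteDimensional_adjoin
      (fun y _ => (Algebra.IsAlgebraic.isAlgebraic y).isIntegral)
  rw [hs] at h3
  exact Module.Finite.equiv (IntermediateField.topEquiv
    (F := IntermediateField.adjoin F {x}) (E := L)).toLinearEquiv

theorem of_finiteDimensional {t : L} (ht : Transcendental F t)
    (hfin : FiniteDimensional (IntermediateField.adjoin F {t}) L) : IsFunctionField F L := by
  have h1 : AlgebraicIndependent F (fun _ : Unit => t) :=
    (algebraicIndependent_unique_type_iff (ι := Unit)).2 ht
  refine ⟨?_, ?_⟩
  · have : Algebra.EssFiniteType F (IntermediateField.adjoin F {t}) :=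
      (IntermediateField.essFiniteType_iff).2 ⟨{t}, by simp⟩
    exact Algebra.EssFiniteType.comp F (IntermediateField.adjoin F {t}) L
  · have : Algebra.IsAlgebraic (Algebra.adjoin F (Set.range fun _ : Unit => t)) L := by
      rw [Set.range_const]
      have : Algebra.IsAlgebraic (IntermediateField.adjoin F {t}) L :=
        Algebra.IsAlgebraic.of_finite _ _
      exact Algebra.IsAlgebraic.trans _ (IntermediateField.adjoin F {t}) _
    have h2 : IsTranscendenceBasis F (fun _ : Unit => t) := by
      exact h1.isTranscendenceBasis_iff_isAlgebraic.2 this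
    have := h2.lift_cardinalMk_eq_trdeg
    simpa using this.symm

theorem restrictScalars {k K : Type*} [Field k] [Field K] [Algebra F k] [Algebra k K]
    [Algebra F K] [IsScalarTower F k K] [FiniteDimensional F k] (h : IsFunctionField k K) :
    IsFunctionField F K := by
  have := h.essFinite
  refine ⟨Algebra.EssFiniteType.comp F k K, ?_⟩
  have h1 := lift_trdeg_add_eq F k K
  rw [h.trdeg_eq, trdeg_eq_zero] at h1
  simpa using h1.symm

theorem not_isIntegral_inv [CharZero F] {s : L} (hs : Transcendental F s) :
    ¬ IsIntegral (Algebra.adjoin F {s}) s⁻¹ := by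
  intro hi
  have hs0 : s ≠ 0 := fun h0 => hs (h0 ▸ isAlgebraic_zero)
  have hpid : IsPrincipalIdealRing (Algebra.adjoin F {s}) :=
    IsPrincipalIdealRing.of_surjective (Polynomial.algEquivOfTranscendental F _ hs).toRingEquiv
      (Polynomial.algEquivOfTranscendental F _ hs).surjective
  let y : IntermediateField.adjoin F {s} := (IntermediateField.AdjoinSimple.gen F s)⁻¹
  have hy : algebraMap (IntermediateField.adjoin F {s}) L y = s⁻¹ := by
    simp [y]
  have h1 : IsIntegral (Algebra.adjoin F {s}) y := by
    rw [← hy] at hi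
    exact (isIntegral_algebraMap_iff
      (algebraMap (IntermediateField.adjoin F {s}) L).injective).1 hi
  obtain ⟨z, hz⟩ := IsIntegrallyClosed.isIntegral_iff.1 h1
  have h2 : (z : L) = s⁻¹ := by
    rw [← hy, ← hz]
    rfl
  obtain ⟨p, hp⟩ : ∃ p : Polynomial F, Polynomial.aeval s p = z := by
    obtain ⟨z, hz'⟩ := z
    rwa [Algebra.adjoin_singleton_eq_range_aeval] at hz'
  have h3 : Polynomial.aeval s (Polynomial.X * p - 1 : Polynomial F) = 0 := by
    have : Polynomial.aeval s p = s⁻¹ := hp.trans h2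
    simp [this, hs0]
  have h4 : (Polynomial.X * p - 1 : Polynomial F) = 0 := by
    by_contra hne
    exact hs ⟨_, hne, h3⟩
  have := congrArg (Polynomial.eval 0) h4
  simp at this

theorem exists_pole [CharZero F] (h : IsFunctionField F L) {x : L} (hx : Transcendental F x) :
    ∃ v : FFPrime F L, v.ord x < 0 := by
  have hx' : Transcendental F x⁻¹ := fun h' => hx (by simpa using h'.inv)
  have hni := not_isIntegral_inv hx'
  rw [inv_inv] at hni
  obtain ⟨v, -, hv⟩ := FFPrime.exists_ord_neg hx' (h.finiteDimensional hx') hni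
  exact ⟨v, hv⟩

end IsFunctionField

namespace FFPrime

section

variable {k K : Type*} [Field k] [Field K] [Algebra k K]

@[ext]
theorem ext' {v w : FFPrime k K} (h : ∀ x, v.ord x = w.ord x) : v = w := by
  obtain ⟨f, _⟩ := v
  obtain ⟨g, _⟩ := w
  obtain rfl : f = g := funext h
  rfl

theorem exists_nonneg_neg {v u : FFPrime k K} (h : v ≠ u) :
    ∃ x, x ≠ 0 ∧ 0 ≤ v.ord x ∧ u.ord x < 0 := by
  by_contra! hc
  apply h
  have h0 : ∀ x ≠ 0, v.ord x = 0 → u.ord x = 0 := fun x hx h0 => by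
    have h1 := hc x hx h0.ge
    have h2 := hc x⁻¹ (inv_ne_zero hx) (by rw [v.ord_inv hx, h0]; rfl)
    rw [u.ord_inv hx] at h2
    omega
  obtain ⟨p, hp0, hp⟩ := v.exists_uniformizer
  have h1 : ∀ x ≠ 0, u.ord x = u.ord p * v.ord x := fun x hx => by
    have := h0 (x * p ^ (-v.ord x)) (mul_ne_zero hx (zpow_ne_zero _ hp0)) (by
      rw [v.ord_mul hx (zpow_ne_zero _ hp0), v.ord_zpow hp0, hp]; ring)
    rw [u.ord_mul hx (zpow_ne_zero _ hp0), u.ord_zpow hp0] at this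
    linarith
  have h2 : u.ord p = 1 := by
    obtain ⟨q, hq0, hq⟩ := u.exists_uniformizer
    rw [h1 q hq0] at hq
    exact (Int.eq_one_or_neg_one_of_mul_eq_one hq).resolve_right
      (fun h => by have := hc p hp0 (by omega); omega)
  ext x
  rcases eq_or_ne x 0 with rfl | hx
  · rw [v.ord_zero', u.ord_zero']
  · rw [h1 x hx, h2, one_mul]

theorem exists_separating_pair {v u : FFPrime k K} (h : v ≠ u) :
    ∃ z, z ≠ 0 ∧ v.ord z < 0 ∧ 0 < u.ord z := by
  obtain ⟨x, hx0, hx1, hx2⟩ := exists_nonneg_neg h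
  obtain ⟨y, hy0, hy1, hy2⟩ := exists_nonneg_neg h.symm
  refine ⟨y * x⁻¹, mul_ne_zero hy0 (inv_ne_zero hx0), ?_, ?_⟩
  · rw [v.ord_mul hy0 (inv_ne_zero hx0), v.ord_inv hx0]
    omega
  · rw [u.ord_mul hy0 (inv_ne_zero hx0), u.ord_inv hx0]
    omega

theorem exists_nat_forall_lt {ι : Type*} (s : Finset ι) (f : ι → ℤ) :
    ∃ n : ℕ, 0 < n ∧ ∀ i ∈ s, f i < n := by
  classical
  induction s using Finset.induction_on with
  | empty => exact ⟨1, by simp⟩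
  | insert i s hi ih =>
    obtain ⟨n, hn0, hn⟩ := ih
    refine ⟨n + (f i).toNat + 1, by omega, fun j hj => ?_⟩
    rcases Finset.mem_insert.1 hj with rfl | hj
    · push_cast
      omega
    · have := hn j hj
      push_cast
      omega

theorem exists_separating (v : FFPrime k K) (T : Finset (FFPrime k K)) (hv : v ∉ T) :
    ∃ z, z ≠ 0 ∧ v.ord z < 0 ∧ ∀ u ∈ T, 0 < u.ord z := by
  classical
  induction T using Finset.induction_on with
  | empty =>
    obtain ⟨p, hp0, hp⟩ := v.exists_uniformizer
    exact ⟨p⁻¹, inv_ne_zero hp0, by rw [v.ord_inv hp0, hp]; norm_num, by simp⟩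
  | insert u T hu ih =>
    obtain ⟨z, hz0, hzv, hz⟩ := ih (fun h => hv (Finset.mem_insert_of_mem h))
    obtain ⟨z', hz'0, hz'v, hz'u⟩ := exists_separating_pair
      (show v ≠ u from fun h => hv (h ▸ Finset.mem_insert_self _ _))
    obtain ⟨n, hn0, hn⟩ := exists_nat_forall_lt T (fun u => -u.ord z')
    have hnT : ∀ w ∈ T, 0 < w.ord (z ^ n) + w.ord z' := fun w hw => by
      rw [w.ord_pow hz0]
      have h1 := hn w hw
      have h2 := hz w hw
      nlinarith
    rcases lt_or_ge (u.ord z) 0 with hneg | hnonneg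
    · have hone : ∀ w : FFPrime k K, w.ord z < 0 →
          z ^ n + 1 ≠ 0 ∧ w.ord (z ^ n + 1) = w.ord (z ^ n) := fun w hw =>
        w.ord_add_eq (pow_ne_zero n hz0) (Or.inr (by
          rw [w.ord_pow hz0, w.ord_one]
          nlinarith))
      have hne := (hone v hzv).1
      refine ⟨z ^ n * (z ^ n + 1)⁻¹ * z', by positivity, ?_, ?_⟩
      · rw [v.ord_mul (by positivity) hz'0, v.ord_mul (by positivity) (by positivity),
          v.ord_inv hne, (hone v hzv).2]
        omega
      · intro w hw
        rw [w.ord_mul (by positivity) hz'0, w.ord_mul (by positivity) (by positivity),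
          w.ord_inv hne]
        rcases Finset.mem_insert.1 hw with rfl | hw
        · rw [(hone w hneg).2]
          omega
        · have h1 : w.ord (z ^ n + 1) = 0 := by
            rw [add_comm, (w.ord_add_eq one_ne_zero (Or.inr ?_)).2, w.ord_one]
            rw [w.ord_one, w.ord_pow hz0]
            have := hz w hw
            nlinarith
          have := hnT w hw
          omega
    · refine ⟨z ^ n * z', by positivity, ?_, ?_⟩
      · rw [v.ord_mul (by positivity) hz'0, v.ord_pow hz0]
        nlinarith
      · intro w hw
        rw [w.ord_mul (by positivity) hz'0]
        rcases Finset.mem_insert.1 hw with rfl | hw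
        · rw [w.ord_pow hz0]
          nlinarith [mul_nonneg (Int.natCast_nonneg n) hnonneg]
        · exact hnT w hw

/-- A weak form of the approximation theorem: parities of orders can be prescribed. -/
theorem exists_odd (T : Finset (FFPrime k K)) : ∃ f : K, f ≠ 0 ∧ ∀ v ∈ T, Odd (v.ord f) := by
  classical
  have key : ∀ v ∈ T, ∃ f : K, f ≠ 0 ∧ Odd (v.ord f) ∧ ∀ u ∈ T.erase v, u.ord f = 0 := by
    intro v hv
    obtain ⟨z, hz0, hzv, hz⟩ := exists_separating v (T.erase v) (by simp)
    obtain ⟨p, hp0, hp⟩ := v.exists_uniformizer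
    obtain ⟨n, hn0, hn⟩ := exists_nat_forall_lt T (fun u => -u.ord p + 1)
    have hn' := hn v hv
    have h0 : z ^ (2 * n) * p ≠ 0 := mul_ne_zero (pow_ne_zero _ hz0) hp0
    have hord : ∀ u : FFPrime k K, u.ord (z ^ (2 * n) * p) = 2 * n * u.ord z + u.ord p := by
      intro u
      rw [u.ord_mul (pow_ne_zero _ hz0) hp0, u.ord_pow hz0]
      push_cast
      ring
    obtain ⟨h1, h2⟩ := v.ord_add_eq (y := 1) h0 (Or.inr (by
      rw [hord, hp, v.ord_one]
      nlinarith))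
    refine ⟨_, h1, ?_, ?_⟩
    · rw [h2, hord, hp]
      exact ⟨n * v.ord z, by ring⟩
    · intro u hu
      rw [add_comm, (u.ord_add_eq one_ne_zero (Or.inr ?_)).2, u.ord_one]
      rw [hord, u.ord_one]
      have h3 := hz u hu
      have h4 := hn u (Finset.mem_of_mem_erase hu)
      nlinarith
  choose! f hf0 hf1 hf2 using key
  refine ⟨∏ v ∈ T, f v, Finset.prod_ne_zero_iff.2 hf0, fun v hv => ?_⟩
  rw [v.ord_prod T f hf0, ← Finset.add_sum_erase T _ hv, Finset.sum_eq_zero, add_zero]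
  · exact hf1 v hv
  · intro u hu
    exact hf2 u (Finset.mem_of_mem_erase hu) v
      (Finset.mem_erase.2 ⟨(Finset.ne_of_mem_erase hu).symm, hv⟩)

end

end FFPrime

namespace FFPrime

/-- A prime over `k`, regarded as a prime over a smaller field of constants. -/
def restrict (F : Type*) {k K : Type*} [Field F] [Field k] [Field K] [Algebra F k] [Algebra k K]
    [Algebra F K] [IsScalarTower F k K] (v : FFPrime k K) : FFPrime F K where
  ord := v.ord
  ord_zero' := v.ord_zero'
  ord_mul := v.ord_mul
  min_le_ord_add := v.min_le_ord_add
  ord_algebraMap := fun {c} hc => by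
    rw [IsScalarTower.algebraMap_apply F k K]
    exact v.ord_algebraMap (by simpa using hc)
  exists_uniformizer := v.exists_uniformizer

/-- A prime over `F`, regarded as a prime over an algebraic extension of constants. -/
def extend {F : Type*} (k : Type*) {K : Type*} [Field F] [Field k] [Field K] [Algebra F k]
    [Algebra k K] [Algebra F K] [IsScalarTower F k K] [Algebra.IsAlgebraic F k]
    (v : FFPrime F K) : FFPrime k K where
  ord := v.ord
  ord_zero' := v.ord_zero'
  ord_mul := v.ord_mul
  min_le_ord_add := v.min_le_ord_add
  ord_algebraMap := fun {c} _ => v.ord_eq_zero_of_isAlgebraic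
    ((Algebra.IsAlgebraic.isAlgebraic (R := F) c).algebraMap)
  exists_uniformizer := v.exists_uniformizer

variable {k K : Type*} [Field k] [Field K] [Algebra k K]

theorem exists_mem_forall_neg (R : Subring K) (T : Finset (FFPrime k K))
    (hT : ∀ v ∈ T, ∃ x ∈ R, v.ord x < 0) : ∃ e ∈ R, ∀ v ∈ T, v.ord e < 0 := by
  classical
  induction T using Finset.induction_on with
  | empty => exact ⟨0, R.zero_mem, by simp⟩
  | insert v T hv ih =>
    obtain ⟨e, he, heT⟩ := ih (fun u hu => hT u (Finset.mem_insert_of_mem hu))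
    obtain ⟨x, hx, hxv⟩ := hT v (Finset.mem_insert_self _ _)
    have hx0 : x ≠ 0 := by
      rintro rfl
      simp [v.ord_zero'] at hxv
    obtain ⟨n, hn0, hn⟩ := exists_nat_forall_lt (insert v T) (fun u => -u.ord e)
    refine ⟨e + x ^ n, R.add_mem he (R.pow_mem hx n), fun u hu => ?_⟩
    have hnu := hn u hu
    rcases lt_or_ge (u.ord x) 0 with h | h
    · have := u.ord_add_eq (y := e) (pow_ne_zero n hx0) (Or.inr (by
        rw [u.ord_pow hx0]
        nlinarith))
      rw [add_comm, this.2, u.ord_pow hx0]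
      nlinarith
    · have huT : u ∈ T := by
        rcases Finset.mem_insert.1 hu with rfl | hu
        · omega
        · exact hu
      have hue := heT u huT
      have he0 : e ≠ 0 := by
        rintro rfl
        simp [u.ord_zero'] at hue
      have := u.ord_add_eq (y := x ^ n) he0 (Or.inr (by
        rw [u.ord_pow hx0]
        nlinarith))
      rw [this.2]
      exact hue

theorem transcendental_of_ord_neg {v : FFPrime k K} {x : K} (hx : v.ord x < 0) :
    Transcendental k x := fun h => by
  rw [v.ord_eq_zero_of_isAlgebraic h] at hx
  exact lt_irrefl _ hx

end FFPrime

theorem IsFunctionField.exists_generator {k K : Type*} [Field k] [CharZero k] [Field K]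
    [Algebra k K] (h : IsFunctionField k K) (S : Set (FFPrime k K)) (hS : S.Finite) (T : K)
    (hT : T ∈ SIntegers S) (hTt : Transcendental k T) :
    ∃ a ∈ SIntegers S, Transcendental k a ∧ (∀ v : FFPrime k K, v.ord a < 0 → Odd (v.ord a)) ∧
      ∀ x, x ∈ SIntegers S ↔ IsIntegral (Algebra.adjoin k {a}) x := by
  classical
  have hfin : {v ∈ S | ∃ x ∈ SIntegers S, v.ord x < 0}.Finite := hS.subset (Set.sep_subset _ _)
  set S₀ := hfin.toFinset with hS₀
  have hmem : ∀ v : FFPrime k K, v ∈ S₀ ↔ ∃ x ∈ SIntegers S, v.ord x < 0 := fun v => by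
    rw [hS₀, Set.Finite.mem_toFinset]
    refine ⟨fun h => h.2, fun h => ⟨?_, h⟩⟩
    by_contra hv
    obtain ⟨x, hx, hxv⟩ := h
    have := hx v hv
    omega
  obtain ⟨v₀, hv₀⟩ : ∃ v, v ∈ S₀ := by
    obtain ⟨v, hv⟩ := h.exists_pole hTt
    exact ⟨v, (hmem v).2 ⟨T, hT, hv⟩⟩
  obtain ⟨e, heR, he⟩ := FFPrime.exists_mem_forall_neg (SIntegers S) S₀ (fun v hv => (hmem v).1 hv)
  have he0 : e ≠ 0 := by
    rintro rfl
    have := he v₀ hv₀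
    simp [v₀.ord_zero'] at this
  have het : Transcendental k e := FFPrime.transcendental_of_ord_neg (he v₀ hv₀)
  obtain ⟨f, hf0, hf⟩ := FFPrime.exists_odd S₀
  obtain ⟨q, hq0, hq, hfq⟩ : ∃ q : K, q ≠ 0 ∧ q ∈ SIntegers S ∧ f * q ∈ SIntegers S := by
    obtain ⟨-, hfr⟩ := isDedekindDomain_integralClosure_adjoin het (h.finiteDimensional het)
    have hsub : ∀ z : integralClosure (Algebra.adjoin k {e}) K, (z : K) ∈ SIntegers S :=
      fun z v hv => v.ord_nonneg_of_isIntegral_adjoin (heR v hv) z.2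
    obtain ⟨⟨p, q⟩, hpq⟩ :=
      IsLocalization.surj (nonZeroDivisors (integralClosure (Algebra.adjoin k {e}) K)) f
    refine ⟨q, ?_, hsub _, ?_⟩
    · simp
    · have := hsub p
      rwa [show (p : K) = f * q from hpq.symm] at this
  obtain ⟨m, hm0, hm⟩ := FFPrime.exists_nat_forall_lt S₀ (fun v => v.ord (f * q * q))
  have hfqq0 : f * q * q ≠ 0 := by positivity
  have hord : ∀ v : FFPrime k K, v.ord (f * q * q * e ^ (2 * m)) =
      v.ord f + 2 * v.ord q + 2 * m * v.ord e := fun v => by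
    rw [v.ord_mul hfqq0 (by positivity), v.ord_mul (by positivity) hq0, v.ord_mul hf0 hq0,
      v.ord_pow he0]
    push_cast
    ring
  have haR : f * q * q * e ^ (2 * m) ∈ SIntegers S :=
    mul_mem (mul_mem hfq hq) (pow_mem heR _)
  have hneg : ∀ v ∈ S₀, v.ord (f * q * q * e ^ (2 * m)) < 0 := fun v hv => by
    have h1 := hm v hv
    have h2 := he v hv
    rw [v.ord_mul (by positivity) hq0, v.ord_mul hf0 hq0] at h1
    rw [hord]
    nlinarith
  have hat := FFPrime.transcendental_of_ord_neg (hneg v₀ hv₀)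
  refine ⟨_, haR, hat, fun v hv => ?_, fun x => ⟨fun hx => ?_, fun hx v hv => ?_⟩⟩
  · have := hf v ((hmem v).2 ⟨_, haR, hv⟩)
    obtain ⟨j, hj⟩ := this
    rw [hord, hj]
    exact ⟨j + v.ord q + m * v.ord e, by ring⟩
  · by_contra hni
    obtain ⟨v, hv1, hv2⟩ := FFPrime.exists_ord_neg hat (h.finiteDimensional hat) hni
    have := hneg v ((hmem v).2 ⟨x, hx, hv2⟩)
    omega
  · exact v.ord_nonneg_of_isIntegral_adjoin (haR v hv) hx

open Polynomial in
/-- Elements whose constant linear combinations are units at some zero of `s` are linearly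
independent over `F(s)`. -/
theorem FFPrime.sum_aeval_mul_eq_zero {F L : Type*} [Field F] [Field L] [Algebra F L] {s : L}
    (hs : s ≠ 0) {n : ℕ} (y : Fin n → L)
    (hy : ∀ c : Fin n → F, c ≠ 0 → ∃ v : FFPrime F L, 0 < v.ord s ∧ (∀ i, 0 ≤ v.ord (y i)) ∧
      ¬ v.Le 1 (∑ i, algebraMap F L (c i) * y i))
    (p : Fin n → F[X]) (hp : ∑ i, aeval s (p i) * y i = 0) : p = 0 := by
  have key : ∀ p : Fin n → F[X], ∑ i, aeval s (p i) * y i = 0 → ∀ i, X ∣ p i := by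
    intro p hp
    by_contra! hX
    obtain ⟨i, hi⟩ := hX
    obtain ⟨v, hv, hvy, hc⟩ := hy (fun i => (p i).coeff 0) (fun h => hi (by
      rw [X_dvd_iff]
      exact congrFun h i))
    apply hc
    have h1 : ∑ i, algebraMap F L ((p i).coeff 0) * y i =
        -(s * ∑ i, aeval s (p i).divX * y i) := by
      rw [eq_neg_iff_add_eq_zero, ← hp, Finset.mul_sum, ← Finset.sum_add_distrib]
      refine Finset.sum_congr rfl fun i _ => ?_
      conv_rhs => rw [← divX_mul_X_add (p i)]
      simp
      ring
    rw [h1]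
    refine Le.neg ?_
    have h2 : v.Le 1 s := Or.inr hv
    have h3 : v.Le 0 (∑ i, aeval s (p i).divX * y i) := Le.sum _ fun i _ => by
      have h4 : 0 ≤ v.ord (aeval s (p i).divX) :=
        v.ord_nonneg_of_mem_adjoin hv.le (aeval_mem_adjoin_singleton F s)
      exact (le_zero_iff.2 h4).mul (le_zero_iff.2 (hvy i))
    exact (h2.mul h3).mono (by norm_num)
  have key2 : ∀ (m : ℕ) (i : Fin n), X ^ m ∣ p i := by
    intro m
    induction m with
    | zero => simp
    | succ m ih =>
      choose q hq using ih
      have h1 : ∑ i, aeval s (q i) * y i = 0 := by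
        have h2 : s ^ m * ∑ i, aeval s (q i) * y i = 0 := by
          rw [← hp, Finset.mul_sum]
          refine Finset.sum_congr rfl fun i _ => ?_
          rw [hq i]
          simp
          ring
        exact (mul_eq_zero.1 h2).resolve_left (pow_ne_zero m hs)
      intro i
      rw [hq i, pow_succ]
      exact mul_dvd_mul_left _ (key q h1 i)
  funext i
  by_contra h
  have h1 := natDegree_le_of_dvd (key2 ((p i).natDegree + 1) i) h
  rw [natDegree_X_pow] at h1
  omega

namespace IsFunctionField

open IntermediateField.algebraAdjoinAdjoin

variable {F L : Type*} [Field F] [Field L] [Algebra F L]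

theorem card_le_finrank (h : IsFunctionField F L) {s : L} (hs : Transcendental F s) {n : ℕ}
    (y : Fin n → L)
    (hy : ∀ c : Fin n → F, c ≠ 0 → ∃ v : FFPrime F L, 0 < v.ord s ∧ (∀ i, 0 ≤ v.ord (y i)) ∧
      ¬ v.Le 1 (∑ i, algebraMap F L (c i) * y i)) :
    n ≤ Module.finrank (IntermediateField.adjoin F {s}) L := by
  have := h.finiteDimensional hs
  have hs0 : s ≠ 0 := fun h0 => hs (h0 ▸ isAlgebraic_zero)
  have h1 : LinearIndependent (Algebra.adjoin F {s}) y := by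
    rw [Fintype.linearIndependent_iff]
    intro g hg
    have h2 : ∀ i, ∃ p : Polynomial F, Polynomial.aeval s p = (g i : L) := fun i => by
      obtain ⟨z, hz⟩ := g i
      rwa [Algebra.adjoin_singleton_eq_range_aeval] at hz
    choose p hp using h2
    have h3 := FFPrime.sum_aeval_mul_eq_zero hs0 y hy p (by simpa [hp, Algebra.smul_def] using hg)
    intro i
    have := hp i
    rw [h3] at this
    simpa using this.symm
  have h2 := (LinearIndependent.iff_fractionRing (Algebra.adjoin F {s})
    (IntermediateField.adjoin F {s})).1 h1
  simpa using h2.fintype_card_le_finrank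

/-- An element has only finitely many zeros. -/
theorem finite_zeros (h : IsFunctionField F L) {s : L} (hs : Transcendental F s) :
    {v : FFPrime F L | 0 < v.ord s}.Finite := by
  classical
  by_contra hinf
  obtain ⟨T, hT, hcard⟩ := Set.Infinite.exists_subset_card_eq hinf
    (Module.finrank (IntermediateField.adjoin F {s}) L + 1)
  have hex : ∀ v : T, ∃ y : L, y ≠ 0 ∧ (v : FFPrime F L).ord y = 0 ∧
      ∀ u ∈ T.erase v, 0 < u.ord y := by
    intro v
    obtain ⟨z, hz0, hzv, hz⟩ := FFPrime.exists_separating (v : FFPrime F L) (T.erase v) (by simp)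
    obtain ⟨h1, h2⟩ := (v : FFPrime F L).ord_add_eq (y := 1) hz0 (Or.inr (by
      rw [FFPrime.ord_one]
      omega))
    refine ⟨z * (z + 1)⁻¹, mul_ne_zero hz0 (inv_ne_zero h1), ?_, fun u hu => ?_⟩
    · rw [FFPrime.ord_mul _ hz0 (inv_ne_zero h1), FFPrime.ord_inv _ h1, h2]
      ring
    · have h3 := (u.ord_add_eq (y := z) one_ne_zero (Or.inr (by
        rw [FFPrime.ord_one]
        have := hz u hu
        omega))).2
      rw [FFPrime.ord_mul _ hz0 (inv_ne_zero h1), FFPrime.ord_inv _ h1, add_comm z, h3,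
        FFPrime.ord_one]
      simpa using hz u hu
  choose y hy0 hyv hyu using hex
  let e := T.equivFinOfCardEq hcard
  have := h.card_le_finrank hs (fun i => y (e.symm i)) (by
    intro c hc
    obtain ⟨i, hi⟩ := Function.ne_iff.1 hc
    have hpos : ∀ j ≠ i, 0 < (e.symm i : FFPrime F L).ord (y (e.symm j)) := fun j hj =>
      hyu (e.symm j) _ (Finset.mem_erase.2 ⟨fun h => hj (e.symm.injective (Subtype.ext h)).symm,
        (e.symm i).2⟩)
    refine ⟨e.symm i, hT (e.symm i).2, fun j => ?_, fun hle => ?_⟩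
    · rcases eq_or_ne j i with rfl | hj
      · exact (hyv _).ge
      · exact (hpos j hj).le
    · rw [← Finset.add_sum_erase _ _ (Finset.mem_univ i)] at hle
      have h1 : (e.symm i : FFPrime F L).Le 1
          (∑ j ∈ Finset.univ.erase i, algebraMap F L (c j) * y (e.symm j)) :=
        FFPrime.Le.sum _ fun j hj => by
          have := (FFPrime.le_algebraMap (v := (e.symm i : FFPrime F L)) (c j)).mul
            (Or.inr (hpos j (Finset.ne_of_mem_erase hj)) : FFPrime.Le _ 1 _)
          exact this.mono (by norm_num)
      have h2 := hle.sub h1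
      rw [add_sub_cancel_right] at h2
      have hci : algebraMap F L (c i) ≠ 0 := by simpa using hi
      have h3 := h2.ord_le (mul_ne_zero hci (hy0 _))
      rw [FFPrime.ord_mul _ hci (hy0 _), FFPrime.ord_algebraMap _ hi, hyv] at h3
      omega)
  omega

theorem finite_poles (h : IsFunctionField F L) (x : L) :
    {v : FFPrime F L | v.ord x < 0}.Finite := by
  by_cases hx : Transcendental F x
  · have hx' : Transcendental F x⁻¹ := fun h' => hx (by simpa using h'.inv)
    refine (h.finite_zeros hx').subset fun v (hv : v.ord x < 0) => ?_
    have hx0 : x ≠ 0 := fun h0 => hx (h0 ▸ isAlgebraic_zero)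
    change 0 < v.ord x⁻¹
    rw [v.ord_inv hx0]
    omega
  · refine Set.Finite.subset Set.finite_empty fun v (hv : v.ord x < 0) => ?_
    exact absurd (FFPrime.transcendental_of_ord_neg hv) hx

/-- Residue fields are finite over the field of constants. -/
theorem finite_residueField (h : IsFunctionField F L) (v : FFPrime F L)
    [Algebra F (IsLocalRing.ResidueField v.valuationSubring)]
    (halg : ∀ (c : F) (hc : 0 ≤ v.ord (algebraMap F L c)),
      algebraMap F (IsLocalRing.ResidueField v.valuationSubring) c =
        IsLocalRing.residue _ ⟨algebraMap F L c, hc⟩) :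
    FiniteDimensional F (IsLocalRing.ResidueField v.valuationSubring) := by
  obtain ⟨s, hs0, hs⟩ := v.exists_uniformizer
  have hst : Transcendental F s := fun hh => by
    rw [v.ord_eq_zero_of_isAlgebraic hh] at hs
    omega
  rw [FiniteDimensional, ← Module.rank_lt_aleph0_iff]
  by_contra! hrank
  obtain ⟨b, hb, hlin⟩ := Module.le_rank_iff_exists_finset.1
    (Cardinal.natCast_lt_aleph0.le.trans hrank :
      ((Module.finrank (IntermediateField.adjoin F {s}) L + 1 : ℕ) : Cardinal) ≤ _)
  let e := b.equivFinOfCardEq hb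
  choose y hy using fun i =>
    IsLocalRing.residue_surjective (R := v.valuationSubring) (e.symm i : IsLocalRing.ResidueField _)
  have := h.card_le_finrank hst (fun i => (y i : L)) (by
    intro c hc
    refine ⟨v, by omega, fun i => (y i).2, fun hle => hc ?_⟩
    have hc0 : ∀ i, 0 ≤ v.ord (algebraMap F L (c i)) := fun i =>
      FFPrime.le_zero_iff.1 (FFPrime.le_algebraMap _)
    let z : v.valuationSubring := ∑ i, ⟨algebraMap F L (c i), hc0 i⟩ * y i
    have hz : (z : L) = ∑ i, algebraMap F L (c i) * y i := by
      simp [z]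
    have hres : IsLocalRing.residue _ z = 0 := by
      rw [IsLocalRing.residue_eq_zero_iff, IsLocalRing.mem_maximalIdeal, mem_nonunits_iff]
      intro hu
      obtain ⟨w, hw⟩ := hu.exists_right_inv
      have hw' : (z : L) * w = 1 := congrArg Subtype.val hw
      have h1 := (hle.mul (FFPrime.le_zero_iff.2 w.2)).ord_le (by
        rw [← hz, hw']
        exact one_ne_zero)
      rw [← hz, hw', v.ord_one] at h1
      omega
    have hsum : ∑ i, c i • (e.symm i : IsLocalRing.ResidueField v.valuationSubring) = 0 := by
      rw [← hres]
      simp only [z, map_sum, map_mul, hy, Algebra.smul_def, halg _ (hc0 _)]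
    have hlin' : LinearIndependent F
        (fun i => (e.symm i : IsLocalRing.ResidueField v.valuationSubring)) :=
      LinearIndependent.comp hlin e.symm e.symm.injective
    funext i
    exact Fintype.linearIndependent_iff.1 hlin' c hsum i)
  omega

end IsFunctionField

open Polynomial

theorem Int.exists_prime_dvd_eval {f : ℤ[X]} (hf : 0 < f.natDegree) (m : ℕ) :
    ∃ (n : ℤ) (l : ℕ), l.Prime ∧ m < l ∧ (l : ℤ) ∣ f.eval n := by
  by_cases hroot : ∃ n : ℤ, f.eval n = 0
  · obtain ⟨n, hn⟩ := hroot
    obtain ⟨l, hl, hlp⟩ := Nat.exists_infinite_primes (m + 1)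
    exact ⟨n, l, hlp, hl, hn ▸ dvd_zero _⟩
  push Not at hroot
  set c := f.eval 0 with hc
  have hc0 : c ≠ 0 := hroot 0
  have hm0 : (m.factorial : ℤ) ≠ 0 := by exact_mod_cast m.factorial_ne_zero
  have hne : ∀ d : ℤ, f - C d ≠ 0 := fun d h => by
    rw [sub_eq_zero.1 h, natDegree_C] at hf
    exact lt_irrefl _ hf
  have hinj : Function.Injective (fun x : ℤ => c * m.factorial * x) :=
    mul_right_injective₀ (mul_ne_zero hc0 hm0)
  obtain ⟨x, hx⟩ := Set.Infinite.nonempty (s := {x : ℤ | c * m.factorial * x ∉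
      ((f - C c) * (f - C (-c))).roots.toFinset}) (by
    have h1 : (((fun x : ℤ => c * m.factorial * x) ⁻¹'
      (((f - C c) * (f - C (-c))).roots.toFinset : Set ℤ))).Finite :=
      Set.Finite.preimage hinj.injOn (Finset.finite_toSet _)
    exact h1.infinite_compl)
  have hx' : f.eval (c * m.factorial * x) ≠ c ∧ f.eval (c * m.factorial * x) ≠ -c := by
    have : c * m.factorial * x ∉ ((f - C c) * (f - C (-c))).roots.toFinset := hx
    rw [Multiset.mem_toFinset, mem_roots (mul_ne_zero (hne c) (hne _)), IsRoot.def, eval_mul,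
      mul_eq_zero, not_or] at this
    simpa [sub_eq_zero, add_eq_zero_iff_eq_neg] using this
  obtain ⟨q, hq⟩ := sub_dvd_eval_sub (c * m.factorial * x) 0 f
  rw [← hc] at hq
  have hfc : f.eval (c * m.factorial * x) = c * (1 + m.factorial * (x * q)) := by
    linear_combination hq
  set g : ℤ := 1 + m.factorial * (x * q) with hg
  have hg1 : g.natAbs ≠ 1 := by
    intro h
    rcases Int.natAbs_eq g with h' | h' <;> rw [h] at h'
    · exact hx'.1 (by rw [hfc, h']; simp)
    · exact hx'.2 (by rw [hfc, h']; simp)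
  refine ⟨c * m.factorial * x, g.natAbs.minFac, Nat.minFac_prime hg1, ?_, ?_⟩
  · by_contra! hle
    have h1 : g.natAbs.minFac ∣ m.factorial :=
      Nat.dvd_factorial (Nat.minFac_pos _) hle
    have h2 : (g.natAbs.minFac : ℤ) ∣ g := Int.natCast_dvd.2 (Nat.minFac_dvd _)
    have h3 : (g.natAbs.minFac : ℤ) ∣ 1 := by
      have h4 : (g.natAbs.minFac : ℤ) ∣ m.factorial * (x * q) :=
        (Int.natCast_dvd_natCast.2 h1).mul_right _
      have h5 := dvd_sub h2 h4
      rwa [hg, add_sub_cancel_right] at h5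
    have := Int.natCast_dvd_natCast.1 (by exact_mod_cast h3 : ((g.natAbs.minFac : ℕ) : ℤ) ∣ (1 : ℕ))
    exact hg1 (Nat.minFac_eq_one_iff.1 (Nat.dvd_one.1 this))
  · rw [hfc]
    exact (Int.natCast_dvd.2 (Nat.minFac_dvd _)).mul_left _

/-- A number field embeds into infinitely many fields of `p`-adic numbers. -/
theorem exists_ringHom_padic (Ω : Type*) [Field Ω] [CharZero Ω] [FiniteDimensional ℚ Ω] (m : ℕ) :
    ∃ (l : ℕ) (_ : Fact l.Prime), m < l ∧ Nonempty (Ω →+* ℚ_[l]) := by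
  obtain ⟨θ₀, hθ₀⟩ := Field.exists_primitive_element ℚ Ω
  obtain ⟨θ, hθ, hint⟩ : ∃ θ : Ω, IntermediateField.adjoin ℚ {θ} = ⊤ ∧ IsIntegral ℤ θ := by
    obtain ⟨d, hd0, hd⟩ := ((IsFractionRing.isAlgebraic_iff ℤ ℚ Ω).2
      (Algebra.IsAlgebraic.isAlgebraic θ₀)).exists_integral_multiple
    refine ⟨_, ?_, hd⟩
    rw [← top_le_iff, ← hθ₀, IntermediateField.adjoin_simple_le_iff]
    have h1 := IntermediateField.mem_adjoin_simple_self ℚ (d • θ₀)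
    have h2 := IntermediateField.smul_mem _ (x := (d : ℚ)⁻¹) h1
    have hd0' : (d : Ω) ≠ 0 := by exact_mod_cast hd0
    convert h2 using 1
    simp [Algebra.smul_def, hd0']
  have hfQ : (minpoly ℤ θ).map (algebraMap ℤ ℚ) = minpoly ℚ θ :=
    (minpoly.isIntegrallyClosed_eq_field_fractions' ℚ hint).symm
  set f := minpoly ℤ θ with hf
  have hfmonic : f.Monic := minpoly.monic hint
  have hdeg : 0 < f.natDegree := minpoly.natDegree_pos hint
  obtain ⟨U, V, r, hr0, hUV⟩ : ∃ (U V : ℤ[X]) (r : ℤ), r ≠ 0 ∧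
      U * f + V * derivative f = C r := by
    obtain ⟨u, v, huv⟩ : (minpoly ℚ θ).Separable :=
      (minpoly.irreducible (Algebra.IsIntegral.isIntegral θ)).separable
    obtain ⟨b, hb, hb'⟩ := IsLocalization.integerNormalization_spec (nonZeroDivisors ℤ) u
    obtain ⟨c, hc, hc'⟩ := IsLocalization.integerNormalization_spec (nonZeroDivisors ℤ) v
    refine ⟨C c * IsLocalization.integerNormalization (nonZeroDivisors ℤ) u,
      C b * IsLocalization.integerNormalization (nonZeroDivisors ℤ) v, b * c,
      mul_ne_zero (nonZeroDivisors.ne_zero hb) (nonZeroDivisors.ne_zero hc), ?_⟩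
    apply map_injective (algebraMap ℤ ℚ) (RingHom.injective_int _)
    simp only [Polynomial.map_add, Polynomial.map_mul, hb', hc', hfQ,
      ← derivative_map]
    simp only [zsmul_eq_mul]
    simp
    linear_combination (b * c : ℚ[X]) * huv
  obtain ⟨n, l, hl, hml, hdvd⟩ := Int.exists_prime_dvd_eval hdeg (m + r.natAbs)
  have : Fact l.Prime := ⟨hl⟩
  refine ⟨l, this, by omega, ?_⟩
  have hf0 : ‖f.aeval (n : ℤ_[l])‖ < 1 := by
    have : f.aeval (n : ℤ_[l]) = ((f.eval n : ℤ) : ℤ_[l]) := by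
      simpa using aeval_algebraMap_apply ℤ_[l] n f
    rw [this, PadicInt.norm_intCast_lt_one_iff]
    exact hdvd
  have hf1 : ‖f.derivative.aeval (n : ℤ_[l])‖ = 1 := by
    have : f.derivative.aeval (n : ℤ_[l]) = ((f.derivative.eval n : ℤ) : ℤ_[l]) := by
      simpa using aeval_algebraMap_apply ℤ_[l] n f.derivative
    refine le_antisymm (PadicInt.norm_le_one _) ?_
    by_contra! hlt
    rw [this, PadicInt.norm_intCast_lt_one_iff] at hlt
    have h1 := congrArg (eval n) hUV
    simp only [eval_add, eval_mul, eval_C] at h1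
    have h2 : (l : ℤ) ∣ r := h1 ▸ dvd_add (hdvd.mul_left _) (hlt.mul_left _)
    have := Nat.le_of_dvd (Int.natAbs_pos.2 hr0) (Int.natCast_dvd.1 h2)
    omega
  obtain ⟨z, hz, -⟩ := hensels_lemma (p := l) (R := ℤ) (F := f) (a := (n : ℤ_[l]))
    (by rw [hf1]; simpa using hf0)
  have hz' : aeval (z : ℚ_[l]) (minpoly ℚ θ) = 0 := by
    rw [← hfQ, aeval_map_algebraMap]
    have := congrArg (algebraMap ℤ_[l] ℚ_[l]) hz
    rw [← aeval_algebraMap_apply] at this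
    simpa using this
  let pb := IntermediateField.adjoin.powerBasis (K := ℚ) (x := θ) (Algebra.IsIntegral.isIntegral θ)
  let e : Ω ≃ₐ[ℚ] IntermediateField.adjoin ℚ {θ} :=
    (IntermediateField.topEquiv.symm.trans (IntermediateField.equivOfEq hθ.symm))
  exact ⟨(pb.lift (z : ℚ_[l]) (by
    rw [IntermediateField.adjoin.powerBasis_gen, IntermediateField.minpoly_gen]
    exact hz')).toRingHom.comp e.toRingHom⟩

/-- Simultaneous embeddings of finitely many number fields. -/
theorem exists_ringHoms_padic {ι : Type*} [Finite ι] (κ : ι → Type*) [∀ i, Field (κ i)]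
    [∀ i, CharZero (κ i)] [∀ i, FiniteDimensional ℚ (κ i)] (m : ℕ) :
    ∃ (l : ℕ) (_ : Fact l.Prime), m < l ∧ ∀ i, Nonempty (κ i →+* ℚ_[l]) := by
  let f : ∀ i, κ i →ₐ[ℚ] AlgebraicClosure ℚ := fun i => IsAlgClosed.lift
  have h1 : ∀ i, FiniteDimensional ℚ (f i).fieldRange := fun i =>
    Module.Finite.equiv (AlgEquiv.ofInjectiveField (f i)).toLinearEquiv
  have h2 : FiniteDimensional ℚ (⨆ i, (f i).fieldRange : IntermediateField ℚ _) :=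
    IntermediateField.finiteDimensional_iSup_of_finite
  obtain ⟨l, hl, hml, ⟨ψ⟩⟩ := exists_ringHom_padic
    (⨆ i, (f i).fieldRange : IntermediateField ℚ (AlgebraicClosure ℚ)) m
  exact ⟨l, hl, hml, fun i => ⟨ψ.comp ((f i).toRingHom.codRestrict _ fun x =>
    le_iSup (fun i => (f i).fieldRange) i ⟨x, rfl⟩)⟩⟩

theorem IsFunctionField.exists_residue_maps {K : Type*} [Field K] [CharZero K]
    (h : IsFunctionField ℚ K) {V : Set (FFPrime ℚ K)} (hV : V.Finite) (m : ℕ) :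
    ∃ (l : ℕ) (_ : Fact l.Prime), m < l ∧
      ∀ v ∈ V, ∃ φ : v.valuationSubring →+* ℚ_[l],
        ∀ x : v.valuationSubring, 0 < v.ord (x : K) → φ x = 0 := by
  have hQ : ∀ (v : FFPrime ℚ K) (c : ℚ), algebraMap ℚ K c ∈ v.valuationSubring := fun v c =>
    FFPrime.le_zero_iff.1 (FFPrime.le_algebraMap c)
  have hchar : ∀ v : FFPrime ℚ K, CharZero (IsLocalRing.ResidueField v.valuationSubring) :=
    fun v => charZero_of_injective_ringHom ((IsLocalRing.residue v.valuationSubring).comp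
      ((algebraMap ℚ K).codRestrict v.valuationSubring.toSubring (hQ v))).injective
  have hfin : ∀ v : FFPrime ℚ K,
      FiniteDimensional ℚ (IsLocalRing.ResidueField v.valuationSubring) := fun v =>
    h.finite_residueField v fun c hc => DFunLike.congr_fun (Subsingleton.elim
      (algebraMap ℚ (IsLocalRing.ResidueField v.valuationSubring))
      ((IsLocalRing.residue v.valuationSubring).comp
        ((algebraMap ℚ K).codRestrict v.valuationSubring.toSubring (hQ v)))) c
  have : Finite V := hV
  obtain ⟨l, hl, hml, hφ⟩ := exists_ringHoms_padic
    (fun v : V => IsLocalRing.ResidueField (v : FFPrime ℚ K).valuationSubring) m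
  refine ⟨l, hl, hml, fun v hv => ?_⟩
  obtain ⟨φ⟩ := hφ ⟨v, hv⟩
  refine ⟨φ.comp (IsLocalRing.residue _), fun x hx => ?_⟩
  have : IsLocalRing.residue v.valuationSubring x = 0 := by
    rw [IsLocalRing.residue_eq_zero_iff, IsLocalRing.mem_maximalIdeal, mem_nonunits_iff]
    intro hu
    obtain ⟨w, hw⟩ := hu.exists_right_inv
    have hw' : (x : K) * w = 1 := congrArg Subtype.val hw
    have hx0 : (x : K) ≠ 0 := left_ne_zero_of_mul_eq_one hw'
    have hw0 : (w : K) ≠ 0 := right_ne_zero_of_mul_eq_one hw'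
    have h1 := v.ord_mul hx0 hw0
    have h2 : 0 ≤ v.ord (w : K) := w.2
    rw [hw', v.ord_one] at h1
    omega
  simp [this]

set_option linter.unusedSectionVars false
set_option linter.style.haveILetI false

namespace FFPrime

variable {F L : Type*} [Field F] [Field L] [Algebra F L] {v : FFPrime F L}

theorem le_aeval {x : L} (hx : v.ord x < 0) {p : F[X]} {n : ℕ} (hp : p.natDegree ≤ n) :
    v.Le (n * v.ord x) (aeval x p) := by
  rw [aeval_eq_sum_range]
  refine Le.sum _ fun i hi => ?_
  rw [Algebra.smul_def]
  refine ((le_algebraMap (p.coeff i)).mul ((Le.refl x).pow i)).mono ?_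
  have : (i : ℤ) ≤ n := by
    have := Finset.mem_range.1 hi
    omega
  nlinarith

theorem ord_aeval {x : L} (hx : v.ord x < 0) {p : F[X]} (hp : p ≠ 0) :
    aeval x p ≠ 0 ∧ v.ord (aeval x p) = p.natDegree * v.ord x := by
  have hx0 : x ≠ 0 := by
    rintro rfl
    simp [v.ord_zero'] at hx
  have hlead : algebraMap F L p.leadingCoeff ≠ 0 := by simpa using hp
  have hl : v.ord (algebraMap F L p.leadingCoeff) = 0 :=
    v.ord_algebraMap (by simpa using hp)
  have hord : v.ord (algebraMap F L p.leadingCoeff * x ^ p.natDegree) = p.natDegree * v.ord x := by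
    rw [v.ord_mul hlead (pow_ne_zero _ hx0), v.ord_pow hx0, hl, zero_add]
  rw [← eraseLead_add_C_mul_X_pow p]
  simp only [map_add, map_mul, map_pow, aeval_C, aeval_X]
  rw [add_comm, eraseLead_add_C_mul_X_pow, ← hord]
  refine ord_add_eq (mul_ne_zero hlead (pow_ne_zero _ hx0)) ?_
  rw [hord]
  rcases eraseLead_natDegree_lt_or_eraseLead_eq_zero p with h | h
  · refine (le_aeval hx (n := p.natDegree - 1) (by omega)).mono ?_
    push_cast [show 1 ≤ p.natDegree by omega]
    nlinarith
  · rw [h]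
    simpa using Le.zero _

end FFPrime

theorem RingHom.IsIntegralElem.norm {A F K : Type*} [CommRing A] [Field F] [Field K] [Algebra F K]
    [FiniteDimensional F K] (φ : A →+* F) {x : K}
    (hx : ((algebraMap F K).comp φ).IsIntegralElem x) : φ.IsIntegralElem (Algebra.norm F x) := by
  letI := φ.toAlgebra
  letI := ((algebraMap F K).comp φ).toAlgebra
  haveI : IsScalarTower A F K := IsScalarTower.of_algebraMap_eq fun _ => rfl
  exact Algebra.isIntegral_norm (R := A) F (x := x) hx

/-- The image of `X` in `K`. -/
noncomputable def genK (K : Type*) [Field K] [Algebra ℚ[X] K] : K := algebraMap ℚ[X] K X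

/-- A ring of integers `R`, finite and free over `ℚ[X]`, of a function field `K` over `ℚ`, such
that the image of `X` has odd order at each of its poles. -/
structure OddPoles (R K : Type*) [CommRing R] [Algebra ℚ[X] R] [Field K] [CharZero K]
    [Algebra R K] [Algebra ℚ[X] K] : Prop where
  isFunctionField : IsFunctionField ℚ K
  odd : ∀ v : FFPrime ℚ K, v.ord (genK K) < 0 → Odd (v.ord (genK K))

theorem algebraMap_X_eq_genK {K : Type*} [Field K] [Algebra ℚ[X] K] :
    algebraMap ℚ[X] K X = genK K := rfl

namespace OddPoles

theorem algebraMap_eq_aeval {K : Type*} [Field K] [CharZero K] [Algebra ℚ[X] K] (p : ℚ[X]) :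
    algebraMap ℚ[X] K p = aeval (genK K) p := by
  have : (algebraMap ℚ[X] K) = (aeval (genK K) : ℚ[X] →ₐ[ℚ] K).toRingHom := by
    refine Polynomial.ringHom_ext' (Subsingleton.elim _ _) ?_
    simp [algebraMap_X_eq_genK]
  exact DFunLike.congr_fun this p

theorem algebraMap_injective (R : Type*) {K : Type*} [CommRing R] [IsDomain R] [Algebra ℚ[X] R]
    [Module.Free ℚ[X] R] [Field K] [Algebra R K] [Algebra ℚ[X] K]
    [IsScalarTower ℚ[X] R K] [IsFractionRing R K] : Function.Injective (algebraMap ℚ[X] K) := by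
  rw [IsScalarTower.algebraMap_eq ℚ[X] R K]
  exact (IsFractionRing.injective R K).comp (FaithfulSMul.algebraMap_injective ℚ[X] R)

theorem transcendental_genK (R : Type*) {K : Type*} [CommRing R] [IsDomain R] [Algebra ℚ[X] R]
    [Module.Free ℚ[X] R] [Field K] [CharZero K] [Algebra R K] [Algebra ℚ[X] K]
    [IsScalarTower ℚ[X] R K] [IsFractionRing R K] : Transcendental ℚ (genK K) := by
  rw [transcendental_iff]
  intro p hp
  rw [← algebraMap_eq_aeval] at hp
  exact (map_eq_zero_iff _ (algebraMap_injective R)).1 hp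

variable {R K : Type*} [CommRing R] [IsDomain R] [Algebra ℚ[X] R] [Module.Finite ℚ[X] R]
  [Module.Free ℚ[X] R] [Field K] [CharZero K] [Algebra R K] [Algebra ℚ[X] K]
  [IsScalarTower ℚ[X] R K] [IsFractionRing R K]

theorem ord_nonneg (x : R) {v : FFPrime ℚ K} (hv : 0 ≤ v.ord (genK K)) :
    0 ≤ v.ord (algebraMap R K x) := by
  refine v.ord_nonneg_of_isIntegral (A := ℚ[X]) (fun p => ?_)
    ((Algebra.IsIntegral.isIntegral (R := ℚ[X]) x).algebraMap (B := K))
  rw [algebraMap_eq_aeval]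
  exact v.ord_nonneg_of_mem_adjoin hv (aeval_mem_adjoin_singleton _ _)

theorem exists_pole (h : OddPoles R K) : ∃ v : FFPrime ℚ K, v.ord (genK K) < 0 :=
  h.isFunctionField.exists_pole (transcendental_genK R)

/-- Orders at the poles of `X` bound the degree of the norm. -/
theorem natDegree_norm_le (h : OddPoles R K) {x : R} {n : ℕ}
    (hx : ∀ v : FFPrime ℚ K, v.ord (genK K) < 0 →
      v.Le (n * v.ord (genK K)) (algebraMap R K x)) :
    (Algebra.norm ℚ[X] x).natDegree ≤ n * Module.finrank ℚ[X] R := by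
  have hinj := algebraMap_injective R (K := K)
  haveI : FaithfulSMul ℚ[X] K := (faithfulSMul_iff_algebraMap_injective _ _).2 hinj
  have htr : Transcendental ℚ (genK K) := transcendental_genK R
  have ha0 : genK K ≠ 0 := fun h0 => htr (h0 ▸ isAlgebraic_zero)
  rcases eq_or_ne x 0 with rfl | hx0
  · haveI : Nontrivial R := inferInstance
    simp [Algebra.norm_zero]
  let F := FractionRing ℚ[X]
  letI : Algebra F K := FractionRing.liftAlgebra ℚ[X] K
  haveI : FiniteDimensional F K := by
    have : Module.Finite (Localization (nonZeroDivisors ℚ[X]))  K :=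
      Module.Finite.of_isLocalization ℚ[X] R (nonZeroDivisors ℚ[X])
    exact this
  let φ : ℚ[X] →+* F := (aeval (algebraMap ℚ[X] F X)⁻¹ : ℚ[X] →ₐ[ℚ] F).toRingHom
  have hφ : ∀ p, algebraMap F K (φ p) = aeval (genK K)⁻¹ p := fun p => by
    simp only [φ, AlgHom.toRingHom_eq_coe, RingHom.coe_coe]
    rw [← aeval_algebraMap_apply, map_inv₀, ← IsScalarTower.algebraMap_apply,
      algebraMap_X_eq_genK]
  set y : K := algebraMap R K x * ((genK K) ^ n)⁻¹ with hy
  have hyint : ((algebraMap F K).comp φ).IsIntegralElem y := by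
    have htr' : Transcendental ℚ (genK K)⁻¹ := fun h' => htr (by simpa using h'.inv)
    by_contra hni
    have hni' : ¬ IsIntegral (Algebra.adjoin ℚ {(genK K)⁻¹}) y := by
      rintro ⟨q, hqm, hq⟩
      have hrange : ∀ c : Algebra.adjoin ℚ {(genK K)⁻¹}, ∃ p : ℚ[X], aeval (genK K)⁻¹ p = c := by
        intro c
        exact (Algebra.adjoin_singleton_eq_range_aeval ℚ (genK K)⁻¹).le c.2
      have : q.map (algebraMap (Algebra.adjoin ℚ {(genK K)⁻¹}) K) ∈
          Polynomial.lifts ((algebraMap F K).comp φ) := by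
        rw [Polynomial.lifts_iff_coeff_lifts]
        intro i
        obtain ⟨p, hp⟩ := hrange (q.coeff i)
        refine ⟨p, ?_⟩
        rw [coeff_map]
        simpa [hφ] using hp
      obtain ⟨q', hq', -, hq'm⟩ := Polynomial.lifts_and_natDegree_eq_and_monic this (hqm.map _)
      refine hni ⟨q', hq'm, ?_⟩
      rw [← eval_map, hq', eval_map]
      exact hq
    obtain ⟨v, hv1, hv2⟩ := FFPrime.exists_ord_neg htr' (h.isFunctionField.finiteDimensional htr')
      hni'
    rw [v.ord_inv ha0] at hv1
    have hxK : algebraMap R K x ≠ 0 := by simpa using hx0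
    rw [hy, v.ord_mul hxK (by positivity), v.ord_inv (by positivity), v.ord_pow ha0] at hv2
    rcases (show v.ord (genK K) ≤ 0 by omega).lt_or_eq with hlt | heq
    · have := (hx v hlt).ord_le hxK
      omega
    · have := ord_nonneg x heq.ge
      rw [heq] at hv2
      simp at hv2
      omega
  have hN := RingHom.IsIntegralElem.norm φ hyint
  have hnx : Algebra.norm F (algebraMap R K x) = algebraMap ℚ[X] F (Algebra.norm ℚ[X] x) :=
    Algebra.norm_localization ℚ[X] (nonZeroDivisors ℚ[X]) x
  have hna : Algebra.norm F (genK K) = (algebraMap ℚ[X] F X) ^ Module.finrank ℚ[X] R := by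
    have h1 := Algebra.norm_localization ℚ[X] (nonZeroDivisors ℚ[X]) (Rₘ := F) (Sₘ := K)
      (algebraMap ℚ[X] R X)
    rw [Algebra.norm_algebraMap, ← IsScalarTower.algebraMap_apply, map_pow,
      algebraMap_X_eq_genK] at h1
    exact h1
  have hinv : Algebra.norm F ((genK K ^ n)⁻¹) =
      ((algebraMap ℚ[X] F X ^ Module.finrank ℚ[X] R) ^ n)⁻¹ := by
    rw [← hna, ← map_pow]
    refine eq_inv_of_mul_eq_one_left ?_
    rw [← map_mul, inv_mul_cancel₀ (pow_ne_zero _ ha0), map_one]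
  rw [hy, map_mul, hinv, hnx] at hN
  obtain ⟨v, hv⟩ := h.exists_pole
  have hK : IsIntegral (Algebra.adjoin ℚ {(genK K)⁻¹}) (algebraMap ℚ[X] K (Algebra.norm ℚ[X] x) *
      (((genK K) ^ Module.finrank ℚ[X] R) ^ n)⁻¹) := by
    have h2 : ((algebraMap F K).comp φ).IsIntegralElem (algebraMap F K
        (algebraMap ℚ[X] F (Algebra.norm ℚ[X] x) *
          ((algebraMap ℚ[X] F X ^ Module.finrank ℚ[X] R) ^ n)⁻¹)) := by
      obtain ⟨q, hqm, hq⟩ := hN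
      refine ⟨q, hqm, ?_⟩
      rw [← Polynomial.hom_eval₂, hq, map_zero]
    obtain ⟨q, hqm, hq⟩ := h2
    let ψ : ℚ[X] →+* Algebra.adjoin ℚ {(genK K)⁻¹} :=
      (aeval (⟨(genK K)⁻¹, Algebra.subset_adjoin rfl⟩ : Algebra.adjoin ℚ {(genK K)⁻¹})
        : ℚ[X] →ₐ[ℚ] _).toRingHom
    have hψ : (algebraMap (Algebra.adjoin ℚ {(genK K)⁻¹}) K).comp ψ = (algebraMap F K).comp φ := by
      ext p
      · simp
      · simp [ψ, hφ]
    refine ⟨q.map ψ, hqm.map _, ?_⟩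
    rw [eval₂_map, hψ]
    simpa only [map_mul, map_inv₀, map_pow, ← IsScalarTower.algebraMap_apply ℚ[X] F K,
      algebraMap_X_eq_genK (K := K)] using hq
  have hord := v.ord_nonneg_of_isIntegral_adjoin
    (by rw [v.ord_inv ha0]; omega) hK
  have hNx : Algebra.norm ℚ[X] x ≠ 0 := Algebra.norm_ne_zero_iff.2 hx0
  have h3 := FFPrime.ord_aeval hv hNx
  rw [algebraMap_eq_aeval, v.ord_mul h3.1 (by positivity), v.ord_inv (by positivity), h3.2,
    v.ord_pow (by positivity), v.ord_pow ha0] at hord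
  have : ((Algebra.norm ℚ[X] x).natDegree : ℤ) ≤ n * Module.finrank ℚ[X] R := by
    by_contra hlt
    nlinarith
  exact_mod_cast this

theorem finrank_pos : 0 < Module.finrank ℚ[X] R := Module.finrank_pos

/-- An element of `R` vanishing at every pole of `X` is zero. -/
theorem eq_zero_of_le_one (h : OddPoles R K) {x : R}
    (hx : ∀ v : FFPrime ℚ K, v.ord (genK K) < 0 → v.Le 1 (algebraMap R K x)) : x = 0 := by
  by_contra hx0
  obtain ⟨m, hm0, hm⟩ := FFPrime.exists_nat_forall_lt
    (h.isFunctionField.finite_poles (genK K)).toFinset (fun v => -v.ord (genK K))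
  have ha0 : algebraMap ℚ[X] R X ≠ 0 := by simp
  have hle := h.natDegree_norm_le (x := x ^ m * algebraMap ℚ[X] R X) (n := 0) (fun v hv => by
    have h1 := hm v (by simpa using hv)
    rw [map_mul, map_pow, ← IsScalarTower.algebraMap_apply, algebraMap_X_eq_genK]
    refine (((hx v hv).pow m).mul (FFPrime.Le.refl _)).mono ?_
    simp only [CharP.cast_eq_zero, zero_mul, mul_one]
    omega)
  rw [map_mul, map_pow, Algebra.norm_algebraMap,
    natDegree_mul (pow_ne_zero _ (Algebra.norm_ne_zero_iff.2 hx0)) (pow_ne_zero _ X_ne_zero),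
    natDegree_X_pow] at hle
  have := finrank_pos (R := R)
  omega

end OddPoles

section Derivation

open IntermediateField.algebraAdjoinAdjoin

theorem exists_derivation_apply_self {F L : Type*} [Field F] [CharZero F] [Field L] [Algebra F L]
    {w : L} (hw : Transcendental F w)
    (halg : Algebra.IsAlgebraic (IntermediateField.adjoin F {w}) L) :
    ∃ D : Derivation F L L, D w = w := by
  let S := Algebra.adjoin F {w}
  haveI : Algebra.FormallyEtale S (IntermediateField.adjoin F {w}) :=
    Algebra.FormallyEtale.of_isLocalization (nonZeroDivisors S)
  haveI : Algebra.FormallyEtale (IntermediateField.adjoin F {w}) L :=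
    Algebra.FormallyEtale.of_isSeparable _ _
  haveI : Algebra.FormallyEtale S L :=
    Algebra.FormallyEtale.comp S (IntermediateField.adjoin F {w}) L
  let φ : S ≃ₐ[F] F[X] := (Polynomial.algEquivOfTranscendental F w hw).symm
  have hφ : ∀ x : S, aeval w (φ x) = (x : L) := fun x => by
    have := congrArg Subtype.val ((Polynomial.algEquivOfTranscendental F w hw).apply_symm_apply x)
    rw [algEquivOfTranscendental_apply] at this
    rw [← this, ← Subalgebra.coe_val, ← aeval_algHom_apply]
    rfl
  let d : Derivation F S L := Derivation.mk'
    ((aeval w).toLinearMap ∘ₗ LinearMap.mulLeft F X ∘ₗ derivative ∘ₗ φ.toLinearMap) (fun x y => by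
      simp only [LinearMap.coe_comp, Function.comp_apply, AlgEquiv.toLinearMap_apply, map_mul,
        derivative_mul, LinearMap.mulLeft_apply, AlgHom.toLinearMap_apply, map_add, hφ, aeval_X,
        Algebra.smul_def]
      change _ = (x : L) * _ + (y : L) * _
      ring)
  let f : Ω[L⁄F] →ₗ[L] L := (LinearMap.liftBaseChange L d.liftKaehlerDifferential) ∘ₗ
    (KaehlerDifferential.tensorKaehlerEquivOfFormallyEtale F S L).symm.toLinearMap
  refine ⟨f.compDer (KaehlerDifferential.D F L), ?_⟩
  let w' : S := ⟨w, Algebra.subset_adjoin rfl⟩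
  have h1 : KaehlerDifferential.D F L w = KaehlerDifferential.D F L (algebraMap S L w') := rfl
  have h2 : φ w' = X := by
    rw [AlgEquiv.symm_apply_eq]
    exact (algEquivOfTranscendental_apply_X F w hw).symm
  change LinearMap.liftBaseChange L d.liftKaehlerDifferential
    ((KaehlerDifferential.tensorKaehlerEquivOfFormallyEtale F S L).symm
      (KaehlerDifferential.D F L w)) = w
  rw [h1, KaehlerDifferential.tensorKaehlerEquivOfFormallyEtale_symm_D_algebraMap]
  simp [d, h2]

end Derivation

section Constants

variable {F L : Type*} [Field F] [CharZero F] [Field L] [Algebra F L] {w : L}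
  {D : Derivation F L L}

theorem Derivation.map_aeval_of_apply_self (hDw : D w = w) (p : F[X]) :
    D (aeval w p) = aeval w (X * derivative p) := by
  rw [Derivation.map_aeval, hDw]
  simp [mul_comm]

/-- A polynomial dividing its image under `X d/dX` is a monomial. -/
theorem Polynomial.eq_monomial_of_dvd_X_mul_derivative {p : F[X]} (hp : p ≠ 0)
    (h : p ∣ X * derivative p) : p = C p.leadingCoeff * X ^ p.natDegree := by
  obtain ⟨q, hq⟩ := h
  rcases eq_or_ne q 0 with rfl | hq0
  · rw [mul_zero, mul_eq_zero, or_iff_right X_ne_zero] at hq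
    rw [derivative_eq_zero.1 hq, pow_zero, mul_one]
    rw [eq_C_of_natDegree_eq_zero (derivative_eq_zero.1 hq)]
    simp
  have hdeg : q.natDegree = 0 := by
    have h1 := congrArg natDegree hq
    rw [natDegree_mul hp hq0] at h1
    have h2 : (X * derivative p).natDegree ≤ p.natDegree := by
      rcases eq_or_ne p.natDegree 0 with h0 | h0
      · rw [eq_C_of_natDegree_eq_zero h0]
        simp
      · refine (natDegree_mul_le).trans ?_
        have := natDegree_derivative_lt h0
        rw [natDegree_X]
        omega
    omega
  rw [eq_C_of_natDegree_eq_zero hdeg] at hq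
  have hcoeff : ∀ i : ℕ, (i : F) * p.coeff i = p.coeff i * q.coeff 0 := fun i => by
    have := congrArg (fun r => coeff r i) hq
    simp only [coeff_mul_C] at this
    rw [← this]
    rcases i with _ | i
    · simp
    · simp [coeff_X_mul, coeff_derivative, mul_comm]
  have hlead := hcoeff p.natDegree
  have hl0 : p.coeff p.natDegree ≠ 0 := by simpa using hp
  replace hlead := mul_left_cancel₀ hl0 ((mul_comm _ _).trans hlead)
  ext i
  rw [coeff_C_mul_X_pow]
  split_ifs with hi
  · rw [hi]; rfl
  · by_contra hne
    have := hcoeff i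
    rw [mul_comm] at this
    have := mul_left_cancel₀ hne this
    rw [← hlead] at this
    exact hi (by exact_mod_cast this)

end Constants

section Constants

variable {F L : Type*} [Field F] [CharZero F] [Field L] [Algebra F L] {w : L}
  {D : Derivation F L L}

theorem Derivation.zpow_of_apply_self (hDw : D w = w) (hw0 : w ≠ 0) (j : ℤ) :
    D (w ^ j) = j * w ^ j := by
  rw [Derivation.leibniz_zpow, hDw, zsmul_eq_mul, smul_eq_mul, zpow_sub_one₀ hw0,
    inv_mul_cancel_right₀ hw0]

theorem Derivation.exists_eq_mul_zpow (hDw : D w = w) (hw : Transcendental F w) {f : L}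
    (hf : f ∈ IntermediateField.adjoin F {w}) (hf0 : f ≠ 0) {e : F}
    (hDf : D f = algebraMap F L e * f) :
    ∃ (j : ℤ) (c : F), e = j ∧ f = algebraMap F L c * w ^ j := by
  classical
  have hw0 : w ≠ 0 := fun h => hw (h ▸ isAlgebraic_zero)
  have hinj : Function.Injective (aeval w : F[X] →ₐ[F] L) :=
    transcendental_iff_injective.1 hw
  obtain ⟨p, q, hp0, hq0, hpq, rfl⟩ : ∃ p q : F[X], p ≠ 0 ∧ q ≠ 0 ∧ IsCoprime p q ∧
      f = aeval w p / aeval w q := by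
    obtain ⟨r, s, hrs⟩ := (IntermediateField.mem_adjoin_simple_iff F f).1 hf
    have hr : r ≠ 0 := fun h => hf0 (by simp [hrs, h])
    have hs : s ≠ 0 := fun h => hf0 (by simp [hrs, h])
    obtain ⟨r', hr'⟩ := EuclideanDomain.gcd_dvd_left r s
    obtain ⟨s', hs'⟩ := EuclideanDomain.gcd_dvd_right r s
    have hg : EuclideanDomain.gcd r s ≠ 0 := fun h => hr (EuclideanDomain.gcd_eq_zero_iff.1 h).1
    refine ⟨r', s', fun h => hr ?_, fun h => hs ?_, ?_, ?_⟩
    · rw [hr', h, mul_zero]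
    · rw [hs', h, mul_zero]
    · have h1 := EuclideanDomain.gcd_eq_gcd_ab r s
      refine ⟨EuclideanDomain.gcdA r s, EuclideanDomain.gcdB r s, mul_left_cancel₀ hg ?_⟩
      linear_combination (-1 : F[X]) * h1 - EuclideanDomain.gcdA r s * hr' -
        EuclideanDomain.gcdB r s * hs'
    · have hg' : aeval w (EuclideanDomain.gcd r s) ≠ 0 := fun h =>
        hg (hinj (by rw [h, map_zero]))
      rw [hrs]
      rw [← mul_div_mul_left (aeval w r') (aeval w s') hg', ← map_mul, ← map_mul, ← hr', ← hs']
  have hq' : aeval w q ≠ 0 := fun h => hq0 (hinj (by rw [h, map_zero]))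
  have key : C e * p * q + p * (X * derivative q) = X * derivative p * q := by
    apply hinj
    have h1 : D (aeval w p / aeval w q * aeval w q) = D (aeval w p) := by
      rw [div_mul_cancel₀ _ hq']
    rw [Derivation.leibniz, hDf, D.map_aeval_of_apply_self hDw, D.map_aeval_of_apply_self hDw,
      smul_eq_mul, smul_eq_mul] at h1
    simp only [map_add, map_mul, aeval_C, aeval_X] at h1 ⊢
    rw [← h1]
    field_simp
    ring
  have hdp : p ∣ X * derivative p := by
    refine hpq.dvd_of_dvd_mul_right ?_
    rw [← key]
    exact ⟨C e * q + X * derivative q, by ring⟩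
  have hdq : q ∣ X * derivative q := by
    refine hpq.symm.dvd_of_dvd_mul_left ?_
    exact ⟨X * derivative p - C e * p, by linear_combination key⟩
  have hp := Polynomial.eq_monomial_of_dvd_X_mul_derivative hp0 hdp
  have hq := Polynomial.eq_monomial_of_dvd_X_mul_derivative hq0 hdq
  have hf' : aeval w p / aeval w q = algebraMap F L (p.leadingCoeff / q.leadingCoeff) *
      w ^ ((p.natDegree : ℤ) - q.natDegree) := by
    conv_lhs => rw [hp, hq]
    simp only [map_mul, aeval_C, map_pow, aeval_X, map_div₀]
    rw [zpow_sub₀ hw0, zpow_natCast, zpow_natCast]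
    field_simp
  refine ⟨(p.natDegree : ℤ) - q.natDegree, p.leadingCoeff / q.leadingCoeff, ?_, hf'⟩
  apply (algebraMap F L).injective
  apply mul_right_cancel₀ hf0
  rw [← hDf, hf', Derivation.leibniz, Derivation.zpow_of_apply_self hDw hw0, map_algebraMap]
  simp only [smul_eq_mul, _root_.map_intCast]
  ring

theorem Derivation.apply_mem_adjoin (hDw : D w = w) {x : L}
    (hx : x ∈ IntermediateField.adjoin F {w}) : D x ∈ IntermediateField.adjoin F {w} := by
  have hmem : ∀ p : F[X], aeval w p ∈ IntermediateField.adjoin F {w} := fun p =>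
    (IntermediateField.mem_adjoin_simple_iff F _).2 ⟨p, 1, by simp⟩
  obtain ⟨p, q, rfl⟩ := (IntermediateField.mem_adjoin_simple_iff F x).1 hx
  rw [Derivation.leibniz_div, D.map_aeval_of_apply_self hDw, D.map_aeval_of_apply_self hDw]
  simp only [smul_eq_mul]
  exact mul_mem (pow_mem (inv_mem (hmem q)) 2)
    (sub_mem (mul_mem (hmem _) (hmem _)) (mul_mem (hmem _) (hmem _)))

theorem Derivation.apply_coeff_minpoly (hDw : D w = w) {u : L}
    (hu : IsIntegral (IntermediateField.adjoin F {w}) u) {e : F}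
    (hDu : D u = algebraMap F L e * u) (i : ℕ) :
    D ((minpoly (IntermediateField.adjoin F {w}) u).coeff i : L) =
      (((minpoly (IntermediateField.adjoin F {w}) u).natDegree : L) - i) * algebraMap F L e *
        ((minpoly (IntermediateField.adjoin F {w}) u).coeff i : L) := by
  set E := IntermediateField.adjoin F {w} with hE
  set g := minpoly E u with hg
  set δ := g.natDegree with hδ
  have hDpow : ∀ i : ℕ, D (u ^ i) = i * algebraMap F L e * u ^ i := fun i => by
    rcases i with _ | i
    · simp
    · rw [Derivation.leibniz_pow, hDu]
      simp only [nsmul_eq_mul, smul_eq_mul, Nat.add_sub_cancel]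
      ring
  let d : ℕ → E := fun i => ⟨D (g.coeff i : L), Derivation.apply_mem_adjoin hDw (g.coeff i).2⟩ -
    ((δ : E) - i) * algebraMap F E e * g.coeff i
  have hmonic : g.Monic := minpoly.monic hu
  have hdδ : d δ = 0 := by
    have : g.coeff δ = 1 := hmonic
    refine Subtype.ext ?_
    simp [d, this]
  let G : E[X] := ∑ i ∈ Finset.range δ, monomial i (d i)
  have hG : aeval u G = 0 := by
    have h1 : D (aeval u g) = 0 := by rw [hg, minpoly.aeval, map_zero]
    rw [aeval_eq_sum_range, map_sum] at h1
    have h2 : ∑ i ∈ Finset.range (δ + 1), algebraMap E L (g.coeff i) * u ^ i = 0 := by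
      have := minpoly.aeval E u
      rw [← hg, aeval_eq_sum_range] at this
      simpa only [Algebra.smul_def] using this
    have h3 : ∑ i ∈ Finset.range (δ + 1), algebraMap E L (d i) * u ^ i = 0 := by
      have : ∀ i ∈ Finset.range (δ + 1), algebraMap E L (d i) * u ^ i =
          D (g.coeff i • u ^ i) - δ * algebraMap F L e * (algebraMap E L (g.coeff i) * u ^ i) := by
        intro i _
        rw [Algebra.smul_def, Derivation.leibniz, hDpow]
        simp only [d, map_sub, map_mul, smul_eq_mul, _root_.map_natCast,
          ← IsScalarTower.algebraMap_apply]
        change (D (algebraMap E L (g.coeff i)) - _) * _ = _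
        ring
      rw [Finset.sum_congr rfl this, Finset.sum_sub_distrib, ← Finset.mul_sum, h1, h2]
      simp
    rw [Finset.sum_range_succ, hdδ] at h3
    simp only [G, map_sum, aeval_monomial]
    simpa using h3
  have hdeg : G.degree < g.degree := by
    rw [degree_eq_natDegree hmonic.ne_zero]
    refine (degree_sum_le _ _).trans_lt ?_
    rw [Finset.sup_lt_iff (WithBot.bot_lt_coe _)]
    intro i hi
    exact (degree_monomial_le _ _).trans_lt (by exact_mod_cast Finset.mem_range.1 hi)
  have hG0 : G = 0 := by
    by_contra h
    exact absurd (minpoly.degree_le_of_ne_zero E u h hG) (not_le.2 hdeg)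
  have hd : d i = 0 := by
    rcases lt_trichotomy i δ with hi | rfl | hi
    · have := congrArg (fun r => coeff r i) hG0
      simp only [G, finsetSum_coeff, coeff_monomial, coeff_zero] at this
      rwa [Finset.sum_ite_eq' , if_pos (Finset.mem_range.2 hi)] at this
    · exact hdδ
    · refine Subtype.ext ?_
      simp [d, coeff_eq_zero_of_natDegree_lt hi]
  have := congrArg (algebraMap E L) hd
  simp only [d, map_sub, map_mul, _root_.map_natCast, map_zero, ← IsScalarTower.algebraMap_apply,
    sub_eq_zero] at this
  exact this

/-- An element with constant logarithmic derivative is, up to a power, a power of `w`. -/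
theorem Derivation.exists_pow_eq (hDw : D w = w) (hw : Transcendental F w) {u : L}
    (hu : IsIntegral (IntermediateField.adjoin F {w}) u) (hu0 : u ≠ 0) {e : F}
    (hDu : D u = algebraMap F L e * u) :
    ∃ j : ℤ, ((minpoly (IntermediateField.adjoin F {w}) u).natDegree : F) * e = j ∧
      IsAlgebraic F (u ^ (minpoly (IntermediateField.adjoin F {w}) u).natDegree * w ^ (-j)) := by
  have hw0 : w ≠ 0 := fun h => hw (h ▸ isAlgebraic_zero)
  have h0 := Derivation.apply_coeff_minpoly hDw hu hDu 0
  set E := IntermediateField.adjoin F {w} with hE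
  set δ := (minpoly E u).natDegree with hδ
  have hc0 : ((minpoly E u).coeff 0 : L) ≠ 0 := by
    simpa using minpoly.coeff_zero_ne_zero hu hu0
  obtain ⟨j, c, hj, -⟩ := Derivation.exists_eq_mul_zpow hDw hw ((minpoly E u).coeff 0).2 hc0
    (e := δ * e) (by rw [h0]; simp)
  refine ⟨j, hj, ?_⟩
  set x := u ^ δ * w ^ (-j) with hx
  have hDx : D x = algebraMap F L 0 * x := by
    have h1 : D (u ^ δ) = δ * algebraMap F L e * u ^ δ := by
      rcases δ with _ | i
      · simp
      · rw [Derivation.leibniz_pow, hDu]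
        simp only [nsmul_eq_mul, smul_eq_mul, Nat.add_sub_cancel]
        ring
    have h2 : (δ : L) * algebraMap F L e = j := by
      rw [← _root_.map_natCast (algebraMap F L), ← map_mul, hj, _root_.map_intCast]
    rw [hx, Derivation.leibniz, Derivation.zpow_of_apply_self hDw hw0, h1, h2]
    simp only [smul_eq_mul, Int.cast_neg, map_zero]
    ring
  have hwE : w ∈ E := IntermediateField.mem_adjoin_simple_self F w
  have hxi : IsIntegral E x :=
    (hu.pow _).mul (isIntegral_algebraMap (R := E) (x := (⟨w, hwE⟩ : E) ^ (-j)))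
  have hcoeff : ∀ i, ∃ c : F, ((minpoly E x).coeff i : L) = algebraMap F L c := fun i => by
    by_cases h : ((minpoly E x).coeff i : L) = 0
    · exact ⟨0, by rw [h, map_zero]⟩
    · obtain ⟨j', c', hj', hc'⟩ := Derivation.exists_eq_mul_zpow hDw hw
        ((minpoly E x).coeff i).2 h (e := 0)
        (by rw [Derivation.apply_coeff_minpoly hDw hxi hDx i]; simp)
      have : j' = 0 := by exact_mod_cast hj'.symm
      exact ⟨c', by rw [hc', this, zpow_zero, mul_one]⟩
  have hlift : minpoly E x ∈ Polynomial.lifts (algebraMap F E) := by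
    rw [lifts_iff_coeff_lifts]
    intro i
    obtain ⟨c, hc⟩ := hcoeff i
    exact ⟨c, Subtype.ext hc.symm⟩
  obtain ⟨p, hp⟩ := (mem_lifts _).1 hlift
  refine ⟨p, fun h => minpoly.ne_zero hxi (by rw [← hp, h, Polynomial.map_zero]), ?_⟩
  have := minpoly.aeval E x
  rwa [← hp, aeval_map_algebraMap] at this

end Constants

namespace IsFunctionField

theorem extendScalars {F k K : Type*} [Field F] [Field k] [Field K] [Algebra F k] [Algebra k K]
    [Algebra F K] [IsScalarTower F k K] [Algebra.IsAlgebraic F k] (h : IsFunctionField F K) :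
    IsFunctionField k K := by
  have := h.essFinite
  refine ⟨Algebra.EssFiniteType.of_comp F k K, ?_⟩
  have h1 := lift_trdeg_add_eq F k K
  rw [h.trdeg_eq, trdeg_eq_zero] at h1
  simpa using h1

section PolynomialAlgebra

variable {K : Type*} [Field K] [CharZero K] [Algebra ℚ[X] K]

theorem injective_algebraMap_polynomial (ht : Transcendental ℚ (genK K)) :
    Function.Injective (algebraMap ℚ[X] K) := by
  have := transcendental_iff_injective.1 ht
  intro p q hpq
  rw [OddPoles.algebraMap_eq_aeval, OddPoles.algebraMap_eq_aeval] at hpq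
  exact this hpq

theorem isAlgebraic_polynomial (h : IsFunctionField ℚ K) (ht : Transcendental ℚ (genK K)) :
    Algebra.IsAlgebraic ℚ[X] K := by
  have hinj := injective_algebraMap_polynomial ht
  have : FaithfulSMul ℚ[X] K := (faithfulSMul_iff_algebraMap_injective ℚ[X] K).2 hinj
  have h1 := lift_trdeg_add_eq ℚ ℚ[X] K
  rw [h.trdeg_eq, Polynomial.trdeg_of_isDomain] at h1
  refine trdeg_eq_zero_iff.1 (Cardinal.eq_of_add_eq_add_left (a := 1) ?_ Cardinal.one_lt_aleph0)
  simpa using h1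

theorem module_finite (h : IsFunctionField ℚ K) (ht : Transcendental ℚ (genK K)) (R : Type*)
    [CommRing R] [Algebra R K] [Algebra ℚ[X] R] [IsScalarTower ℚ[X] R K]
    [IsIntegralClosure R ℚ[X] K] : Module.Finite ℚ[X] R := by
  have hinj := injective_algebraMap_polynomial ht
  have := h.isAlgebraic_polynomial ht
  have : FaithfulSMul ℚ[X] K := (faithfulSMul_iff_algebraMap_injective ℚ[X] K).2 hinj
  letI := FractionRing.liftAlgebra ℚ[X] K
  have : IsScalarTower ℚ[X] (FractionRing ℚ[X]) K := FractionRing.isScalarTower_liftAlgebra ℚ[X] K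
  have : Algebra.IsAlgebraic (FractionRing ℚ[X]) K :=
    (IsFractionRing.comap_isAlgebraic_iff (A := ℚ[X])).1 ‹_›
  have := h.essFinite
  have : Algebra.EssFiniteType (FractionRing ℚ[X]) K := Algebra.EssFiniteType.of_comp ℚ _ K
  have : FiniteDimensional (FractionRing ℚ[X]) K :=
    Algebra.finite_of_essFiniteType_of_isAlgebraic
  exact IsIntegralClosure.finite ℚ[X] (FractionRing ℚ[X]) K R

theorem isFractionRing (h : IsFunctionField ℚ K) (ht : Transcendental ℚ (genK K)) (R : Type*)
    [CommRing R] [IsDomain R] [Algebra R K] [Algebra ℚ[X] R] [IsScalarTower ℚ[X] R K]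
    [IsIntegralClosure R ℚ[X] K] : IsFractionRing R K := by
  have hinj := injective_algebraMap_polynomial ht
  have := h.isAlgebraic_polynomial ht
  exact IsIntegralClosure.isFractionRing_of_algebraic ℚ[X] R
    (fun x hx => hinj (hx.trans (map_zero _).symm))

end PolynomialAlgebra

theorem finiteDimensional_algebraicClosure {F L : Type*} [Field F] [CharZero F] [Field L]
    [Algebra F L] (h : IsFunctionField F L) : FiniteDimensional F (algebraicClosure F L) := by
  obtain ⟨w, hw⟩ : ∃ w : L, Transcendental F w := by
    by_contra! hc
    have : Algebra.IsAlgebraic F L := ⟨fun x => not_not.1 (hc x)⟩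
    have h1 := h.trdeg_eq
    rw [trdeg_eq_zero] at h1
    exact zero_ne_one h1
  obtain ⟨v, hv⟩ := h.exists_pole hw
  have hw' : Transcendental F w⁻¹ := fun h' => hw (by simpa using h'.inv)
  have hw0 : w ≠ 0 := fun h0 => hw (h0 ▸ isAlgebraic_zero)
  refine Module.rank_lt_aleph0_iff.1 (lt_of_le_of_lt (rank_le (n :=
    Module.finrank (IntermediateField.adjoin F {w⁻¹}) L) fun s hs => ?_) Cardinal.natCast_lt_aleph0)
  have h1 : LinearIndependent F fun i : Fin s.card =>
      ((s.equivFin.symm i : algebraicClosure F L)) :=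
    hs.comp _ s.equivFin.symm.injective
  refine h.card_le_finrank hw' (fun i => ((s.equivFin.symm i : algebraicClosure F L) : L))
    fun c hc => ⟨v, by rw [v.ord_inv hw0]; omega, fun i => ?_, fun hle => ?_⟩
  · exact (v.ord_eq_zero_of_isAlgebraic
      (mem_algebraicClosure_iff.1 (s.equivFin.symm i : algebraicClosure F L).2)).ge
  · let y : algebraicClosure F L := ∑ i, c i • (s.equivFin.symm i : algebraicClosure F L)
    have hy : (y : L) = ∑ i, algebraMap F L (c i) *
        ((s.equivFin.symm i : algebraicClosure F L) : L) := by
      simp [y, Algebra.smul_def]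
    rw [← hy] at hle
    have h2 : v.ord (y : L) = 0 := v.ord_eq_zero_of_isAlgebraic (mem_algebraicClosure_iff.1 y.2)
    rcases hle with h3 | h3
    · exact hc (funext (Fintype.linearIndependent_iff.1 h1 c (Subtype.ext h3)))
    · omega

end IsFunctionField

theorem AddMonoidHom.fg_range_of_ker_le {G A B : Type*} [AddCommGroup G] [AddCommGroup A]
    [AddCommGroup B] [Module.Finite ℤ A] (f : G →+ A) (φ : G →+ B) (h : f.ker ≤ φ.ker) :
    (LinearMap.range φ.toIntLinearMap).FG := by
  have h' : LinearMap.ker f.toIntLinearMap ≤ LinearMap.ker φ.toIntLinearMap := fun x hx => h hx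
  rw [← Submodule.range_liftQ _ _ h']
  have : Module.Finite ℤ (LinearMap.range f.toIntLinearMap) :=
    Module.Finite.iff_fg.2 (IsNoetherian.noetherian _)
  have : Module.Finite ℤ (G ⧸ LinearMap.ker f.toIntLinearMap) :=
    Module.Finite.equiv f.toIntLinearMap.quotKerEquivRange.symm
  exact Module.Finite.iff_fg.1 inferInstance

section LogarithmicDerivative

variable {L : Type*} [Field L] [CharZero L] [Algebra ℚ[X] L]

/-- The logarithmic derivative on the units of the integral closure of `ℚ[X]`. -/
noncomputable def logDerivHom {F : Type*} [Field F] [Algebra F L] (D : Derivation F L L) :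
    Additive (integralClosure ℚ[X] L)ˣ →+ L where
  toFun u := ((u.toMul⁻¹ : (integralClosure ℚ[X] L)ˣ) : integralClosure ℚ[X] L) *
    D ((u.toMul : integralClosure ℚ[X] L) : L)
  map_zero' := by simp
  map_add' u v := by
    have hu : ((((u.toMul⁻¹ : (integralClosure ℚ[X] L)ˣ) : integralClosure ℚ[X] L)) : L) *
        ((u.toMul : integralClosure ℚ[X] L) : L) = 1 := by
      rw [← MulMemClass.coe_mul, Units.inv_mul]; rfl
    have hv : ((((v.toMul⁻¹ : (integralClosure ℚ[X] L)ˣ) : integralClosure ℚ[X] L)) : L) *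
        ((v.toMul : integralClosure ℚ[X] L) : L) = 1 := by
      rw [← MulMemClass.coe_mul, Units.inv_mul]; rfl
    simp only [toMul_add, mul_inv_rev, Units.val_mul, MulMemClass.coe_mul, Derivation.leibniz,
      smul_eq_mul]
    linear_combination (((((v.toMul⁻¹ : (integralClosure ℚ[X] L)ˣ) :
      integralClosure ℚ[X] L)) : L) * D ((v.toMul : integralClosure ℚ[X] L) : L)) * hu +
      (((((u.toMul⁻¹ : (integralClosure ℚ[X] L)ˣ) :
      integralClosure ℚ[X] L)) : L) * D ((u.toMul : integralClosure ℚ[X] L) : L)) * hv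

theorem finiteDimensional_span_range_logDerivHom (h : IsFunctionField ℚ L)
    {F : Type*} [Field F] [Algebra F L] (hF : ∀ x : L, IsAlgebraic ℚ x →
      ∃ c : F, algebraMap F L c = x)
    (D : Derivation F L L) :
    (Submodule.span ℚ (Set.range (logDerivHom D))).FG := by
  let P : Set (FFPrime ℚ L) := {v | v.ord (genK L) < 0}
  have : Finite P := h.finite_poles (genK L)
  have hne : ∀ u : (integralClosure ℚ[X] L)ˣ, ((u : integralClosure ℚ[X] L) : L) ≠ 0 := fun u h0 =>
    u.ne_zero (Subtype.ext h0)
  let f : Additive (integralClosure ℚ[X] L)ˣ →+ (P → ℤ) :=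
    { toFun := fun u v => (v : FFPrime ℚ L).ord ((u.toMul : integralClosure ℚ[X] L) : L)
      map_zero' := funext fun v => (v : FFPrime ℚ L).ord_one
      map_add' := fun x y => funext fun v => (v : FFPrime ℚ L).ord_mul (hne _) (hne _) }
  have hker : f.ker ≤ (logDerivHom D).ker := by
    intro u hu
    have h1 : ∀ v : FFPrime ℚ L, 0 ≤ v.ord ((u.toMul : integralClosure ℚ[X] L) : L) := by
      intro v
      rcases lt_or_ge (v.ord (genK L)) 0 with hv | hv
      · exact (congrFun hu ⟨v, hv⟩).ge
      · refine v.ord_nonneg_of_isIntegral (A := ℚ[X]) (fun p => ?_)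
          (u.toMul : integralClosure ℚ[X] L).2
        rw [OddPoles.algebraMap_eq_aeval]
        exact v.ord_nonneg_of_mem_adjoin hv (aeval_mem_adjoin_singleton ℚ _)
    have h2 : IsAlgebraic ℚ ((u.toMul : integralClosure ℚ[X] L) : L) := by
      by_contra hc
      obtain ⟨v, hv⟩ := h.exists_pole hc
      exact absurd (h1 v) (not_le.2 hv)
    obtain ⟨c, hc⟩ := hF _ h2
    change _ * D ((u.toMul : integralClosure ℚ[X] L) : L) = 0
    rw [← hc, Derivation.map_algebraMap, mul_zero]
  obtain ⟨s, hs⟩ := AddMonoidHom.fg_range_of_ker_le f (logDerivHom D) hker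
  refine ⟨s, ?_⟩
  rw [← Submodule.span_span_of_tower ℤ ℚ (s : Set L), hs]
  rfl

end LogarithmicDerivative

theorem Module.exists_forall_natDegree_lt {M : Type*} [AddCommGroup M] [Module ℚ[X] M] [Module ℚ M]
    [IsScalarTower ℚ ℚ[X] M] [Module.Finite ℚ[X] M] [Module.Free ℚ[X] M] {V : Submodule ℚ M}
    (hV : V.FG) : ∃ d : ℕ, ∀ (p : ℚ[X]) (m : M), d < p.natDegree → p • m ∈ V → p • m = 0 := by
  classical
  let b := Module.Free.chooseBasis ℚ[X] M
  obtain ⟨s, rfl⟩ := hV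
  let d := s.sup fun x => Finset.univ.sup fun i => (b.repr x i).natDegree
  refine ⟨d, fun p m hp hpm => ?_⟩
  have key : ∀ x ∈ Submodule.span ℚ (s : Set M), ∀ i, (b.repr x i).natDegree ≤ d := by
    intro x hx i
    induction hx using Submodule.span_induction with
    | mem x hx =>
      exact (Finset.le_sup (f := fun i => (b.repr x i).natDegree) (Finset.mem_univ i)).trans
        (Finset.le_sup (f := fun x => Finset.univ.sup fun i => (b.repr x i).natDegree) hx)
    | zero => simp
    | add x y _ _ hx hy =>
      rw [map_add, Finsupp.add_apply]
      exact (natDegree_add_le _ _).trans (max_le hx hy)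
    | smul c x _ hx =>
      rw [← algebraMap_smul ℚ[X] c x, map_smul, Finsupp.smul_apply, smul_eq_mul]
      exact (natDegree_C_mul_le c _).trans hx
  apply b.repr.injective
  ext1 i
  have h1 := key _ hpm i
  rw [map_smul, Finsupp.smul_apply, smul_eq_mul] at h1 ⊢
  rw [map_zero, Finsupp.zero_apply]
  by_contra hne
  rw [natDegree_mul (left_ne_zero_of_mul hne) (right_ne_zero_of_mul hne)] at h1
  omega

theorem Polynomial.Chebyshev.natDegree_S (n : ℕ) : (Chebyshev.S ℚ n).natDegree = n := by
  have h1 := congrArg natDegree (Chebyshev.S_comp_two_mul_X ℚ n)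
  rw [natDegree_comp, natDegree_eq_of_degree_eq_some (Chebyshev.degree_U_natCast ℚ n)] at h1
  have h2 : (2 * X : ℚ[X]).natDegree = 1 := by
    rw [← C_ofNat, natDegree_C_mul_X _ (by norm_num)]
  rwa [h2, mul_one] at h1

theorem Polynomial.Chebyshev.sub_mul_S_eval {A : Type*} [CommRing A] {w w' : A} (h : w * w' = 1)
    (n : ℕ) : (w - w') * (Chebyshev.S A n).eval (w + w') = w ^ (n + 1) - w' ^ (n + 1) := by
  induction n using Nat.twoStepInduction with
  | zero => simp
  | one => simp; ring
  | more n h1 h2 =>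
    push_cast at h2 ⊢
    rw [Chebyshev.S_add_two]
    simp only [eval_sub, eval_mul, eval_X]
    linear_combination (w + w') * h2 - h1 + (w ^ (n + 1) - w' ^ (n + 1)) * h

section ExpPin

variable {L : Type*} [Field L] [CharZero L] [Algebra ℚ[X] L]

theorem derivation_algebraMap {F : Type*} [Field F] [CharZero F] [Algebra F L]
    {D : Derivation F L L} {w w' : L}
    (hDw : D w = w) (hww : w * w' = 1) (ha : w + w' = genK L) (p : ℚ[X]) :
    D (algebraMap ℚ[X] L p) = algebraMap ℚ[X] L (derivative p) * (w - w') := by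
  have hw0 : w ≠ 0 := left_ne_zero_of_mul_eq_one hww
  have hDw' : D w' = -w' := by
    obtain rfl : w' = w⁻¹ := eq_inv_of_mul_eq_one_right hww
    rw [Derivation.leibniz_inv, hDw, smul_eq_mul]
    field_simp
  have h1 := (D.restrictScalars ℚ).map_aeval p (genK L)
  rw [← OddPoles.algebraMap_eq_aeval] at h1
  change D _ = _ at h1
  rw [h1, ← OddPoles.algebraMap_eq_aeval, ← ha]
  change _ * D (w + w') = _
  rw [map_add, hDw, hDw']
  ring

/-- A finitely generated module over the integral closure `O` of `ℚ[X]`, containing `O` and the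
image of `O` under the derivation. -/
theorem exists_submodule_derivation [Module.Finite ℚ[X] (integralClosure ℚ[X] L)]
    {F : Type*} [Field F] [CharZero F] [Algebra F L] {D : Derivation F L L} {w w' : L}
    (hDw : D w = w) (hww : w * w' = 1) (ha : w + w' = genK L)
    (hw : IsIntegral ℚ[X] w) (hw' : IsIntegral ℚ[X] w') :
    ∃ M : Submodule ℚ[X] L, M.FG ∧ (∀ x, IsIntegral ℚ[X] x → x ∈ M) ∧
      (∀ x, IsIntegral ℚ[X] x → D x ∈ M) ∧
      ∀ x m, IsIntegral ℚ[X] x → m ∈ M → x * m ∈ M := by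
  classical
  let O : Submodule ℚ[X] L := Subalgebra.toSubmodule (integralClosure ℚ[X] L)
  have hO : O.FG := Module.Finite.iff_fg.1 ‹_›
  obtain ⟨s, hs⟩ := hO
  let T : Submodule ℚ[X] L := Submodule.span ℚ[X] ((insert 1 (s.image D) : Finset L) : Set L)
  have h1 : (1 : L) ∈ T := Submodule.subset_span (by simp)
  have hOT : ∀ x, IsIntegral ℚ[X] x → x ∈ O * T := fun x hx => by
    have := Submodule.mul_mem_mul (show x ∈ O from hx) h1
    rwa [mul_one] at this
  have hmul : ∀ x m, IsIntegral ℚ[X] x → m ∈ O * T → x * m ∈ O * T := by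
    intro x m hx hm
    refine Submodule.mul_induction_on hm (fun y hy z hz => ?_) (fun y z hy hz => ?_)
    · rw [← mul_assoc]
      exact Submodule.mul_mem_mul (IsIntegral.mul hx hy) hz
    · rw [mul_add]
      exact add_mem hy hz
  refine ⟨O * T, Submodule.FG.mul ⟨s, hs⟩ ⟨_, rfl⟩, hOT, fun x hx => ?_, hmul⟩
  have hxs : x ∈ Submodule.span ℚ[X] (s : Set L) := by rw [hs]; exact hx
  clear hx
  induction hxs using Submodule.span_induction with
  | mem x hx =>
    have := hmul 1 (D x) isIntegral_one
      (by
        have := Submodule.mul_mem_mul (show (1 : L) ∈ O from isIntegral_one)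
          (show D x ∈ T from Submodule.subset_span (by
            simp only [Finset.coe_insert, Finset.coe_image]
            exact Set.mem_insert_of_mem _ ⟨x, hx, rfl⟩))
        rwa [one_mul] at this)
    rwa [one_mul] at this
  | zero => rw [map_zero]; exact zero_mem _
  | add x y _ _ hx hy => rw [map_add]; exact add_mem hx hy
  | smul p x hx ih =>
    rw [Algebra.smul_def, Derivation.leibniz, smul_eq_mul, smul_eq_mul,
      derivation_algebraMap hDw hww ha]
    have hx' : IsIntegral ℚ[X] x := by rw [hs] at hx; exact hx
    exact add_mem (hmul _ _ isIntegral_algebraMap ih)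
      (hOT _ (hx'.mul (isIntegral_algebraMap.mul (hw.sub hw'))))

theorem exists_exponential_pin (h : IsFunctionField ℚ L) (ht : Transcendental ℚ (genK L))
    {w w' : L} (hww : w * w' = 1) (ha : w + w' = genK L) :
    ∃ M D' : ℕ, 0 < M ∧ 0 < D' ∧ ∀ u u' c g : L, IsIntegral ℚ[X] u → IsIntegral ℚ[X] u' →
      IsIntegral ℚ[X] g → IsAlgebraic ℚ c → u * u' = 1 →
      u - 1 - c * (w ^ (2 * M) - 1) =
        (algebraMap ℚ[X] L (Chebyshev.S ℚ ((M : ℤ) - 1))) ^ 2 * g →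
      ∃ j : ℤ, (D' * (2 * M : ℕ) : L) * c = j ∧ u ^ (D' * (2 * M)) = w ^ ((2 * M : ℕ) * j) := by
  have hw0 : w ≠ 0 := left_ne_zero_of_mul_eq_one hww
  have hw'0 : w' ≠ 0 := right_ne_zero_of_mul_eq_one hww
  obtain rfl : w' = w⁻¹ := eq_inv_of_mul_eq_one_right hww
  let F := algebraicClosure ℚ L
  have hFalg : Algebra.IsAlgebraic ℚ F := ⟨fun x =>
    (isAlgebraic_algebraMap_iff (A := L) F.val.injective).1 (mem_algebraicClosure_iff.1 x.2)⟩
  have hwt' : Transcendental ℚ w := fun hw => ht (ha ▸ hw.add hw.inv)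
  have hwt : Transcendental F w := fun hw => hwt' (hw.restrictScalars ℚ)
  have hF : IsFunctionField F L := h.extendScalars
  have hfd := hF.finiteDimensional hwt
  obtain ⟨D, hDw⟩ := exists_derivation_apply_self hwt (hF.isAlgebraic hwt)
  have hgen : IsIntegral ℚ[X] (genK L) := isIntegral_algebraMap (x := (X : ℚ[X]))
  have hquad : ∀ z : L, z ^ 2 - genK L * z + 1 = 0 → IsIntegral ℚ[X] z := fun z hz => by
    refine ⟨X ^ 2 - C X * X + 1, by monicity!, ?_⟩
    simpa [eval₂_add, eval₂_sub, eval₂_mul, algebraMap_X_eq_genK] using hz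
  have hw : IsIntegral ℚ[X] w := hquad w (by rw [← ha]; field_simp; ring)
  have hw' : IsIntegral ℚ[X] w⁻¹ := hquad _ (by rw [← ha]; field_simp; ring)
  have hinj := IsFunctionField.injective_algebraMap_polynomial ht
  have : FaithfulSMul ℚ[X] L := (faithfulSMul_iff_algebraMap_injective ℚ[X] L).2 hinj
  have : Module.Finite ℚ[X] (integralClosure ℚ[X] L) := h.module_finite ht _
  obtain ⟨𝓜, hfg, hO𝓜, hD𝓜, hmul𝓜⟩ := exists_submodule_derivation hDw hww ha hw hw'
  have : Module.Finite ℚ[X] 𝓜 := Module.Finite.iff_fg.2 hfg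
  have : Module.Free ℚ[X] 𝓜 := Module.free_of_finite_type_torsion_free'
  let V : Submodule ℚ L := Submodule.span ℚ (Set.range (logDerivHom D)) ⊔
    Subalgebra.toSubmodule F.toSubalgebra
  have hV1 := finiteDimensional_span_range_logDerivHom h
    (fun x hx => ⟨(⟨x, mem_algebraicClosure_iff.2 hx⟩ : F), rfl⟩) D
  have hV2 : (Subalgebra.toSubmodule F.toSubalgebra).FG := by
    have := h.finiteDimensional_algebraicClosure
    exact Module.Finite.iff_fg.1 this
  have hV : V.FG := hV1.sup hV2
  let V' : Submodule ℚ 𝓜 := V.comap (𝓜.subtype.restrictScalars ℚ)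
  have hV' : V'.FG := by
    have : Module.Finite ℚ V := Module.Finite.iff_fg.2 hV
    refine Module.Finite.iff_fg.1 (Module.Finite.of_injective
      (((𝓜.subtype.restrictScalars ℚ).restrict (p := V') (q := V) fun x hx => hx)) ?_)
    intro x y hxy
    exact Subtype.ext (Subtype.ext (congrArg (fun z : V => (z : L)) hxy))
  obtain ⟨d, hd⟩ := Module.exists_forall_natDegree_lt hV'
  have hd' : ∀ (p : ℚ[X]) (m : L), d < p.natDegree → m ∈ 𝓜 → algebraMap ℚ[X] L p * m ∈ V →
      algebraMap ℚ[X] L p * m = 0 := fun p m hp hm hpm => by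
    rw [← Algebra.smul_def] at hpm ⊢
    exact congrArg Subtype.val (hd p ⟨m, hm⟩ hp hpm)
  let M := d + 2
  refine ⟨M, Module.finrank (IntermediateField.adjoin F {w}) L, by omega, Module.finrank_pos, ?_⟩
  intro u u' c g hu hu' hg hc huu heq
  have hM1 : ((M : ℤ) - 1) = ((d + 1 : ℕ) : ℤ) := by simp [M]; ring
  rw [hM1] at heq
  set p := Chebyshev.S ℚ ((d + 1 : ℕ) : ℤ) with hp
  have hpdeg : d < p.natDegree := by rw [hp, Chebyshev.natDegree_S]; omega
  set σ := algebraMap ℚ[X] L p with hσ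
  have hσi : IsIntegral ℚ[X] σ := isIntegral_algebraMap
  have hci : IsIntegral ℚ[X] c := (hc.isIntegral).tower_top
  have hwN : w ^ (2 * M) - 1 = σ * (w ^ M * (w - w⁻¹)) := by
    have h1 := Chebyshev.sub_mul_S_eval hww (d + 1)
    have h2 : (Chebyshev.S L ((d + 1 : ℕ) : ℤ)).eval (w + w⁻¹) = σ := by
      rw [hσ, OddPoles.algebraMap_eq_aeval, hp, ha, aeval_def, ← eval_map, Chebyshev.map_S]
    rw [h2] at h1
    have h3 : w ^ M * w⁻¹ ^ M = 1 := by rw [← mul_pow, hww, one_pow]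
    change (w - w⁻¹) * σ = w ^ M - w⁻¹ ^ M at h1
    linear_combination (-w ^ M) * h1 + h3
  have hu0 : u ≠ 0 := left_ne_zero_of_mul_eq_one huu
  let cF : F := ⟨c, mem_algebraicClosure_iff.2 hc⟩
  have hDc : D c = 0 := D.map_algebraMap cF
  set N := 2 * M with hN
  have hDu : D u = algebraMap F L (cF * N) * u := by
    have h1 := congrArg D heq
    have hDN : D (w ^ N) = N * w ^ N := by
      have := Derivation.zpow_of_apply_self hDw hw0 (N : ℤ)
      rwa [zpow_natCast, Int.cast_natCast] at this
    have hDσ := derivation_algebraMap hDw hww ha p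
    rw [← hσ] at hDσ
    simp only [map_sub, Derivation.map_one_eq_zero, Derivation.leibniz, hDc, hDN, smul_eq_mul,
      pow_two, hDσ, sub_zero, mul_zero, add_zero] at h1
    let m : L := u' * (2 * (algebraMap ℚ[X] L (derivative p) * (w - w⁻¹)) * g + σ * D g +
      c * N * (w ^ M * (w - w⁻¹)) * (1 - c) - c * N * (σ * g))
    have hm : u' * D u - c * N = σ * m := by
      simp only [m]
      linear_combination u' * h1 + (-u' * c * N) * heq + c * N * huu + u' * c * N * (1 - c) * hwN
    have hNi : IsIntegral ℚ[X] (N : L) := by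
      rw [← map_natCast (algebraMap ℚ[X] L)]; exact isIntegral_algebraMap
    have h2i : IsIntegral ℚ[X] (2 : L) := by
      rw [← map_ofNat (algebraMap ℚ[X] L)]; exact isIntegral_algebraMap
    have hm𝓜 : m ∈ 𝓜 := by
      refine hmul𝓜 _ _ hu' (sub_mem (add_mem (add_mem (hO𝓜 _ ?_) (hmul𝓜 _ _ hσi (hD𝓜 _ hg)))
        (hO𝓜 _ ?_)) (hO𝓜 _ ?_))
      · exact ((h2i.mul (isIntegral_algebraMap.mul (hw.sub hw'))).mul hg)
      · exact (((hci.mul hNi).mul ((hw.pow _).mul (hw.sub hw'))).mul (isIntegral_one.sub hci))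
      · exact (hci.mul hNi).mul (hσi.mul hg)
    have h0 := hd' p m hpdeg hm𝓜 (by
      rw [← hσ, ← hm]
      refine sub_mem (Submodule.mem_sup_left (Submodule.subset_span ?_))
        (Submodule.mem_sup_right ?_)
      · exact ⟨Additive.ofMul (⟨⟨u, hu⟩, ⟨u', hu'⟩, Subtype.ext huu,
          Subtype.ext ((mul_comm _ _).trans huu)⟩ : (integralClosure ℚ[X] L)ˣ), rfl⟩
      · exact F.mul_mem cF.2 (natCast_mem F N))
    rw [← hσ, ← hm] at h0
    have : algebraMap F L (cF * N) = c * N := by simp [cF]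
    rw [this]
    linear_combination u * h0 - D u * huu
  obtain ⟨j, hj, halg⟩ := Derivation.exists_pow_eq hDw hwt
    (Algebra.IsIntegral.isIntegral u) hu0 hDu
  obtain ⟨q, hq⟩ := minpoly.degree_dvd
    (Algebra.IsIntegral.isIntegral (R := IntermediateField.adjoin F {w}) u)
  set δ := (minpoly (IntermediateField.adjoin F {w}) u).natDegree with hδ
  have hpow : (u ^ δ * w ^ (-j)) ^ N = 1 := by
    have halg' : IsAlgebraic ℚ (u ^ δ * w ^ (-j)) := halg.restrictScalars ℚ
    let Q : L → Prop := fun x => IsIntegral ℚ[X] x ∧ ∃ z, IsIntegral ℚ[X] z ∧ x - 1 = σ * z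
    have hQmul : ∀ x y, Q x → Q y → Q (x * y) := by
      rintro x y ⟨hx, z, hz, hxz⟩ ⟨hy, z', hz', hyz⟩
      exact ⟨hx.mul hy, z * y + z', (hz.mul hy).add hz', by linear_combination y * hxz + hyz⟩
    have hQpow : ∀ x (n : ℕ), Q x → Q (x ^ n) := by
      intro x n hx
      induction n with
      | zero => exact ⟨by simpa using isIntegral_one, 0, isIntegral_zero, by simp⟩
      | succ n ih => rw [pow_succ]; exact hQmul _ _ ih hx
    have hQu : Q u := ⟨hu, c * (w ^ M * (w - w⁻¹)) + σ * g,
      (hci.mul ((hw.pow _).mul (hw.sub hw'))).add (hσi.mul hg), by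
        linear_combination heq + c * hwN⟩
    have hQw : Q (w ^ N) := ⟨hw.pow _, _, (hw.pow _).mul (hw.sub hw'), hwN⟩
    have hQw' : Q (w⁻¹ ^ N) := ⟨hw'.pow _, -(w⁻¹ ^ N * (w ^ M * (w - w⁻¹))),
      ((hw'.pow _).mul ((hw.pow _).mul (hw.sub hw'))).neg, by
        have h3 : w ^ N * w⁻¹ ^ N = 1 := by rw [← mul_pow, hww, one_pow]
        linear_combination (-w⁻¹ ^ N) * hwN + h3⟩
    have hQj : Q ((w ^ (-j)) ^ N) := by
      rw [← zpow_natCast, ← zpow_mul, mul_comm, zpow_mul, zpow_natCast]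
      obtain ⟨n, hn | hn⟩ := Int.eq_nat_or_neg (-j)
      · rw [hn, zpow_natCast]
        exact hQpow _ _ hQw
      · rw [hn, zpow_neg, zpow_natCast, ← inv_pow, ← inv_pow]
        exact hQpow _ _ hQw'
    obtain ⟨-, z, hz, hxz⟩ : Q ((u ^ δ * w ^ (-j)) ^ N) := by
      rw [mul_pow, ← pow_mul, mul_comm δ, pow_mul]
      exact hQmul _ _ (by rw [← pow_mul]; exact hQpow _ _ hQu) hQj
    have h0 := hd' p z hpdeg (hO𝓜 _ hz) (by
      rw [← hσ, ← hxz]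
      exact Submodule.mem_sup_right (F.sub_mem
        (pow_mem (show _ ∈ F from mem_algebraicClosure_iff.2 halg') N) F.one_mem))
    rw [← hσ, ← hxz] at h0
    exact sub_eq_zero.1 h0
  have huj : u ^ (δ * N) = w ^ ((N : ℤ) * j) := by
    rw [mul_pow, ← zpow_natCast (w ^ (-j)), ← zpow_mul, ← pow_mul] at hpow
    rw [eq_comm, mul_comm, ← mul_one (w ^ _), ← hpow, mul_left_comm, ← zpow_add₀ hw0]
    simp
  refine ⟨q * j, ?_, ?_⟩
  · have h1 := congrArg (algebraMap F L) hj
    simp only [map_mul, map_natCast, map_intCast] at h1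
    have h2 : algebraMap F L cF = c := rfl
    rw [h2] at h1
    rw [hq]
    push_cast
    linear_combination (q : L) * h1
  · rw [hq, mul_right_comm, pow_mul, huj, ← zpow_natCast, ← zpow_mul]
    congr 1
    ring

end ExpPin

theorem IsFunctionField.of_finite_extension {F K L : Type*} [Field F] [Field K] [Field L]
    [Algebra F K] [Algebra K L] [Algebra F L] [IsScalarTower F K L] [FiniteDimensional K L]
    (h : IsFunctionField F K) : IsFunctionField F L := by
  refine ⟨?_, ?_⟩
  · have := h.essFinite
    exact Algebra.EssFiniteType.comp F K L
  · have : FaithfulSMul F K :=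
      (faithfulSMul_iff_algebraMap_injective F K).2 (algebraMap F K).injective
    have h1 := lift_trdeg_add_eq F K L
    rw [trdeg_eq_zero (R := K) (A := L), h.trdeg_eq] at h1
    simpa using h1.symm

/-- Interpolation: a polynomial whose values at sufficiently many constants lie in a subspace
has all its coefficients in that subspace. -/
theorem Polynomial.coeff_mem_of_eval_mem {V : Submodule ℚ ℚ[X]} {P : ℚ[X][X]} {n : ℕ}
    (hn : P.natDegree ≤ n) (hP : ∀ i ≤ n, P.eval (i : ℚ[X]) ∈ V) (j : ℕ) : P.coeff j ∈ V := by
  by_contra hj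
  obtain ⟨f, hf, hV⟩ := Submodule.exists_le_ker_of_notMem hj
  let q : ℚ[X] := ∑ i ∈ Finset.range (n + 1), C (f (P.coeff i)) * X ^ i
  have hq : ∀ i, q.coeff i = f (P.coeff i) := fun i => by
    simp only [q, finsetSum_coeff, coeff_C_mul_X_pow]
    rw [Finset.sum_ite_eq]
    split_ifs with h
    · rfl
    · rw [coeff_eq_zero_of_natDegree_lt (by simp at h; omega), map_zero]
  have hq0 : q = 0 := by
    refine eq_zero_of_natDegree_lt_card_of_eval_eq_zero' q
      ((Finset.range (n + 1)).image (fun i : ℕ => (i : ℚ))) (fun x hx => ?_) ?_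
    · simp only [Finset.mem_image, Finset.mem_range] at hx
      obtain ⟨i, hi, rfl⟩ := hx
      have h1 : f (P.eval (i : ℚ[X])) = 0 := hV (hP i (by omega))
      rw [eval_eq_sum_range' (n := n + 1) (by omega), map_sum] at h1
      rw [← h1]
      simp only [q, eval_finsetSum, eval_mul, eval_C, eval_pow, eval_X]
      refine Finset.sum_congr rfl fun k _ => ?_
      have : P.coeff k * (i : ℚ[X]) ^ k = ((i : ℚ) ^ k) • P.coeff k := by
        rw [smul_eq_C_mul]
        simp [mul_comm]
      rw [this, map_smul, smul_eq_mul, mul_comm]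
    · rw [Finset.card_image_of_injective _ Nat.cast_injective, Finset.card_range, Nat.lt_succ_iff]
      refine natDegree_sum_le_of_forall_le _ _ fun i hi => ?_
      exact (natDegree_C_mul_X_pow_le _ _).trans (by simp at hi; omega)
  apply hf
  rw [← hq, hq0, coeff_zero]

section

variable {R : Type*} [CommRing R] [IsDomain R] [Algebra ℚ[X] R] [Module.Finite ℚ[X] R]
  [Module.Free ℚ[X] R]

/-- The characteristic polynomial of multiplication by `x`. -/
noncomputable def mulCharpoly (x : R) : ℚ[X][X] := (Algebra.lmul ℚ[X] R x).charpoly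

theorem mulCharpoly_monic (x : R) : (mulCharpoly x).Monic := LinearMap.charpoly_monic _

theorem natDegree_mulCharpoly (x : R) : (mulCharpoly x).natDegree = Module.finrank ℚ[X] R :=
  LinearMap.charpoly_natDegree _

theorem aeval_mulCharpoly (x : R) : aeval x (mulCharpoly x) = 0 :=
  Algebra.aeval_self_charpoly_lmul x

theorem eval_mulCharpoly (x : R) (q : ℚ[X]) :
    (mulCharpoly x).eval q = Algebra.norm ℚ[X] (algebraMap ℚ[X] R q - x) := by
  rw [mulCharpoly, LinearMap.eval_charpoly, Algebra.norm_apply]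
  congr 1
  ext y
  simp [Algebra.smul_def]

theorem isAlgebraic_of_isUnit {K : Type*} [Field K] [CharZero K] [Algebra R K] [Algebra ℚ[X] K]
    [IsScalarTower ℚ[X] R K] {c : R}
    (hc : ∀ i ≤ Module.finrank ℚ[X] R, ((i : R) - c = 0 ∨ IsUnit ((i : R) - c))) :
    IsAlgebraic ℚ (algebraMap R K c) := by
  have h1 : ∀ j, (mulCharpoly c).coeff j ∈ LinearMap.range (Algebra.linearMap ℚ ℚ[X]) := by
    refine coeff_mem_of_eval_mem (natDegree_mulCharpoly c).le fun i hi => ?_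
    rw [eval_mulCharpoly, map_natCast]
    rcases hc i hi with h | h
    · rw [h, Algebra.norm_zero]; exact zero_mem _
    · have := h.map (Algebra.norm ℚ[X])
      obtain ⟨r, hr, h2⟩ := isUnit_iff.1 this
      exact ⟨r, h2⟩
  have h2 : mulCharpoly c ∈ lifts (C : ℚ →+* ℚ[X]) := by
    rw [lifts_iff_coeff_lifts]
    intro j
    obtain ⟨r, hr⟩ := h1 j
    exact ⟨r, hr⟩
  obtain ⟨q, hq, -, hqm⟩ := lifts_and_natDegree_eq_and_monic h2 (mulCharpoly_monic c)
  refine ⟨q, hqm.ne_zero, ?_⟩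
  have h3 := congrArg (algebraMap R K) (aeval_mulCharpoly c)
  rw [map_zero, ← aeval_algebraMap_apply, ← hq, aeval_def, eval₂_map] at h3
  rw [aeval_def, ← h3]
  congr 1
  exact Subsingleton.elim _ _

end

/-- The distinguished generator of a `ℚ[X]`-algebra. -/
noncomputable def genR (R : Type*) [CommRing R] [Algebra ℚ[X] R] : R := algebraMap ℚ[X] R X

/-- The inclusion of the constants. -/
noncomputable def genMap (R : Type*) [CommRing R] [Algebra ℚ[X] R] : ℚ →+* R :=
  (algebraMap ℚ[X] R).comp C

theorem eval_genR {R : Type*} [CommRing R] [Algebra ℚ[X] R] (p : ℚ[X]) :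
    (p.map (genMap R)).eval (genR R) = algebraMap ℚ[X] R p := by
  rw [eval_map, genMap, genR, ← hom_eval₂, eval₂_C_X]

/-- The ring `R[ω]` with `ω² - aω + 1 = 0`, where `a` is the distinguished generator. -/
abbrev QR (R : Type*) [CommRing R] [Algebra ℚ[X] R] := QuadraticAlgebra R (-1) (genR R)

namespace QR

open QuadraticAlgebra

section

variable {R : Type*} [CommRing R] [Algebra ℚ[X] R]

/-- The standard generator of `R[ω]`. -/
def w (R : Type*) [CommRing R] [Algebra ℚ[X] R] : QR R := ⟨0, 1⟩

theorem norm_w : norm (w R) = 1 := by simp [norm_def, w]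

theorem w_mul_star : w R * star (w R) = 1 := by
  rw [← algebraMap_norm_eq_mul_star, norm_w, map_one]

theorem w_add_star : w R + star (w R) = algebraMap R (QR R) (genR R) := by
  ext <;> simp [w]

theorem w_pow_sub_one (M : ℕ) : (w R) ^ (2 * (M + 1)) - 1 =
    algebraMap R (QR R) (algebraMap ℚ[X] R (Chebyshev.S ℚ M)) *
      (w R ^ (M + 1) * (w R - star (w R))) := by
  have h1 := Chebyshev.sub_mul_S_eval (w_mul_star (R := R)) M
  rw [w_add_star, ← Chebyshev.algebraMap_eval_S, ← Chebyshev.map_S (genMap R), eval_genR] at h1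
  have h3 : w R ^ (M + 1) * star (w R) ^ (M + 1) = 1 := by rw [← mul_pow, w_mul_star, one_pow]
  linear_combination (-w R ^ (M + 1)) * h1 + h3

theorem w_pow_add_star (m : ℕ) : w R ^ m + star (w R) ^ m =
    algebraMap R (QR R) (algebraMap ℚ[X] R (Chebyshev.C ℚ m)) := by
  have key : ∀ m : ℕ, w R ^ m + star (w R) ^ m =
      (Chebyshev.C (QR R) m).eval (w R + star (w R)) := by
    intro m
    induction m using Nat.twoStepInduction with
    | zero => simp; norm_num
    | one => simp
    | more n h1 h2 =>
      push_cast at h2 ⊢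
      rw [Chebyshev.C_add_two]
      simp only [eval_sub, eval_mul, eval_X]
      linear_combination (w R + star (w R)) * h2 - h1 -
        (w R ^ n + star (w R) ^ n) * w_mul_star (R := R)
  rw [key, w_add_star, ← Chebyshev.algebraMap_eval_C, ← Chebyshev.map_C (genMap R), eval_genR]

theorem two_mul_re_add (m : ℕ) : 2 * (w R ^ m).re + (w R ^ m).im * genR R =
    algebraMap ℚ[X] R (Chebyshev.C ℚ m) := by
  have h := congrArg QuadraticAlgebra.re (w_pow_add_star (R := R) m)
  rw [← star_pow, re_add, re_star, algebraMap_re] at h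
  rw [← h]
  ring

end

end QR

namespace QR

open QuadraticAlgebra

section

variable {R K : Type*} [CommRing R] [IsDomain R] [Algebra ℚ[X] R] [Module.Finite ℚ[X] R]
  [Module.Free ℚ[X] R] [Field K] [CharZero K] [Algebra R K] [Algebra ℚ[X] K]
  [IsScalarTower ℚ[X] R K] [IsFractionRing R K]

theorem exists_pin_aux {L : Type*} [Field L] [CharZero L] [Algebra ℚ[X] L]
    [Algebra K L] [IsScalarTower ℚ[X] K L] (hL : IsFunctionField ℚ L) {w₀ w₁ : L}
    (hww : w₀ * w₁ = 1) (ha : w₀ + w₁ = genK L) :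
    ∃ M D' : ℕ, 0 < M ∧ 0 < D' ∧ ∀ (u g : QR R) (c : R), IsAlgebraic ℚ (algebraMap R K c) →
      norm u = 1 → u - 1 - algebraMap R (QR R) c * (w R ^ (2 * M) - 1) =
        algebraMap R (QR R) (algebraMap ℚ[X] R (Chebyshev.S ℚ ((M : ℤ) - 1))) ^ 2 * g →
      ∃ j : ℤ, ((D' * (2 * M) : ℕ) : R) * c = j ∧
        ∀ n : ℕ, j = n → u ^ (D' * (2 * M)) = w R ^ (2 * M * n) := by
  have hKL : Function.Injective (algebraMap K L) := (algebraMap K L).injective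
  have hgen : algebraMap K L (genK K) = genK L := by
    rw [genK, genK, ← IsScalarTower.algebraMap_apply]
  have htL : Transcendental ℚ (genK L) := by
    rw [← hgen]
    intro hx
    refine OddPoles.transcendental_genK R (K := K) ?_
    obtain ⟨p, hp, hpx⟩ := hx
    refine ⟨p, hp, hKL ?_⟩
    rw [map_zero, ← hpx, aeval_def, aeval_def, hom_eval₂]
    congr 1
    exact Subsingleton.elim _ _
  obtain ⟨M, D', hM, hD', hpin⟩ := exists_exponential_pin hL htL hww ha
  refine ⟨M, D', hM, hD', fun u g c hc hu heq => ?_⟩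
  let e : R →+* L := (algebraMap K L).comp (algebraMap R K)
  have heinj : Function.Injective e := hKL.comp (IsFractionRing.injective R K)
  letI : Algebra R L := e.toAlgebra
  have heR : ∀ p : ℚ[X], e (algebraMap ℚ[X] R p) = algebraMap ℚ[X] L p := fun p => by
    rw [IsScalarTower.algebraMap_apply ℚ[X] K L, IsScalarTower.algebraMap_apply ℚ[X] R K]; rfl
  have : IsScalarTower ℚ[X] R L := IsScalarTower.of_algebraMap_eq fun p => (heR p).symm
  have heg : e (genR R) = genK L := heR X
  let φ : QR R →ₐ[R] L := QuadraticAlgebra.lift ⟨w₀, by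
    rw [Algebra.smul_def, Algebra.smul_def, map_neg, map_one]
    change w₀ * w₀ = -1 * 1 + e (genR R) * w₀
    rw [heg, ← ha]
    linear_combination -hww⟩
  have hφ : ∀ z : QR R, φ z = e z.re + e z.im * w₀ := fun z => by
    simp only [φ, lift_apply_apply, Algebra.smul_def, mul_one]
    rfl
  have hφw : φ (w R) = w₀ := by simp [hφ, w]
  have hφw' : φ (star (w R)) = w₁ := by
    have h1 := congrArg φ (w_mul_star (R := R))
    rw [map_mul, hφw, map_one] at h1
    have h0 : w₀ ≠ 0 := left_ne_zero_of_mul_eq_one hww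
    exact mul_left_cancel₀ h0 (h1.trans hww.symm)
  have hφR : ∀ r : R, φ (algebraMap R (QR R) r) = e r := fun r => φ.commutes r
  have hint : ∀ z : QR R, IsIntegral ℚ[X] (φ z) := fun z => by
    have h1 : IsIntegral R z := Algebra.IsIntegral.isIntegral z
    have h2 : IsIntegral R (φ z) := h1.map φ
    exact isIntegral_trans (R := ℚ[X]) (A := R) _ h2
  have halg : IsAlgebraic ℚ (e c) := by
    obtain ⟨p, hp, hpx⟩ := hc
    refine ⟨p, hp, ?_⟩
    have h1 := congrArg (algebraMap K L) hpx
    rw [map_zero, aeval_def, hom_eval₂] at h1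
    rw [← h1, aeval_def]
    congr 1
    exact Subsingleton.elim _ _
  have huu : φ u * φ (star u) = 1 := by
    rw [← map_mul, ← algebraMap_norm_eq_mul_star, hu, map_one, map_one]
  obtain ⟨j, hj, hpow⟩ := hpin (φ u) (φ (star u)) (e c) (φ g) (hint _) (hint _) (hint _)
    halg huu (by
    have h1 := congrArg φ heq
    simp only [map_sub, map_mul, map_pow, map_one, hφR, hφw, heR] at h1
    exact h1)
  refine ⟨j, heinj ?_, fun n hn => ?_⟩
  · rw [map_mul, map_natCast, map_intCast, ← hj]
    push_cast
    ring
  · subst hn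
    have hpow1 : φ (u ^ (D' * (2 * M))) = φ (w R ^ (2 * M * n)) := by
      rw [map_pow, map_pow, hφw, hpow]
      norm_cast
    have hpow2 : φ (star (u ^ (D' * (2 * M)))) = φ (star (w R ^ (2 * M * n))) := by
      have h1 : φ (u ^ (D' * (2 * M))) * φ (star (u ^ (D' * (2 * M)))) = 1 := by
        rw [star_pow, map_pow, map_pow, ← mul_pow, huu, one_pow]
      have h2 : φ (w R ^ (2 * M * n)) * φ (star (w R ^ (2 * M * n))) = 1 := by
        rw [star_pow, map_pow, map_pow, ← mul_pow, hφw, hφw', hww, one_pow]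
      rw [hpow1] at h1
      exact mul_left_cancel₀ (left_ne_zero_of_mul_eq_one h2) (h1.trans h2.symm)
    have hw01 : w₀ ≠ w₁ := by
      rintro rfl
      refine htL ?_
      rw [← ha]
      have : IsAlgebraic ℚ w₀ := ⟨X ^ 2 - 1, (monic_X_pow_sub_C (1 : ℚ) two_ne_zero).ne_zero, by
        simp [pow_two, hww]⟩
      exact this.add this
    rw [hφ, hφ] at hpow1 hpow2
    simp only [re_star, im_star, map_add, map_neg, map_mul, heg, ← ha] at hpow2
    have him : e (u ^ (D' * (2 * M))).im = e (w R ^ (2 * M * n)).im := by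
      refine mul_right_cancel₀ (sub_ne_zero.2 hw01) ?_
      linear_combination hpow1 - hpow2
    ext
    · refine heinj ?_
      linear_combination hpow1 - w₀ * him
    · exact heinj him

theorem exists_pin (h : OddPoles R K) :
    ∃ M D' : ℕ, 0 < M ∧ 0 < D' ∧ ∀ (u g : QR R) (c : R), IsAlgebraic ℚ (algebraMap R K c) →
      norm u = 1 → u - 1 - algebraMap R (QR R) c * (w R ^ (2 * M) - 1) =
        algebraMap R (QR R) (algebraMap ℚ[X] R (Chebyshev.S ℚ ((M : ℤ) - 1))) ^ 2 * g →
      ∃ j : ℤ, ((D' * (2 * M) : ℕ) : R) * c = j ∧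
        ∀ n : ℕ, j = n → u ^ (D' * (2 * M)) = w R ^ (2 * M * n) := by
  let f : K[X] := X ^ 2 - C (genK K) * X + 1
  have hf : f.degree ≠ 0 := by
    have : f.degree = 2 := by simp only [f]; compute_degree!
    rw [this]; decide
  let L := f.SplittingField
  obtain ⟨w₀, hw₀⟩ := (SplittingField.splits f).exists_eval_eq_zero (by rwa [degree_map])
  have hw : w₀ ^ 2 - algebraMap K L (genK K) * w₀ + 1 = 0 := by
    simpa [f] using hw₀
  have hc : CharZero L := charZero_of_injective_algebraMap (algebraMap K L).injective
  have hfin : FiniteDimensional K L := inferInstance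
  have hFF : IsFunctionField ℚ L := by
    have : IsScalarTower ℚ K L := IsScalarTower.of_algebraMap_eq' (Subsingleton.elim _ _)
    exact h.isFunctionField.of_finite_extension
  have hgen : algebraMap K L (genK K) = genK L := by
    rw [genK, genK, ← IsScalarTower.algebraMap_apply]
  refine exists_pin_aux (K := K) hFF (w₀ := w₀) (w₁ := genK L - w₀) ?_ (by ring)
  rw [← hgen]
  linear_combination -hw

end

end QR

theorem sq_sub_one_dvd {A : Type*} [CommRing A] (x : A) (n : ℕ) :
    (x - 1) ^ 2 ∣ x ^ n - 1 - n * (x - 1) := by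
  induction n with
  | zero => simp
  | succ n ih =>
    obtain ⟨y, hy⟩ := ih
    exact ⟨x * y + n, by push_cast; linear_combination x * hy⟩

namespace DiophSys

open QuadraticAlgebra

section

variable {R : Type*} [CommRing R] {ι : Type} {α β : R}

/-- A function with values in a quadratic algebra that is given by polynomials. -/
def PolyQ (f : (ι → R) → QuadraticAlgebra R α β) : Prop :=
  PolyFun (fun ρ => (f ρ).re) ∧ PolyFun (fun ρ => (f ρ).im)

namespace PolyQ

variable {f g : (ι → R) → QuadraticAlgebra R α β}

theorem const (c : QuadraticAlgebra R α β) : PolyQ (fun _ : ι → R => c) :=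
  ⟨PolyFun.const _, PolyFun.const _⟩

theorem mk {f g : (ι → R) → R} (hf : PolyFun f) (hg : PolyFun g) :
    PolyQ (fun ρ => (⟨f ρ, g ρ⟩ : QuadraticAlgebra R α β)) := ⟨hf, hg⟩

theorem coe {f : (ι → R) → R} (hf : PolyFun f) :
    PolyQ (fun ρ => algebraMap R (QuadraticAlgebra R α β) (f ρ)) := ⟨hf, PolyFun.const _⟩

theorem sub (hf : PolyQ f) (hg : PolyQ g) : PolyQ (fun ρ => f ρ - g ρ) :=
  ⟨hf.1.sub hg.1, hf.2.sub hg.2⟩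

theorem mul (hf : PolyQ f) (hg : PolyQ g) : PolyQ (fun ρ => f ρ * g ρ) :=
  ⟨(hf.1.mul hg.1).add (((PolyFun.const α).mul hf.2).mul hg.2),
    ((hf.1.mul hg.2).add (hf.2.mul hg.1)).add (((PolyFun.const β).mul hf.2).mul hg.2)⟩

theorem pow (hf : PolyQ f) (n : ℕ) : PolyQ (fun ρ => f ρ ^ n) := by
  induction n with
  | zero => simpa only [pow_zero] using const 1
  | succ n ih => simpa only [pow_succ] using ih.mul hf

theorem norm (hf : PolyQ f) : PolyFun (fun ρ => QuadraticAlgebra.norm (f ρ)) :=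
  ((hf.1.mul hf.1).add (((PolyFun.const β).mul hf.1).mul hf.2)).sub
    (((PolyFun.const α).mul hf.2).mul hf.2)

theorem eq (hf : PolyQ f) (hg : PolyQ g) : DS (fun ρ => f ρ = g ρ) :=
  ((DS.eq hf.1 hg.1).and (DS.eq hf.2 hg.2)).congr fun ρ => by
    rw [QuadraticAlgebra.ext_iff]

end PolyQ

/-- Being zero or a unit is Diophantine. -/
theorem d1_zero_or_isUnit [IsDomain R] : D1 (fun x : R => x = 0 ∨ IsUnit x) := by
  intro ι f hf
  have : DS (fun ρ => ∃ v, f ρ * (f ρ * v - 1) = 0) :=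
    DS.ex (DS.eq (hf.lift.mul ((hf.lift.mul (PolyFun.proj _)).sub (PolyFun.const 1)))
      (PolyFun.const 0))
  refine this.congr fun ρ => ?_
  constructor
  · rintro (h | h)
    · exact ⟨0, by simp [h]⟩
    · obtain ⟨v, hv⟩ := h.exists_right_inv
      exact ⟨v, by simp [hv]⟩
  · rintro ⟨v, hv⟩
    rcases mul_eq_zero.1 hv with h | h
    · exact Or.inl h
    · exact Or.inr (IsUnit.of_mul_eq_one _ (sub_eq_zero.1 h))

end

section

variable {R K : Type*} [CommRing R] [IsDomain R] [Algebra ℚ[X] R] [Module.Finite ℚ[X] R]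
  [Module.Free ℚ[X] R] [Field K] [CharZero K] [Algebra R K] [Algebra ℚ[X] K]
  [IsScalarTower ℚ[X] R K] [IsFractionRing R K]

/-- The auxiliary relation cutting out the powers of `ω` whose exponent is a multiple of `2 * M`. -/
def ExpRel (R : Type*) [CommRing R] [Algebra ℚ[X] R] (M : ℕ) (c : R) (u : QR R) : Prop :=
  (∀ i ∈ Finset.range (Module.finrank ℚ[X] R + 1), ((i : R) - c = 0 ∨ IsUnit ((i : R) - c))) ∧
    norm u = 1 ∧ ∃ g : QR R, u - 1 - algebraMap R (QR R) c * (QR.w R ^ (2 * M) - 1) =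
      algebraMap R (QR R) (algebraMap ℚ[X] R (Chebyshev.S ℚ ((M : ℤ) - 1))) ^ 2 * g

theorem ds_expRel (M : ℕ) {ι : Type} {c r s : (ι → R) → R} (hc : PolyFun c) (hr : PolyFun r)
    (hs : PolyFun s) : DS (fun ρ => ExpRel R M (c ρ) ⟨r ρ, s ρ⟩) := by
  refine DS.and (DS.forall_finset _ fun i _ => d1_zero_or_isUnit
    ((PolyFun.const (i : R)).sub hc)) (DS.and (DS.eq (PolyQ.mk hr hs).norm (PolyFun.const 1)) ?_)
  have : DS (fun ρ => ∃ g₁ g₂ : R, (⟨r ρ, s ρ⟩ : QR R) - 1 -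
      algebraMap R (QR R) (c ρ) * (QR.w R ^ (2 * M) - 1) =
      algebraMap R (QR R) (algebraMap ℚ[X] R (Chebyshev.S ℚ ((M : ℤ) - 1))) ^ 2 * ⟨g₁, g₂⟩) :=
    DS.ex (DS.ex (((PolyQ.mk hr.lift.lift hs.lift.lift).sub (PolyQ.const 1) |>.sub
      ((PolyQ.coe hc.lift.lift).mul (PolyQ.const _))).eq
        ((PolyQ.const _).mul (PolyQ.mk (PolyFun.proj _) (PolyFun.proj _)))))
  exact this.congr fun ρ => ⟨fun ⟨g, hg⟩ => ⟨g.1, g.2, hg⟩, fun ⟨g₁, g₂, hg⟩ => ⟨_, hg⟩⟩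

theorem expRel_natCast {M : ℕ} (hM : 0 < M) (n : ℕ) :
    ExpRel R M (n : R) (QR.w R ^ (2 * M * n)) := by
  refine ⟨fun i _ => ?_, by rw [map_pow, QR.norm_w, one_pow], ?_⟩
  · by_cases h : (i : ℚ) - n = 0
    · left
      have := congrArg (genMap R) h
      simpa using this
    · right
      have := (IsUnit.mk0 _ h).map (genMap R)
      simpa using this
  · obtain ⟨M, rfl⟩ : ∃ m, M = m + 1 := ⟨M - 1, by omega⟩
    obtain ⟨y, hy⟩ := sq_sub_one_dvd (QR.w R ^ (2 * (M + 1))) n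
    rw [pow_mul]
    refine ⟨(QR.w R ^ (M + 1) * (QR.w R - star (QR.w R))) ^ 2 * y, ?_⟩
    have h1 := QR.w_pow_sub_one (R := R) M
    rw [map_natCast, hy, h1]
    have : ((M + 1 : ℕ) : ℤ) - 1 = M := by push_cast; ring
    rw [this]
    ring

variable (R) in
/-- `Exp κ n r s` says that `n` is a natural number and `r + s ω = ω ^ (κ n)`. -/
def Exp (κ : ℕ) (n r s : R) : Prop := ∃ m : ℕ, n = m ∧ (⟨r, s⟩ : QR R) = QR.w R ^ (κ * m)

theorem exists_d3_exp (h : OddPoles R K) : D1 (fun n : R => ∃ z : ℤ, n = z) ∧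
    D1 (fun n : R => ∃ m : ℕ, n = m) ∧ ∃ κ : ℕ, 0 < κ ∧ D3 (Exp R κ) := by
  obtain ⟨M, D', hM, hD', hpin⟩ := QR.exists_pin h
  have hchar : CharZero R := (algebraMap R K).charZero
  have hpin' : ∀ c u, ExpRel R M c u → ∃ j : ℤ, ((D' * (2 * M) : ℕ) : R) * c = j ∧
        ∀ n : ℕ, j = n → u ^ (D' * (2 * M)) = QR.w R ^ (2 * M * n) := by
    rintro c u ⟨h1, h2, g, h3⟩
    exact hpin u g c (isAlgebraic_of_isUnit fun i hi => h1 i (by simp; omega)) h2 h3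
  set N := D' * (2 * M) with hN
  have hN0 : 0 < N := by positivity
  have hZ : D1 (fun n : R => ∃ z : ℤ, n = z) := by
    intro ι f hf
    have : DS (fun ρ => ∃ c r s c' r' s' x : R, ExpRel R M c ⟨r, s⟩ ∧ ExpRel R M c' ⟨r', s'⟩ ∧
        ∏ i ∈ Finset.range N, (x - (i : R)) = 0 ∧ f ρ = N * (c - c') + x) := by
      refine DS.ex (DS.ex (DS.ex (DS.ex (DS.ex (DS.ex (DS.ex ?_))))))
      refine (ds_expRel M (PolyFun.proj _) (PolyFun.proj _) (PolyFun.proj _)).and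
        ((ds_expRel M (PolyFun.proj _) (PolyFun.proj _) (PolyFun.proj _)).and
        ((DS.eq (PolyFun.prod _ fun i _ => (PolyFun.proj _).sub (PolyFun.const _))
          (PolyFun.const 0)).and (DS.eq hf.lift.lift.lift.lift.lift.lift.lift
          (((PolyFun.const _).mul ((PolyFun.proj _).sub (PolyFun.proj _))).add
            (PolyFun.proj _)))))
    refine this.congr fun ρ => ?_
    constructor
    · rintro ⟨z, hz⟩
      have hz' := Int.emod_add_mul_ediv z N
      have h0 := Int.emod_nonneg z (b := N) (by positivity)
      have h1 := Int.emod_lt_of_pos z (b := N) (by positivity)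
      obtain ⟨x, hx⟩ := Int.eq_ofNat_of_zero_le h0
      obtain ⟨p, q, hpq⟩ : ∃ p q : ℕ, z / N = p - q := ⟨(z / N).toNat, (-(z / N)).toNat, by omega⟩
      refine ⟨p, _, _, q, _, _, x, expRel_natCast hM p, expRel_natCast hM q,
        Finset.prod_eq_zero (i := x) (by simp; omega) (sub_self _), ?_⟩
      rw [hz, ← hz', hx, hpq]
      push_cast
      ring
    · rintro ⟨c, r, s, c', r', s', x, hc, hc', hx, hf⟩
      obtain ⟨j, hj, -⟩ := hpin' _ _ hc
      obtain ⟨j', hj', -⟩ := hpin' _ _ hc'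
      obtain ⟨i, -, hi⟩ := Finset.prod_eq_zero_iff.1 hx
      refine ⟨j - j' + i, ?_⟩
      rw [hf, sub_eq_zero.1 hi]
      push_cast
      linear_combination hj - hj'
  have hNat : D1 (fun n : R => ∃ m : ℕ, n = m) := by
    intro ι f hf
    have : DS (fun ρ => ∃ a b c d : R, (∃ z : ℤ, a = z) ∧ (∃ z : ℤ, b = z) ∧ (∃ z : ℤ, c = z) ∧
        (∃ z : ℤ, d = z) ∧ f ρ = a ^ 2 + b ^ 2 + c ^ 2 + d ^ 2) := by
      refine DS.ex (DS.ex (DS.ex (DS.ex ?_)))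
      refine (hZ (PolyFun.proj _)).and ((hZ (PolyFun.proj _)).and ((hZ (PolyFun.proj _)).and
        ((hZ (PolyFun.proj _)).and (DS.eq hf.lift.lift.lift.lift
          (((((PolyFun.proj _).pow 2).add ((PolyFun.proj _).pow 2)).add
            ((PolyFun.proj _).pow 2)).add ((PolyFun.proj _).pow 2))))))
    refine this.congr fun ρ => ?_
    constructor
    · rintro ⟨m, hm⟩
      obtain ⟨a, b, c, d, h4⟩ := Nat.sum_four_squares m
      refine ⟨a, b, c, d, ⟨a, by simp⟩, ⟨b, by simp⟩, ⟨c, by simp⟩, ⟨d, by simp⟩, ?_⟩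
      rw [hm, ← h4]
      push_cast
      rfl
    · rintro ⟨_, _, _, _, ⟨a, rfl⟩, ⟨b, rfl⟩, ⟨c, rfl⟩, ⟨d, rfl⟩, hf⟩
      obtain ⟨m, hm⟩ := Int.eq_ofNat_of_zero_le (a := a ^ 2 + b ^ 2 + c ^ 2 + d ^ 2) (by positivity)
      refine ⟨m, ?_⟩
      rw [hf]
      have := congrArg (Int.cast : ℤ → R) hm
      push_cast at this
      exact this
  refine ⟨hZ, hNat, 2 * M * N, by positivity, ?_⟩
  intro ι f r s hf hr hs
  have : DS (fun ρ => (∃ m : ℕ, f ρ = m) ∧ ∃ r' s' : R, ExpRel R M (f ρ) ⟨r', s'⟩ ∧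
      (⟨r ρ, s ρ⟩ : QR R) = ⟨r', s'⟩ ^ N) := by
    refine (hNat hf).and (DS.ex (DS.ex ?_))
    exact (ds_expRel M hf.lift.lift (PolyFun.proj _) (PolyFun.proj _)).and
      ((PolyQ.mk hr.lift.lift hs.lift.lift).eq ((PolyQ.mk (PolyFun.proj _) (PolyFun.proj _)).pow N))
  refine this.congr fun ρ => ?_
  constructor
  · rintro ⟨m, hm, hrs⟩
    refine ⟨⟨m, hm⟩, _, _, hm ▸ expRel_natCast hM m, ?_⟩
    rw [hrs]
    change _ = (QR.w R ^ (2 * M * m)) ^ N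
    rw [← pow_mul]
    congr 1
    ring
  · rintro ⟨⟨m, hm⟩, r', s', hE, hrs⟩
    obtain ⟨j, hj, hpow⟩ := hpin' _ _ hE
    have hjm : j = (N * m : ℕ) := by
      rw [hm] at hj
      exact_mod_cast hj.symm
    refine ⟨m, hm, ?_⟩
    rw [hrs, hpow _ hjm, mul_assoc (2 * M)]

end

end DiophSys

theorem Polynomial.Chebyshev.monic_and_natDegree_C (A : Type*) [CommRing A] [Nontrivial A] (n : ℕ) :
    (Chebyshev.C A ((n : ℤ) + 1)).Monic ∧ (Chebyshev.C A ((n : ℤ) + 1)).natDegree = n + 1 := by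
  induction n using Nat.twoStepInduction with
  | zero => simp [monic_X]
  | one =>
    have h : Chebyshev.C A (((1 : ℕ) : ℤ) + 1) = X ^ 2 - Polynomial.C 2 := by
      have := Chebyshev.C_two A
      norm_num at this ⊢
      rw [this, map_ofNat]
    rw [h]
    exact ⟨monic_X_pow_sub_C 2 two_ne_zero, natDegree_X_pow_sub_C⟩
  | more n h₁ h₂ =>
    have h := Chebyshev.C_add_two A ((n : ℤ) + 1)
    have e₁ : (n : ℤ) + 1 + 2 = ((n + 2 : ℕ) : ℤ) + 1 := by push_cast; ring
    have e₂ : (n : ℤ) + 1 + 1 = ((n + 1 : ℕ) : ℤ) + 1 := by push_cast; ring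
    rw [e₁, e₂] at h
    rw [h]
    have hm : (X * Chebyshev.C A (((n + 1 : ℕ) : ℤ) + 1)).Monic := monic_X.mul h₂.1
    have hd : (X * Chebyshev.C A (((n + 1 : ℕ) : ℤ) + 1)).natDegree = n + 2 + 1 := by
      rw [natDegree_X_mul h₂.1.ne_zero, h₂.2]
    have hlt : (Chebyshev.C A ((n : ℤ) + 1)).natDegree <
        (X * Chebyshev.C A (((n + 1 : ℕ) : ℤ) + 1)).natDegree := by rw [h₁.2, hd]; omega
    exact ⟨hm.sub_of_left (degree_lt_degree hlt), by
      rw [natDegree_sub_eq_left_of_natDegree_lt hlt, hd]⟩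

theorem Polynomial.Chebyshev.natDegree_C (A : Type*) [CommRing A] [Nontrivial A] (n : ℕ) :
    (Chebyshev.C A (n : ℤ)).natDegree = n := by
  cases n with
  | zero =>
    have : Chebyshev.C A ((0 : ℕ) : ℤ) = Polynomial.C 2 := by simp [map_ofNat]
    rw [this, Polynomial.natDegree_C]
  | succ n => exact_mod_cast (monic_and_natDegree_C A n).2

theorem Polynomial.Chebyshev.monic_C (A : Type*) [CommRing A] [Nontrivial A] {n : ℕ} (hn : n ≠ 0) :
    (Chebyshev.C A (n : ℤ)).Monic := by
  obtain ⟨n, rfl⟩ := Nat.exists_eq_succ_of_ne_zero hn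
  exact_mod_cast (monic_and_natDegree_C A n).1

theorem Polynomial.Chebyshev.C_ne_zero (A : Type*) [CommRing A] [Nontrivial A] [CharZero A]
    (n : ℕ) : Chebyshev.C A (n : ℤ) ≠ 0 := by
  by_cases hn : n = 0
  · subst hn
    simp
  · exact (monic_C A hn).ne_zero

theorem Padic.eq_zero_of_sum_sq {l : ℕ} [Fact l.Prime] {b : ℤ} (hb : ¬ IsSquare (b : ZMod l))
    {y : Fin 3 → ℚ_[l]} (h : b * y 0 ^ 2 - y 1 ^ 2 + l * y 2 ^ 2 = 0) : y = 0 := by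
  by_contra hy
  obtain ⟨j, -, hj⟩ := Finset.exists_max_image Finset.univ (fun i => ‖y i‖) ⟨0, by simp⟩
  have hyj : y j ≠ 0 := by
    intro h0
    refine hy (funext fun i => norm_le_zero_iff.1 ?_)
    simpa [h0] using hj i (Finset.mem_univ _)
  have hle (i) : ‖y i / y j‖ ≤ 1 := by
    rw [norm_div]
    exact div_le_one_of_le₀ (hj i (Finset.mem_univ _)) (norm_nonneg _)
  let u : Fin 3 → ℤ_[l] := fun i => ⟨y i / y j, hle i⟩
  have huj : u j = 1 := Subtype.ext (div_self hyj)
  have hu : (b : ℤ_[l]) * u 0 ^ 2 - u 1 ^ 2 + l * u 2 ^ 2 = 0 := by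
    apply Subtype.ext
    push_cast
    change (b : ℚ_[l]) * (y 0 / y j) ^ 2 - (y 1 / y j) ^ 2 + l * (y 2 / y j) ^ 2 = 0
    field_simp
    rw [h, mul_zero]
  have hdvd (x : ℤ_[l]) : (l : ℤ_[l]) ∣ x ↔ PadicInt.toZMod x = 0 := by
    rw [← PadicInt.norm_lt_one_iff_dvd, ← RingHom.mem_ker, PadicInt.ker_toZMod,
      PadicInt.maximalIdeal_eq_span_p, Ideal.mem_span_singleton, ← PadicInt.norm_lt_one_iff_dvd]
  have hmod := congrArg PadicInt.toZMod hu
  simp only [map_add, map_sub, map_mul, map_pow, map_intCast, map_natCast, map_zero,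
    CharP.cast_eq_zero, zero_mul, add_zero] at hmod
  have h0 : PadicInt.toZMod (u 0) = 0 := by
    by_contra h0
    refine hb ⟨PadicInt.toZMod (u 1) / PadicInt.toZMod (u 0), ?_⟩
    field_simp
    linear_combination hmod
  have h1 : PadicInt.toZMod (u 1) = 0 := by
    rw [h0] at hmod
    simpa using hmod
  obtain ⟨s, hs⟩ := (hdvd _).2 h0
  obtain ⟨t, ht⟩ := (hdvd _).2 h1
  have hl : (l : ℤ_[l]) ≠ 0 := by exact_mod_cast (Fact.out : l.Prime).ne_zero
  have h2 : PadicInt.toZMod (u 2) = 0 := by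
    have : u 2 ^ 2 = l * (t ^ 2 - b * s ^ 2) := by
      apply mul_left_cancel₀ hl
      rw [hs, ht] at hu
      linear_combination hu
    rw [← pow_eq_zero_iff two_ne_zero, ← map_pow, this]
    simp
  have : PadicInt.toZMod (u j) = 0 := by
    fin_cases j
    exacts [h0, h1, h2]
  rw [huj, map_one] at this
  exact one_ne_zero this

namespace FFPrime

variable {k K : Type*} [Field k] [Field K] [Algebra k K] {v : FFPrime k K}

theorem even_ord_sum_sq {ι F : Type*} [Fintype ι] [Field F] {φ : v.valuationSubring →+* F}
    (hφ : ∀ x : v.valuationSubring, 0 < v.ord (x : K) → φ x = 0) {c : ι → v.valuationSubring}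
    (hc : ∀ y : ι → F, ∑ i, φ (c i) * y i ^ 2 = 0 → y = 0) {x : ι → K} (hx : x ≠ 0) :
    ∑ i, (c i : K) * x i ^ 2 ≠ 0 ∧ Even (v.ord (∑ i, (c i : K) * x i ^ 2)) := by
  classical
  obtain ⟨i₀, hi₀⟩ := Function.ne_iff.1 hx
  obtain ⟨j, hj, hmin⟩ := Finset.exists_min_image (Finset.univ.filter fun i => x i ≠ 0)
    (fun i => v.ord (x i)) ⟨i₀, by simpa using hi₀⟩
  have hxj : x j ≠ 0 := by simpa using hj
  have hmem (i) : x i / x j ∈ v.valuationSubring := by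
    rw [mem_valuationSubring]
    by_cases h : x i = 0
    · rw [h, zero_div, v.ord_zero']
    · rw [div_eq_mul_inv, v.ord_mul h (inv_ne_zero hxj), ord_inv v hxj]
      have := hmin i (by simpa using h)
      omega
  let y : ι → v.valuationSubring := fun i => ⟨x i / x j, hmem i⟩
  have hyj : y j = 1 := Subtype.ext (div_self hxj)
  set s : v.valuationSubring := ∑ i, c i * y i ^ 2 with hs
  have hφs : φ s ≠ 0 := by
    intro h0
    have := hc (fun i => φ (y i)) (by simpa [hs] using h0)
    have := congrFun this j
    simp [hyj] at this
  have hs0 : (s : K) ≠ 0 := by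
    intro h0
    have : s = 0 := Subtype.ext h0
    exact hφs (by rw [this, map_zero])
  have hords : v.ord (s : K) = 0 :=
    le_antisymm (not_lt.1 fun h => hφs (hφ s h)) ((mem_valuationSubring v).1 s.2)
  have hsum : ∑ i, (c i : K) * x i ^ 2 = x j ^ 2 * s := by
    rw [hs]
    push_cast
    rw [Finset.mul_sum]
    refine Finset.sum_congr rfl fun i _ => ?_
    change _ = x j ^ 2 * (c i * (x i / x j) ^ 2)
    field_simp
  rw [hsum]
  refine ⟨by positivity, ?_⟩
  rw [v.ord_mul (by positivity) hs0, hords, ord_pow v hxj]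
  simp

theorem ord_le_of_form_eq [CharZero k] {l : ℕ} [Fact l.Prime] {b : ℤ}
    (hb : ¬ IsSquare (b : ZMod l)) {φ : v.valuationSubring →+* ℚ_[l]}
    (hφ : ∀ x : v.valuationSubring, 0 < v.ord (x : K) → φ x = 0) {a c z y x₁ x₂ x₃ x₄ : K}
    (ha : Odd (v.ord a)) (hc : c ≠ 0) (hz : z ≠ 0) (hy : y ≠ 0)
    (h : b * y ^ 2 = x₁ ^ 2 - a * x₂ ^ 2 - (c + l * z ^ 2) * (x₃ ^ 2 - a * x₄ ^ 2)) :
    v.ord c ≤ 2 * v.ord z := by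
  by_contra! hlt
  have hchar : CharZero K := charZero_of_injective_algebraMap (algebraMap k K).injective
  have hl : (l : K) ≠ 0 := by exact_mod_cast (Fact.out : l.Prime).ne_zero
  have hordl : v.ord (l : K) = 0 := by
    have : (l : k) ≠ 0 := by exact_mod_cast (Fact.out : l.Prime).ne_zero
    simpa using v.ord_algebraMap this
  set e : K := c / z ^ 2 with he
  have he0 : 0 < v.ord e := by
    rw [he, div_eq_mul_inv, v.ord_mul hc (by positivity), ord_inv v (by positivity), ord_pow v hz]
    push_cast
    omega
  let e' : v.valuationSubring := ⟨e, (mem_valuationSubring v).2 he0.le⟩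
  let w : Fin 3 → v.valuationSubring := ![b, -1, e' + l]
  have haniso : ∀ y : Fin 3 → ℚ_[l], ∑ i, φ (w i) * y i ^ 2 = 0 → y = 0 := by
    intro y hy
    refine Padic.eq_zero_of_sum_sq hb ?_
    rw [Fin.sum_univ_three] at hy
    simp only [w, Matrix.cons_val_zero, Matrix.cons_val_one, Matrix.cons_val, map_add, map_neg,
      map_one, map_intCast, map_natCast, hφ e' he0] at hy
    linear_combination hy
  have hsum (x : Fin 3 → K) : ∑ i, (w i : K) * x i ^ 2 =
      b * x 0 ^ 2 - x 1 ^ 2 + (e + l) * x 2 ^ 2 := by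
    rw [Fin.sum_univ_three]
    simp only [w, Matrix.cons_val_zero, Matrix.cons_val_one, Matrix.cons_val]
    push_cast
    ring
  have ha0 : a ≠ 0 := by
    rintro rfl
    simp [v.ord_zero'] at ha
  obtain ⟨h1, h2⟩ := even_ord_sum_sq hφ haniso (x := ![y, x₁, z * x₃])
    (fun h0 => hy (congrFun h0 0))
  have key : ∑ i, (w i : K) * (![y, x₁, z * x₃] : Fin 3 → K) i ^ 2 =
      a * ∑ i, (w i : K) * (![0, x₂, z * x₄] : Fin 3 → K) i ^ 2 := by
    rw [hsum, hsum]
    simp only [Matrix.cons_val_zero, Matrix.cons_val_one, Matrix.cons_val]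
    have : c = e * z ^ 2 := by rw [he]; field_simp
    rw [this] at h
    linear_combination h
  rw [key] at h1 h2
  have hx : (![0, x₂, z * x₄] : Fin 3 → K) ≠ 0 := by
    intro h0
    rw [h0] at h1
    simp at h1
  obtain ⟨h3, h4⟩ := even_ord_sum_sq hφ haniso hx
  rw [v.ord_mul ha0 h3, Int.even_add'] at h2
  exact Int.not_even_iff_odd.2 (h2.1 ha) h4

end FFPrime

/-- The value of the rescaled Chebyshev polynomial `C m` at the distinguished generator. -/
noncomputable def cheb (R : Type*) [CommRing R] [Algebra ℚ[X] R] (m : ℕ) : R :=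
  algebraMap ℚ[X] R (Chebyshev.C ℚ m)

theorem dvd_algebraMap_norm {R : Type*} [CommRing R] [IsDomain R] [Algebra ℚ[X] R]
    [Module.Finite ℚ[X] R] [Module.Free ℚ[X] R] (y : R) :
    y ∣ algebraMap ℚ[X] R (Algebra.norm ℚ[X] y) := by
  have h := aeval_mulCharpoly (-y)
  have h0 : (mulCharpoly (-y)).coeff 0 = Algebra.norm ℚ[X] y := by
    rw [coeff_zero_eq_eval_zero, eval_mulCharpoly, map_zero, sub_neg_eq_add, zero_add]
  rw [← divX_mul_X_add (mulCharpoly (-y)), h0] at h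
  simp only [map_add, map_mul, aeval_X, aeval_C] at h
  exact ⟨aeval (-y) (mulCharpoly (-y)).divX, by linear_combination h⟩

/-- `z` is divisible enough for `b y² = N(x₁, x₂) - (c + l z²) N(x₃, x₄)` to be solvable with
`y ≠ 0` and `b ≡ b₀` modulo `l`, where `N` is the norm form of `√a`. -/
def FormRel {R : Type*} [CommRing R] [Algebra ℚ[X] R] (l b₀ : ℤ) (z c : R) : Prop :=
  ∃ e : ℤ, ∃ y x₁ x₂ x₃ x₄ : R, y ≠ 0 ∧
    (b₀ + l * e) * y ^ 2 = x₁ ^ 2 - genR R * x₂ ^ 2 - (c + l * z ^ 2) * (x₃ ^ 2 - genR R * x₄ ^ 2)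

section

variable {R K : Type*} [CommRing R] [IsDomain R] [Algebra ℚ[X] R] [Module.Finite ℚ[X] R]
  [Module.Free ℚ[X] R] [Field K] [CharZero K] [Algebra R K] [Algebra ℚ[X] K]
  [IsScalarTower ℚ[X] R K] [IsFractionRing R K]

theorem norm_ne_zero_of_ne_zero {y : R} (hy : y ≠ 0) : Algebra.norm ℚ[X] y ≠ 0 :=
  Algebra.norm_ne_zero_iff.2 hy

theorem not_isUnit_genR_sub (q : ℚ) : ¬ IsUnit (genR R - algebraMap ℚ[X] R (C q)) := by
  intro h
  rw [genR, ← map_sub] at h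
  have h1 := h.map (Algebra.norm ℚ[X])
  rw [Algebra.norm_algebraMap, isUnit_pow_iff Module.finrank_pos.ne'] at h1
  exact not_isUnit_X_sub_C q h1

theorem algebraMap_genR : algebraMap R K (genR R) = genK K := by
  rw [genR, ← IsScalarTower.algebraMap_apply, algebraMap_X_eq_genK]

theorem FormRel.ord_le (h : OddPoles R K) {l : ℕ} [Fact l.Prime] {b₀ : ℤ}
    (hb : ¬ IsSquare (b₀ : ZMod l))
    (hl : ∀ v : FFPrime ℚ K, v.ord (genK K) < 0 → ∃ φ : v.valuationSubring →+* ℚ_[l],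
      ∀ x : v.valuationSubring, 0 < v.ord (x : K) → φ x = 0)
    {z : R} {m : ℕ} (hz : FormRel l b₀ z (cheb R m)) {v : FFPrime ℚ K}
    (hv : v.ord (genK K) < 0) {N : ℤ} (hN : 2 * N ≤ m * v.ord (genK K)) :
    v.Le N (algebraMap R K z) := by
  by_cases hz0 : z = 0
  · exact Or.inl (by rw [hz0, map_zero])
  obtain ⟨e, y, x₁, x₂, x₃, x₄, hy, hE⟩ := hz
  obtain ⟨φ, hφ⟩ := hl v hv
  have hinj := IsFractionRing.injective R K
  have hz1 : algebraMap R K z ≠ 0 := (map_ne_zero_iff _ hinj).2 hz0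
  obtain ⟨hc0, hc⟩ := v.ord_aeval hv (Chebyshev.C_ne_zero ℚ m)
  rw [← OddPoles.algebraMap_eq_aeval, IsScalarTower.algebraMap_apply ℚ[X] R K] at hc hc0
  rw [Chebyshev.natDegree_C] at hc
  have hE' := congrArg (algebraMap R K) hE
  simp only [map_mul, map_add, map_sub, map_pow, map_intCast, map_natCast, algebraMap_genR,
    Int.cast_natCast] at hE'
  have := v.ord_le_of_form_eq (b := b₀ + l * e) (by push_cast; simpa using hb) hφ
    (h.odd v hv) hc0 hz1
    ((map_ne_zero_iff _ hinj).2 hy) (by push_cast; exact hE')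
  right
  rw [hc] at this
  omega

end

namespace DiophSys

variable {R K : Type*} [CommRing R] [IsDomain R] [Algebra ℚ[X] R] [Module.Finite ℚ[X] R]
  [Module.Free ℚ[X] R] [Field K] [CharZero K] [Algebra R K] [Algebra ℚ[X] K]
  [IsScalarTower ℚ[X] R K] [IsFractionRing R K]

theorem d1_ne_zero (hZ : D1 (fun n : R => ∃ z : ℤ, n = z)) : D1 (fun y : R => y ≠ 0) := by
  intro ι f hf
  have : DS (fun ρ => ∃ β t r : R, (∃ z : ℤ, β = z) ∧ f ρ * t + (genR R - β) * r = 1) := by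
    refine DS.ex (DS.ex (DS.ex ?_))
    exact (hZ (PolyFun.proj _)).and (DS.eq ((hf.lift.lift.lift.mul (PolyFun.proj _)).add
      (((PolyFun.const _).sub (PolyFun.proj _)).mul (PolyFun.proj _))) (PolyFun.const 1))
  refine this.congr fun ρ => ?_
  constructor
  · intro hy
    obtain ⟨s, hs⟩ := dvd_algebraMap_norm (f ρ)
    set p := Algebra.norm ℚ[X] (f ρ)
    have hp : p ≠ 0 := norm_ne_zero_of_ne_zero hy
    obtain ⟨β, hβ⟩ : ∃ β : ℤ, p.eval (β : ℚ) ≠ 0 := by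
      by_contra! hβ
      refine hp (eq_zero_of_infinite_isRoot p ((Set.infinite_range_of_injective
        (Int.cast_injective (α := ℚ))).mono ?_))
      rintro _ ⟨β, rfl⟩
      exact hβ β
    obtain ⟨q, hq⟩ := X_sub_C_dvd_sub_C_eval (a := (β : ℚ)) (p := p)
    refine ⟨β, s * algebraMap ℚ[X] R (C (p.eval (β : ℚ))⁻¹),
      -algebraMap ℚ[X] R (q * C (p.eval (β : ℚ))⁻¹), ⟨β, rfl⟩, ?_⟩
    have h1 : p * C (p.eval (β : ℚ))⁻¹ - (X - C (β : ℚ)) * (q * C (p.eval (β : ℚ))⁻¹) = 1 := by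
      have h2 : C (p.eval (β : ℚ)) * C (p.eval (β : ℚ))⁻¹ = (1 : ℚ[X]) := by
        rw [← C_mul, mul_inv_cancel₀ hβ, C_1]
      linear_combination (C (p.eval (β : ℚ))⁻¹) * hq + h2
    have h3 := congrArg (algebraMap ℚ[X] R) h1
    simp only [map_mul, map_sub, map_one, hs] at h3
    rw [map_mul, genR]
    simp only [map_intCast] at h3 ⊢
    linear_combination h3
  · rintro ⟨β, t, r, ⟨z, rfl⟩, hr⟩ h0
    rw [h0, zero_mul, zero_add] at hr
    have := not_isUnit_genR_sub (R := R) z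
    rw [map_intCast, map_intCast] at this
    exact this (IsUnit.of_mul_eq_one _ hr)

theorem d2_formRel (hZ : D1 (fun n : R => ∃ z : ℤ, n = z)) (l b₀ : ℤ) :
    D2 (FormRel (R := R) l b₀) := by
  intro ι z c hz hc
  have : DS (fun ρ => ∃ e y x₁ x₂ x₃ x₄ : R, (∃ z : ℤ, e = z) ∧ y ≠ 0 ∧
    (b₀ + l * e) * y ^ 2 = x₁ ^ 2 - genR R * x₂ ^ 2 -
      (c ρ + l * z ρ ^ 2) * (x₃ ^ 2 - genR R * x₄ ^ 2)) := by
    refine DS.ex (DS.ex (DS.ex (DS.ex (DS.ex (DS.ex ?_)))))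
    refine (hZ (PolyFun.proj _)).and ((d1_ne_zero hZ (PolyFun.proj _)).and (DS.eq ?_ ?_))
    · exact ((PolyFun.const _).add ((PolyFun.const _).mul (PolyFun.proj _))).mul
        ((PolyFun.proj _).pow 2)
    · exact (((PolyFun.proj _).pow 2).sub ((PolyFun.const _).mul ((PolyFun.proj _).pow 2))).sub
        ((hc.lift.lift.lift.lift.lift.lift.add ((PolyFun.const _).mul
          (hz.lift.lift.lift.lift.lift.lift.pow 2))).mul
        (((PolyFun.proj _).pow 2).sub ((PolyFun.const _).mul ((PolyFun.proj _).pow 2))))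
  refine this.congr fun ρ => ?_
  constructor
  · rintro ⟨e, h⟩
    obtain ⟨y, x₁, x₂, x₃, x₄, h1, h2⟩ := h
    exact ⟨e, y, x₁, x₂, x₃, x₄, ⟨e, rfl⟩, h1, h2⟩
  · rintro ⟨_, y, x₁, x₂, x₃, x₄, ⟨e, rfl⟩, h1, h2⟩
    exact ⟨e, y, x₁, x₂, x₃, x₄, h1, h2⟩

/-- `n` is a natural number and `x` is the value of the Chebyshev polynomial `C (κ n)`. -/
def ChebRel {R : Type*} [CommRing R] [Algebra ℚ[X] R] (κ : ℕ) (n x : R) : Prop :=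
  ∃ m : ℕ, n = m ∧ x = cheb R (κ * m)

theorem d2_chebRel {κ : ℕ} (hE : D3 (Exp R κ)) : D2 (ChebRel (R := R) κ) := by
  intro ι n x hn hx
  have : DS (fun ρ => ∃ r s, Exp R κ (n ρ) r s ∧ x ρ = 2 * r + s * genR R) := by
    refine DS.ex (DS.ex ?_)
    exact (hE hn.lift.lift (PolyFun.proj _) (PolyFun.proj _)).and (DS.eq hx.lift.lift
      (((PolyFun.const _).mul (PolyFun.proj _)).add ((PolyFun.proj _).mul (PolyFun.const _))))
  refine this.congr fun ρ => ?_
  constructor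
  · rintro ⟨m, hm, hx⟩
    exact ⟨(QR.w R ^ (κ * m)).re, (QR.w R ^ (κ * m)).im, ⟨m, hm, rfl⟩,
      by rw [QR.two_mul_re_add, hx, cheb]⟩
  · rintro ⟨r, s, ⟨m, hm, hrs⟩, hx⟩
    refine ⟨m, hm, ?_⟩
    rw [hx, cheb, ← QR.two_mul_re_add, ← hrs]

end DiophSys

namespace Polynomial

/-- If `h` divides `N(x) - b`, where `N` is the norm form of `√X`, then up to squares and a
constant `h` is represented by the norm form of the quaternion algebra `(X, b)`. -/
theorem exists_mul_sq_eq_quaternion_norm {b : ℚ} (hb : ¬ IsSquare b) {h x₁ x₂ : ℚ[X]} (h0 : h ≠ 0)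
    (hd : h ∣ x₁ ^ 2 - X * x₂ ^ 2 - C b) : ∃ (c : ℚ) (w u₁ u₂ u₃ u₄ : ℚ[X]), c ≠ 0 ∧ w ≠ 0 ∧
      h * w ^ 2 = C c * (u₁ ^ 2 - X * u₂ ^ 2 - C b * (u₃ ^ 2 - X * u₄ ^ 2)) := by
  induction hn : h.natDegree using Nat.strong_induction_on generalizing h x₁ x₂ with
  | _ n ih =>
    rcases Nat.eq_zero_or_pos n with rfl | hn0
    · obtain ⟨c, rfl⟩ := natDegree_eq_zero.1 hn
      exact ⟨c, 1, 1, 0, 0, 0, by simpa using h0, one_ne_zero, by ring⟩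
    have hmod (x : ℚ[X]) : (x % h).natDegree ≤ n - 1 := by
      have := natDegree_mod_lt x (by omega : h.natDegree ≠ 0)
      omega
    obtain ⟨h', hh'⟩ : h ∣ (x₁ % h) ^ 2 - X * (x₂ % h) ^ 2 - C b := by
      have e₁ := EuclideanDomain.div_add_mod x₁ h
      have e₂ := EuclideanDomain.div_add_mod x₂ h
      set r₁ := x₁ % h
      set r₂ := x₂ % h
      rw [← e₁, ← e₂] at hd
      refine (dvd_add_right (a := h) (b := (h * (x₁ / h) + r₁) ^ 2 - r₁ ^ 2 -
        X * ((h * (x₂ / h) + r₂) ^ 2 - r₂ ^ 2)) ?_).1 ?_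
      · exact ⟨(x₁ / h) * (h * (x₁ / h) + 2 * r₁) - X * ((x₂ / h) * (h * (x₂ / h) + 2 * r₂)),
          by ring⟩
      · convert hd using 1
        ring
    have hdeg : ((x₁ % h) ^ 2 - X * (x₂ % h) ^ 2 - C b).natDegree ≤ 2 * n - 1 := by
      have h1 : ((x₁ % h) ^ 2).natDegree ≤ 2 * (n - 1) :=
        natDegree_pow_le.trans (Nat.mul_le_mul_left _ (hmod x₁))
      have h2 : ((x₂ % h) ^ 2).natDegree ≤ 2 * (n - 1) :=
        natDegree_pow_le.trans (Nat.mul_le_mul_left _ (hmod x₂))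
      have h3 : (X * (x₂ % h) ^ 2).natDegree ≤ 1 + 2 * (n - 1) :=
        natDegree_mul_le.trans (add_le_add natDegree_X_le h2)
      refine (natDegree_sub_le _ _).trans (max_le ((natDegree_sub_le _ _).trans (max_le ?_ ?_)) ?_)
      · omega
      · omega
      · simp
    have hh0 : h' ≠ 0 := by
      rintro rfl
      have := congrArg (eval 0) hh'
      simp only [eval_sub, eval_pow, eval_mul, eval_X, eval_C, zero_mul, mul_zero, eval_zero,
        sub_zero] at this
      exact hb ⟨eval 0 (x₁ % h), by linear_combination -this⟩
    rw [hh', natDegree_mul h0 hh0, hn] at hdeg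
    obtain ⟨c, w, u₁, u₂, u₃, u₄, hc, hw, hu⟩ :=
      ih h'.natDegree (by omega) hh0 (Dvd.intro_left h hh'.symm) rfl
    set p := x₁ % h
    set q := x₂ % h
    refine ⟨c, h' * w, p * u₁ + X * q * u₂ + C b * u₃, p * u₂ + q * u₁ + C b * u₄,
      p * u₃ - X * q * u₄ + u₁, p * u₄ - q * u₃ + u₂, hc, mul_ne_zero hh0 hw, ?_⟩
    linear_combination (-h' * w ^ 2) * hh' + (p ^ 2 - X * q ^ 2 - C b) * hu

theorem natDegree_leadingCoeff_sq_sub {b : ℚ} (hb : ¬ IsSquare b) {p q : ℚ[X]}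
    (h : p ≠ 0 ∨ q ≠ 0) : ∃ (m : ℕ) (α β : ℚ), (p ^ 2 - C b * q ^ 2).natDegree = 2 * m ∧
      (p ^ 2 - C b * q ^ 2).leadingCoeff = α ^ 2 - b * β ^ 2 ∧ p ^ 2 - C b * q ^ 2 ≠ 0 := by
  set m := max p.natDegree q.natDegree with hm
  have hcoeff : (p ^ 2 - C b * q ^ 2).coeff (2 * m) = p.coeff m ^ 2 - b * q.coeff m ^ 2 := by
    rw [coeff_sub, coeff_C_mul, pow_two, pow_two, two_mul,
      coeff_mul_add_eq_of_natDegree_le (le_max_left _ _) (le_max_left _ _),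
      coeff_mul_add_eq_of_natDegree_le (le_max_right _ _) (le_max_right _ _)]
    ring
  have hne : p.coeff m ^ 2 - b * q.coeff m ^ 2 ≠ 0 := by
    intro h0
    have hq : q.coeff m = 0 := by
      by_contra hq
      exact hb ⟨p.coeff m / q.coeff m, by field_simp; linear_combination -h0⟩
    have hp : p.coeff m = 0 := by simpa [hq] using h0
    rcases max_choice p.natDegree q.natDegree with h1 | h1
    · rw [hm, h1, coeff_natDegree, leadingCoeff_eq_zero] at hp
      have : q.natDegree = 0 := by
        have := le_max_right p.natDegree q.natDegree
        rw [h1, hp, natDegree_zero] at this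
        omega
      obtain ⟨d, rfl⟩ := natDegree_eq_zero.1 this
      simp_all
    · rw [hm, h1, coeff_natDegree, leadingCoeff_eq_zero] at hq
      have : p.natDegree = 0 := by
        have := le_max_left p.natDegree q.natDegree
        rw [h1, hq, natDegree_zero] at this
        omega
      obtain ⟨d, rfl⟩ := natDegree_eq_zero.1 this
      simp_all
  have hdeg : (p ^ 2 - C b * q ^ 2).natDegree = 2 * m := by
    refine natDegree_eq_of_le_of_coeff_ne_zero ?_ (by rwa [hcoeff])
    refine (natDegree_sub_le _ _).trans (max_le ?_ ((natDegree_C_mul_le _ _).trans ?_))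
    · exact natDegree_pow_le.trans (Nat.mul_le_mul_left _ (le_max_left _ _))
    · exact natDegree_pow_le.trans (Nat.mul_le_mul_left _ (le_max_right _ _))
  refine ⟨m, p.coeff m, q.coeff m, hdeg, by rw [leadingCoeff, hdeg, hcoeff], ?_⟩
  intro h0
  rw [h0, coeff_zero] at hcoeff
  exact hne hcoeff.symm

/-- The leading coefficient of a value of even degree of the norm form of `(X, b)`. -/
theorem leadingCoeff_quaternion_norm {b : ℚ} (hb : ¬ IsSquare b) {u₁ u₂ u₃ u₄ : ℚ[X]}
    (h0 : u₁ ^ 2 - X * u₂ ^ 2 - C b * (u₃ ^ 2 - X * u₄ ^ 2) ≠ 0)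
    (he : Even (u₁ ^ 2 - X * u₂ ^ 2 - C b * (u₃ ^ 2 - X * u₄ ^ 2)).natDegree) :
    ∃ α β : ℚ, (u₁ ^ 2 - X * u₂ ^ 2 - C b * (u₃ ^ 2 - X * u₄ ^ 2)).leadingCoeff =
      α ^ 2 - b * β ^ 2 := by
  have hsplit : u₁ ^ 2 - X * u₂ ^ 2 - C b * (u₃ ^ 2 - X * u₄ ^ 2) =
    (u₁ ^ 2 - C b * u₃ ^ 2) - X * (u₂ ^ 2 - C b * u₄ ^ 2) := by ring
  rw [hsplit] at h0 he ⊢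
  by_cases h24 : u₂ ≠ 0 ∨ u₄ ≠ 0
  · obtain ⟨m', -, -, hm', -, hne'⟩ := natDegree_leadingCoeff_sq_sub hb h24
    have hX : (X * (u₂ ^ 2 - C b * u₄ ^ 2)).natDegree = 2 * m' + 1 := by
      rw [natDegree_X_mul hne', hm']
    by_cases h13 : u₁ ≠ 0 ∨ u₃ ≠ 0
    · obtain ⟨m, α, β, hm, hlc, hne⟩ := natDegree_leadingCoeff_sq_sub hb h13
      rcases lt_or_ge m m' with hlt | hle
      · exfalso
        rw [natDegree_sub_eq_right_of_natDegree_lt (by omega), hX] at he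
        exact Nat.not_even_iff_odd.2 (odd_two_mul_add_one m') he
      · rcases hle.eq_or_lt with rfl | hlt
        · exfalso
          rw [natDegree_sub_eq_right_of_natDegree_lt (by omega), hX] at he
          exact Nat.not_even_iff_odd.2 (odd_two_mul_add_one m') he
        · exact ⟨α, β, by rw [leadingCoeff_sub_of_degree_lt (degree_lt_degree (by omega)), hlc]⟩
    · push Not at h13
      exfalso
      rw [h13.1, h13.2] at he
      simp only [ne_eq, OfNat.ofNat_ne_zero, not_false_eq_true, zero_pow, mul_zero, sub_zero,
        zero_sub, natDegree_neg, hX] at he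
      exact Nat.not_even_iff_odd.2 (odd_two_mul_add_one m') he
  · push Not at h24
    rw [h24.1, h24.2] at h0 ⊢
    simp only [ne_eq, OfNat.ofNat_ne_zero, not_false_eq_true, zero_pow, mul_zero, sub_zero] at h0 ⊢
    obtain ⟨m, α, β, hm, hlc, hne⟩ := natDegree_leadingCoeff_sq_sub hb (p := u₁) (q := u₃) (by
      by_contra! h
      exact h0 (by simp [h.1, h.2]))
    exact ⟨α, β, hlc⟩

/-- If `Q` is monic of even degree and divides `N(x) - b`, where `N` is the norm form of `√X`, then
`b` is represented by the norm form of `(X, Q)`. -/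
theorem exists_mul_sq_eq_of_dvd {b : ℚ} (hb : ¬ IsSquare b) {Q x₁ x₂ : ℚ[X]} (hQ : Q.Monic)
    (he : Even Q.natDegree) (hd : Q ∣ x₁ ^ 2 - X * x₂ ^ 2 - C b) :
    ∃ y y₁ y₂ y₃ y₄ : ℚ[X], y ≠ 0 ∧
      C b * y ^ 2 = y₁ ^ 2 - X * y₂ ^ 2 - Q * (y₃ ^ 2 - X * y₄ ^ 2) := by
  obtain ⟨c, w, u₁, u₂, u₃, u₄, hc, hw, hu⟩ := exists_mul_sq_eq_quaternion_norm hb hQ.ne_zero hd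
  have hCc : C c ≠ 0 := by simpa using hc
  have hdeg : (u₁ ^ 2 - X * u₂ ^ 2 - C b * (u₃ ^ 2 - X * u₄ ^ 2)).natDegree =
      (Q * w ^ 2).natDegree := by rw [hu, natDegree_C_mul hc]
  obtain ⟨α, β, hαβ⟩ := leadingCoeff_quaternion_norm hb (u₁ := u₁) (u₂ := u₂) (u₃ := u₃) (u₄ := u₄)
    (by
      intro h0
      rw [h0, mul_zero] at hu
      exact mul_ne_zero hQ.ne_zero (pow_ne_zero 2 hw) hu)
    (by
      rw [hdeg, natDegree_mul hQ.ne_zero (pow_ne_zero 2 hw), natDegree_pow]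
      exact he.add (even_two_mul _))
  have hlc := congrArg leadingCoeff hu
  rw [leadingCoeff_mul, leadingCoeff_mul, hαβ, hQ.leadingCoeff, one_mul, leadingCoeff_pow,
    leadingCoeff_C] at hlc
  set d := w.leadingCoeff with hd'
  have hd0 : d ≠ 0 := leadingCoeff_ne_zero.2 hw
  obtain ⟨γ, δ, hγδ⟩ : ∃ γ δ : ℚ, c = γ ^ 2 - b * δ ^ 2 :=
    ⟨c * α / d, c * β / d, by field_simp; linear_combination hlc⟩
  set v₁ := C γ * u₁ + C b * C δ * u₃ with hv₁
  set v₂ := C γ * u₂ + C b * C δ * u₄ with hv₂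
  set v₃ := C γ * u₃ + C δ * u₁ with hv₃
  set v₄ := C γ * u₄ + C δ * u₂ with hv₄
  have hv : Q * w ^ 2 = v₁ ^ 2 - X * v₂ ^ 2 - C b * (v₃ ^ 2 - X * v₄ ^ 2) := by
    rw [hu, hγδ, hv₁, hv₂, hv₃, hv₄]
    simp only [map_sub, map_mul, map_pow]
    ring
  by_cases hn : v₃ ^ 2 - X * v₄ ^ 2 = 0
  · refine ⟨Q * w ^ 2, C ((b + 1) / 2) * (Q * w ^ 2), 0, C ((b - 1) / 2) * w * v₁,
      C ((b - 1) / 2) * w * v₂, mul_ne_zero hQ.ne_zero (pow_ne_zero 2 hw), ?_⟩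
    have h1 : C b = C ((b + 1) / 2) ^ 2 - C ((b - 1) / 2) ^ 2 := by
      rw [← C_pow, ← C_pow, ← C_sub]
      congr 1
      ring
    rw [hn, mul_zero, sub_zero] at hv
    rw [h1]
    linear_combination (-C ((b - 1) / 2) ^ 2 * (Q * w ^ 2)) * hv
  · refine ⟨v₃ ^ 2 - X * v₄ ^ 2, v₁ * v₃ + X * v₂ * v₄, v₁ * v₄ + v₂ * v₃, w * v₃, w * v₄, hn, ?_⟩
    linear_combination (v₃ ^ 2 - X * v₄ ^ 2) * hv

end Polynomial

namespace Polynomial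

theorem exists_expand_two_add {A : Type*} [CommRing A] (q : A[X]) :
    ∃ e o : A[X], q = expand A 2 e + X * expand A 2 o := by
  induction q using Polynomial.induction_on' with
  | add p q hp hq =>
    obtain ⟨e, o, rfl⟩ := hp
    obtain ⟨e', o', rfl⟩ := hq
    exact ⟨e + e', o + o', by simp only [map_add]; ring⟩
  | monomial n c =>
    rcases Nat.even_or_odd' n with ⟨m, rfl | rfl⟩
    · exact ⟨monomial m c, 0, by simp [expand_monomial, mul_comm]⟩
    · refine ⟨0, monomial m c, ?_⟩
      simp [expand_monomial, mul_comm m 2, X_mul_monomial]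

theorem expand_dvd_expand {A : Type*} [CommRing A] [IsDomain A] {n : ℕ} (hn : 0 < n) {p q : A[X]}
    (hp : p.Monic) (h : expand A n p ∣ expand A n q) : p ∣ q := by
  rw [← modByMonic_eq_zero_iff_dvd hp]
  by_contra hr
  have h1 : expand A n p ∣ expand A n (q %ₘ p) := by
    have := modByMonic_add_div q p
    rw [← eq_sub_iff_add_eq] at this
    rw [this, map_sub, map_mul]
    exact dvd_sub h (dvd_mul_right _ _)
  have h2 := natDegree_le_of_dvd h1 (by rwa [Ne, expand_eq_zero hn])
  rw [natDegree_expand, natDegree_expand] at h2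
  have h3 := degree_modByMonic_lt q hp
  have h4 := natDegree_lt_natDegree hr h3
  exact absurd (Nat.le_of_mul_le_mul_right h2 hn) (by omega)

/-- A rational number which is a norm from a splitting field of the separable polynomial `Q(X²)`
is represented by the norm form of `√X` modulo `Q`. -/
theorem exists_dvd_sq_sub_of_norm {M : Type*} [Field M] [Algebra ℚ M] [FiniteDimensional ℚ M]
    [IsGalois ℚ M] {Q : ℚ[X]} (hQ : Q.Monic) (hs : (expand ℚ 2 Q).Separable)
    (hsp : ((expand ℚ 2 Q).map (algebraMap ℚ M)).Splits) (x : M) :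
    ∃ x₁ x₂ : ℚ[X], Q ∣ x₁ ^ 2 - X * x₂ ^ 2 - C (Algebra.norm ℚ x) := by
  classical
  set F := expand ℚ 2 Q with hF
  have hF0 : F ≠ 0 := hs.ne_zero
  have hFM0 : F.map (algebraMap ℚ M) ≠ 0 := by rwa [Ne, Polynomial.map_eq_zero]
  have : CharZero M := algebraRat.charZero M
  have hmem : ∀ v : M, v ∈ (F.map (algebraMap ℚ M)).roots ↔ aeval v F = 0 := by
    intro v
    rw [mem_roots hFM0, IsRoot.def, eval_map_algebraMap]
  have hneg : ∀ v : M, aeval v F = 0 → aeval (-v) F = 0 := by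
    intro v hv
    rw [hF, expand_aeval] at hv ⊢
    rwa [neg_sq]
  have hzero : aeval (0 : M) F ≠ 0 := by
    intro h0
    have h1 := hs.aeval_derivative_ne_zero h0
    rw [hF, derivative_expand] at h1
    simp at h1
  set P : M → Prop := fun v => WellOrderingRel v (-v)
  have hP : ∀ v : M, v ≠ 0 → (P (-v) ↔ ¬ P v) := by
    intro v hv
    simp only [P, neg_neg]
    have hne : v ≠ -v := fun h => hv (self_eq_neg.1 h)
    constructor
    · exact fun h1 h2 => asymm_of _ h1 h2
    · intro h1
      rcases trichotomous_of WellOrderingRel v (-v) with h | h | h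
      · exact absurd h h1
      · exact absurd h hne
      · exact h
  set g : M → M := fun v => ∏ σ : Gal(M/ℚ), if P (σ⁻¹ v) then σ x else 1
  have hgσ : ∀ (τ : Gal(M/ℚ)) (v : M), g (τ v) = τ (g v) := by
    intro τ v
    simp only [g]
    rw [map_prod, ← Equiv.prod_comp (Equiv.mulLeft τ)]
    refine Finset.prod_congr rfl fun σ _ => ?_
    rw [Equiv.coe_mulLeft, mul_inv_rev, AlgEquiv.mul_apply, AlgEquiv.mul_apply]
    have : (τ⁻¹ : Gal(M/ℚ)) (τ v) = v := by
      rw [← AlgEquiv.mul_apply, inv_mul_cancel, AlgEquiv.one_apply]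
    rw [this, apply_ite τ, map_one]
  have hgg : ∀ v : M, v ≠ 0 → g v * g (-v) = algebraMap ℚ M (Algebra.norm ℚ x) := by
    intro v hv
    rw [Algebra.norm_eq_prod_automorphisms]
    simp only [g]
    rw [← Finset.prod_mul_distrib]
    refine Finset.prod_congr rfl fun σ _ => ?_
    rw [map_neg]
    have h1 := hP (σ⁻¹ v) (by rwa [Ne, EmbeddingLike.map_eq_zero_iff])
    by_cases h2 : P (σ⁻¹ v)
    · rw [if_pos h2, if_neg (by rw [h1]; exact not_not.2 h2), mul_one]
    · rw [if_neg h2, if_pos (h1.2 h2), one_mul]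
  set s := (F.map (algebraMap ℚ M)).roots.toFinset
  have hmem' : ∀ v, v ∈ s ↔ aeval v F = 0 := fun v => by rw [Multiset.mem_toFinset, hmem]
  set p := Lagrange.interpolate s id g
  have hpd : p.degree < s.card := Lagrange.degree_interpolate_lt g Function.injective_id.injOn
  have hpe : ∀ v ∈ s, p.eval v = g v := fun v hv =>
    Lagrange.eval_interpolate_at_node (v := id) g Function.injective_id.injOn hv
  have hfix : ∀ τ : Gal(M/ℚ), p.map (τ : M →+* M) = p := by
    intro τ
    refine eq_of_degrees_lt_of_eval_finset_eq s (degree_map_le.trans_lt hpd) hpd fun v hv => ?_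
    have hv' : τ⁻¹ v ∈ s := by
      rw [hmem'] at hv ⊢
      have := congrArg (τ⁻¹ : Gal(M/ℚ)) hv
      rwa [← aeval_algHom_apply, map_zero] at this
    have h1 : τ (τ⁻¹ v) = v := by
      rw [← AlgEquiv.mul_apply, mul_inv_cancel, AlgEquiv.one_apply]
    have h2 : (p.map (τ : M →+* M)).eval (τ (τ⁻¹ v)) = τ (p.eval (τ⁻¹ v)) := by
      rw [eval_map]
      exact (hom_eval₂ p (RingHom.id M) (τ : M →+* M) (τ⁻¹ v)).symm
    rw [h1] at h2
    rw [h2, hpe _ hv', hpe _ hv, ← hgσ, h1]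
  obtain ⟨q, hq⟩ : ∃ q : ℚ[X], q.map (algebraMap ℚ M) = p := by
    rw [← mem_lifts, lifts_iff_coeff_lifts]
    intro n
    have := (IsGalois.mem_bot_iff_fixed (F := ℚ) (p.coeff n)).2 fun τ => by
      conv_rhs => rw [← hfix τ]
      rw [coeff_map]
      rfl
    obtain ⟨c, hc⟩ := IntermediateField.mem_bot.1 this
    exact ⟨c, hc⟩
  obtain ⟨e, o, heo⟩ := exists_expand_two_add q
  refine ⟨e, o, expand_dvd_expand two_pos hQ ?_⟩
  rw [← hF, ← map_dvd_map' (algebraMap ℚ M)]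
  by_cases h0 : (expand ℚ 2 (e ^ 2 - X * o ^ 2 - C (Algebra.norm ℚ x))).map (algebraMap ℚ M) = 0
  · rw [h0]
    exact dvd_zero _
  refine hsp.dvd_of_roots_le_roots hFM0 ?_
  rw [Multiset.le_iff_subset (nodup_roots hs.map)]
  intro v hv
  rw [mem_roots h0, IsRoot.def]
  have hv0 : v ≠ 0 := by
    rintro rfl
    exact hzero ((hmem 0).1 hv)
  have hv1 : v ∈ s := Multiset.mem_toFinset.2 hv
  have hv2 : -v ∈ s := by
    rw [hmem'] at hv1 ⊢
    exact hneg v hv1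
  have h3 := hgg v hv0
  rw [← hpe _ hv1, ← hpe _ hv2, ← hq, heo] at h3
  simp only [eval_map_algebraMap, map_add, map_mul, expand_aeval, aeval_X, neg_sq] at h3
  simp only [eval_map_algebraMap, map_sub, map_pow, map_mul, aeval_X, expand_C, expand_X,
    expand_aeval, aeval_C]
  linear_combination h3

end Polynomial

open NumberField Pointwise in
/-- An integer is congruent modulo an unramified prime to a norm. -/
theorem exists_norm_eq_intCast {M : Type*} [Field M] [NumberField M] [IsGalois ℚ M] {l : ℕ}
    (hl : l.Prime) (P : Ideal (𝓞 M)) [P.IsMaximal] (hP : (l : 𝓞 M) ∈ P)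
    (hin : ∀ σ : Gal(M/ℚ), (∀ x : 𝓞 M, σ • x - x ∈ P) → σ = 1) (b₀ : ℤ) :
    ∃ (x : M) (b : ℤ), Algebra.norm ℚ x = b ∧ (l : ℤ) ∣ b - b₀ := by
  classical
  set p : Ideal ℤ := Ideal.span {(l : ℤ)}
  have hpm : p.IsMaximal :=
    PrincipalIdealRing.isMaximal_of_irreducible (Nat.prime_iff_prime_int.1 hl).irreducible
  have hover : P.LiesOver p := by
    constructor
    refine hpm.eq_of_le (Ideal.IsPrime.under ℤ P).ne_top ?_
    rw [Ideal.span_singleton_le_iff_mem]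
    simpa [Ideal.mem_comap] using hP
  have hP0 : P ≠ ⊥ := by
    rintro rfl
    rw [Ideal.mem_bot, Nat.cast_eq_zero] at hP
    exact hl.ne_zero hP
  have : Finite (𝓞 M ⧸ P) := Ideal.finiteQuotientOfFreeOfNeBot P hP0
  letI := Ideal.Quotient.field p
  letI := Ideal.Quotient.field P
  obtain ⟨u', hu'⟩ := FiniteField.norm_surjective (ℤ ⧸ p) (𝓞 M ⧸ P) (Ideal.Quotient.mk p b₀)
  obtain ⟨u, rfl⟩ := Ideal.Quotient.mk_surjective u'
  have hnorm := Algebra.norm_eq_prod_automorphisms (ℤ ⧸ p) (Ideal.Quotient.mk P u)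
  have hsurj := Ideal.Quotient.stabilizerHom_surjective Gal(M/ℚ) p P
  have hinj : Function.Injective (Ideal.Quotient.stabilizerHom P p Gal(M/ℚ)) := by
    rw [injective_iff_map_eq_one]
    intro σ hσ
    ext1
    refine hin _ fun x => ?_
    have := DFunLike.congr_fun hσ (Ideal.Quotient.mk P x)
    rw [Ideal.Quotient.stabilizerHom_apply] at this
    exact Ideal.Quotient.eq.1 this
  rw [hu', ← (Equiv.ofBijective _ ⟨hinj, hsurj⟩).prod_comp] at hnorm
  replace hnorm : Ideal.Quotient.mk P (b₀ : 𝓞 M) =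
    ∏ σ : MulAction.stabilizer Gal(M/ℚ) P, Ideal.Quotient.mk P (σ • u) := hnorm
  have hex : ∀ σ : Gal(M/ℚ), ∃ e : 𝓞 M, e ∉ P ∧
      (σ ∉ MulAction.stabilizer Gal(M/ℚ) P → e ∈ σ • P) := by
    intro σ
    by_cases hσ : σ ∈ MulAction.stabilizer Gal(M/ℚ) P
    · exact ⟨1, (Ideal.ne_top_iff_one P).1 Ideal.IsPrime.ne_top', fun h => absurd hσ h⟩
    · have h1 : ¬ σ • P ≤ P := by
        intro h1
        have h2 : P ≤ σ⁻¹ • P := by rwa [Ideal.subset_pointwise_smul_iff, inv_inv]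
        have h3 : σ⁻¹ • P ≠ ⊤ := (inferInstance : (σ⁻¹ • P).IsPrime).ne_top
        have h4 := ‹P.IsMaximal›.eq_of_le h3 h2
        exact hσ (by rw [← inv_mem_iff]; exact h4.symm)
      obtain ⟨e, he, he'⟩ := SetLike.not_le_iff_exists.1 h1
      exact ⟨e, he', fun _ => he⟩
  choose e he he' using hex
  have hprod : ∏ σ, e σ ∉ P := by
    rw [Ideal.IsPrime.prod_mem_iff]
    rintro ⟨σ, -, hσ⟩
    exact he σ hσ
  obtain ⟨y, i, hi, hy⟩ := ‹P.IsMaximal›.exists_inv hprod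
  set E := y * ∏ σ, e σ
  have hE1 : Ideal.Quotient.mk P E = 1 := by
    rw [← map_one (Ideal.Quotient.mk P), Ideal.Quotient.eq, ← hy]
    simpa using hi
  have hE : ∀ σ ∉ MulAction.stabilizer Gal(M/ℚ) P, E ∈ σ • P := fun σ hσ =>
    Ideal.mul_mem_left _ _
      (Ideal.mem_of_dvd _ (Finset.dvd_prod_of_mem e (Finset.mem_univ σ)) (he' σ hσ))
  set π := 1 + E * (u - 1)
  refine ⟨π, Algebra.norm ℤ π, (Algebra.coe_norm_int π).symm, ?_⟩
  have hN : ((Algebra.norm ℤ π : ℤ) : 𝓞 M) = ∏ σ : Gal(M/ℚ), σ • π := by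
    apply RingOfIntegers.ext
    have := Algebra.norm_eq_prod_automorphisms ℚ (π : M)
    rw [← Algebra.coe_norm_int] at this
    simp only [map_intCast, map_prod] at this ⊢
    exact this
  have hfac : ∀ σ : Gal(M/ℚ), Ideal.Quotient.mk P (σ • π) =
      if σ ∈ MulAction.stabilizer Gal(M/ℚ) P then Ideal.Quotient.mk P (σ • u) else 1 := by
    intro σ
    have hsm : σ • π = 1 + (σ • E) * (σ • u - 1) := by
      simp only [π, smul_add, smul_mul', smul_sub, smul_one]
    rw [hsm]
    split_ifs with hσ
    · have : Ideal.Quotient.mk P (σ • E) = 1 := by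
        rw [← map_one (Ideal.Quotient.mk P), Ideal.Quotient.eq] at hE1 ⊢
        have h2 := Ideal.smul_mem_pointwise_smul σ _ _ hE1
        rwa [MulAction.mem_stabilizer_iff.1 hσ, smul_sub, smul_one] at h2
      rw [map_add, map_mul, this]
      simp
    · have : Ideal.Quotient.mk P (σ • E) = 0 := by
        rw [Ideal.Quotient.eq_zero_iff_mem]
        have h2 := Ideal.smul_mem_pointwise_smul σ _ _ (hE σ⁻¹ (by rwa [inv_mem_iff]))
        rwa [smul_inv_smul] at h2
      rw [map_add, map_mul, this]
      simp
  have hfin : Ideal.Quotient.mk P ((Algebra.norm ℤ π : ℤ) : 𝓞 M) =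
      Ideal.Quotient.mk P (b₀ : 𝓞 M) := by
    rw [hN, map_prod, Finset.prod_congr rfl fun σ _ => hfac σ, ← Finset.prod_filter]
    rw [Finset.prod_subtype (p := (· ∈ MulAction.stabilizer Gal(M/ℚ) P)) _ (by simp)]
    exact hnorm.symm
  rw [← sub_eq_zero, ← map_sub, Ideal.Quotient.eq_zero_iff_mem] at hfin
  rw [← Ideal.mem_span_singleton]
  change _ ∈ p
  rw [hover.over, Ideal.mem_comap]
  simpa using hfin

open NumberField in
theorem Polynomial.exists_dvd_sq_sub_of_separable {l : ℕ} [hl : Fact l.Prime] {Q : ℤ[X]}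
    (hQ : Q.Monic) (hs : ((expand ℤ 2 Q).map (Int.castRingHom (ZMod l))).Separable) (b₀ : ℤ) :
    ∃ b : ℤ, (l : ℤ) ∣ b - b₀ ∧ ∃ x₁ x₂ : ℚ[X],
      Q.map (Int.castRingHom ℚ) ∣ x₁ ^ 2 - X * x₂ ^ 2 - C (b : ℚ) := by
  set F := expand ℤ 2 Q
  have hF : F.Monic := hQ.expand two_pos
  set f := F.map (Int.castRingHom ℚ)
  let M := f.SplittingField
  have : NumberField M := NumberField.mk
  have : IsGalois ℚ M := by
    have : IsSplittingField ℚ M f := IsSplittingField.splittingField f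
    have : Normal ℚ M := Normal.of_isSplittingField f
    exact ⟨⟩
  obtain ⟨P, hPm, hP⟩ := Ideal.exists_le_maximal (Ideal.span {(l : 𝓞 M)}) (by
    rw [Ne, Ideal.span_singleton_eq_top]
    intro h
    have h1 := (h.map (Algebra.norm ℤ))
    rw [← map_natCast (algebraMap ℤ (𝓞 M)), Algebra.norm_algebraMap,
      isUnit_pow_iff Module.finrank_pos.ne'] at h1
    exact (Nat.prime_iff_prime_int.1 hl.out).not_isUnit h1)
  rw [Ideal.span_singleton_le_iff_mem] at hP
  letI := Ideal.Quotient.field P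
  have hchar : CharP (𝓞 M ⧸ P) l := by
    refine ringChar.of_eq ?_
    have h1 : ringChar (𝓞 M ⧸ P) ∣ l := ringChar.dvd (by
      rw [← map_natCast (Ideal.Quotient.mk P)]
      exact Ideal.Quotient.eq_zero_iff_mem.2 hP)
    exact ((Nat.dvd_prime hl.out).1 h1).resolve_left CharP.ringChar_ne_one
  have hfs : (f.map (algebraMap ℚ M)).Splits := SplittingField.splits f
  have hFf : F.map (Int.castRingHom M) = f.map (algebraMap ℚ M) := by
    rw [Polynomial.map_map]
    congr 1
  have hint : ∀ v ∈ (f.map (algebraMap ℚ M)).roots, ∃ y : 𝓞 M, (y : M) = v := by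
    intro v hv
    have h1 := (mem_roots'.1 hv).2
    rw [← hFf, IsRoot.def, eval_map] at h1
    exact ⟨⟨v, F, hF, h1⟩, rfl⟩
  obtain ⟨m, hm⟩ : ∃ m : Multiset (𝓞 M),
      m.map (algebraMap (𝓞 M) M) = (f.map (algebraMap ℚ M)).roots := by
    choose y hy using hint
    refine ⟨(f.map (algebraMap ℚ M)).roots.attach.map fun v => y v.1 v.2, ?_⟩
    rw [Multiset.map_map]
    conv_rhs => rw [← Multiset.attach_map_val (f.map (algebraMap ℚ M)).roots]
    exact Multiset.map_congr rfl fun v _ => hy v.1 v.2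
  have hFO : F.map (Int.castRingHom (𝓞 M)) = (m.map fun y => X - C y).prod := by
    apply map_injective (algebraMap (𝓞 M) M) RingOfIntegers.coe_injective
    rw [Polynomial.map_map, RingHom.ext_int ((algebraMap (𝓞 M) M).comp _) (Int.castRingHom M), hFf,
      hfs.eq_prod_roots, ← hm, ← hFf, (hF.map _).leadingCoeff, C_1, one_mul,
      Polynomial.map_multiset_prod,
      Multiset.map_map, Multiset.map_map]
    simp
  have hFP : F.map (Int.castRingHom (𝓞 M ⧸ P)) =
      (m.map fun y => X - C (Ideal.Quotient.mk P y)).prod := by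
    rw [RingHom.ext_int (Int.castRingHom (𝓞 M ⧸ P))
      ((Ideal.Quotient.mk P).comp (Int.castRingHom (𝓞 M))), ← Polynomial.map_map,
      hFO, Polynomial.map_multiset_prod, Multiset.map_map]
    simp
  have hnd : (m.map (Ideal.Quotient.mk P)).Nodup := by
    have h1 := hs.map (f := ZMod.castHom dvd_rfl (𝓞 M ⧸ P))
    rw [Polynomial.map_map, RingHom.ext_int (RingHom.comp _ _) (Int.castRingHom (𝓞 M ⧸ P)),
      hFP] at h1
    have h2 := nodup_roots h1
    rwa [← Function.comp_def (fun y => X - C y) (Ideal.Quotient.mk P), ← Multiset.map_map,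
      roots_multiset_prod_X_sub_C] at h2
  have hinj : ∀ y ∈ m, ∀ y' ∈ m, Ideal.Quotient.mk P y = Ideal.Quotient.mk P y' → y = y' :=
    Multiset.inj_on_of_nodup_map hnd
  have hsep : f.Separable := by
    rw [← separable_map (algebraMap ℚ M), ← nodup_roots_iff_of_splits
      ((hF.map _).map _).ne_zero hfs, ← hm]
    exact (Multiset.Nodup.of_map _ hnd).map RingOfIntegers.coe_injective
  have hin : ∀ σ : Gal(M/ℚ), (∀ x : 𝓞 M, σ • x - x ∈ P) → σ = 1 := by
    intro σ hσ
    have h1 : (σ : M →ₐ[ℚ] M) = AlgHom.id ℚ M := by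
      refine AlgHom.ext_of_adjoin_eq_top (SplittingField.adjoin_rootSet f) fun v hv => ?_
      have hv' : ∀ v, v ∈ f.rootSet M → v ∈ m.map (algebraMap (𝓞 M) M) := by
        intro v hv
        rw [hm]
        classical exact Multiset.mem_toFinset.1 hv
      obtain ⟨y, hy, rfl⟩ := Multiset.mem_map.1 (hv' v hv)
      have hσv : (σ • y : 𝓞 M) ∈ m := by
        have h2 : algebraMap (𝓞 M) M (σ • y) ∈ f.rootSet M := by
          rw [mem_rootSet] at hv ⊢
          refine ⟨hv.1, ?_⟩
          have h3 := congrArg σ hv.2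
          rwa [← aeval_algHom_apply, map_zero] at h3
        obtain ⟨y', hy', h3⟩ := Multiset.mem_map.1 (hv' _ h2)
        rwa [← RingOfIntegers.coe_injective h3]
      have h4 := hinj _ hσv _ hy (Ideal.Quotient.eq.2 (hσ y))
      exact congrArg (algebraMap (𝓞 M) M) h4
    ext v
    exact DFunLike.congr_fun h1 v
  obtain ⟨x, b, hb, hbl⟩ := exists_norm_eq_intCast hl.out P hP hin b₀
  have hmap : expand ℚ 2 (Q.map (Int.castRingHom ℚ)) = f := (map_expand ..).symm
  obtain ⟨x₁, x₂, h⟩ := exists_dvd_sq_sub_of_norm (hQ.map (Int.castRingHom ℚ)) (by rwa [hmap])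
    (by rwa [hmap]) x
  exact ⟨b, hbl, x₁, x₂, by rwa [← hb]⟩

namespace Polynomial.Chebyshev

theorem derivative_C (A : Type*) [CommRing A] (n : ℕ) :
    derivative (Chebyshev.C A n) = n * S A (n - 1) := by
  induction n using Nat.twoStepInduction with
  | zero => simp
  | one => simp
  | more n h1 h2 =>
    have h3 := S_eq_X_mul_S_add_C A n
    have h4 := S_add_two A ((n : ℤ) - 1)
    push_cast at h1 h2 ⊢
    rw [C_add_two, derivative_sub, derivative_mul, h1, h2, derivative_X]
    have e1 : (n : ℤ) - 1 + 2 = n + 1 := by ring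
    have e2 : (n : ℤ) - 1 + 1 = n := by ring
    have e3 : (n : ℤ) + 2 - 1 = n + 1 := by ring
    have e4 : (n : ℤ) + 1 - 1 = n := by ring
    rw [e1, e2] at h4
    rw [e3, e4]
    linear_combination (-1 : A[X]) * h3 - (n : A[X]) * h4

theorem C_sq_sub (A : Type*) [CommRing A] (n : ℤ) :
    Chebyshev.C A n ^ 2 - (X ^ 2 - 4) * S A (n - 1) ^ 2 = 4 := by
  have h1 := C_eq_S_sub_X_mul_S A n
  have h2 := S_sq_add_S_sq A (n - 1)
  rw [sub_add_cancel] at h2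
  rw [h1]
  linear_combination 4 * h2

theorem eval_zero_C_two_mul (A : Type*) [CommRing A] (n : ℕ) :
    (Chebyshev.C A (2 * n)).eval 0 = 2 * (-1) ^ n := by
  induction n with
  | zero => simp
  | succ n ih =>
    push_cast
    rw [mul_add, mul_one, C_add_two, eval_sub, eval_mul, eval_X, ih]
    ring

theorem separable_expand_C {A : Type*} [Field A] (n : ℕ) (hn : (2 * n : A) ≠ 0) :
    (expand A 2 (Chebyshev.C A (2 * n))).Separable := by
  have h2 : (2 : A) ≠ 0 := left_ne_zero_of_mul hn
  have h4 : (4 : A) ≠ 0 := by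
    have := mul_ne_zero h2 h2
    norm_num at this ⊢
    exact this
  rw [separable_def, derivative_expand]
  refine IsCoprime.mul_right ?_ (IsCoprime.mul_right ?_ ?_)
  · refine IsCoprime.map ?_ (expand A 2).toRingHom
    have h := derivative_C A (2 * n)
    push_cast at h
    rw [h]
    have h5 : (4 : A[X]) = Polynomial.C 4 := (map_ofNat _ _).symm
    have h6 : (2 * n : A[X]) = Polynomial.C (2 * n : A) := by
      rw [map_mul, map_ofNat, map_natCast]
    refine ⟨Polynomial.C 4⁻¹ * Chebyshev.C A (2 * n),
      -Polynomial.C (4⁻¹ * (2 * n : A)⁻¹) * ((X ^ 2 - 4) * S A (2 * n - 1)), ?_⟩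
    have h7 := C_sq_sub A (2 * n)
    have h8 : Polynomial.C (4⁻¹ : A) * 4 = 1 := by
      rw [h5, ← Polynomial.C_mul, inv_mul_cancel₀ h4, Polynomial.C_1]
    have h9 : Polynomial.C ((2 * n : A)⁻¹) * (2 * n : A[X]) = 1 := by
      rw [h6, ← Polynomial.C_mul, inv_mul_cancel₀ hn, Polynomial.C_1]
    rw [Polynomial.C_mul]
    linear_combination Polynomial.C (4⁻¹ : A) * h7 + h8 -
      Polynomial.C (4⁻¹ : A) * (X ^ 2 - 4) * S A (2 * n - 1) ^ 2 * h9
  · have h5 : ((2 : ℕ) : A[X]) = Polynomial.C 2 := by rw [map_ofNat, Nat.cast_ofNat]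
    rw [h5]
    exact isCoprime_one_right.of_isCoprime_of_dvd_right (isUnit_C.2 h2.isUnit).dvd
  · rw [show 2 - 1 = 1 from rfl, pow_one]
    refine ((irreducible_X.coprime_iff_not_dvd).2 ?_).symm
    rw [X_dvd_iff, coeff_zero_eq_eval_zero, expand_eval, zero_pow two_ne_zero, eval_zero_C_two_mul]
    exact mul_ne_zero h2 (pow_ne_zero _ (by norm_num))

end Polynomial.Chebyshev

section

variable {R : Type*} [CommRing R] [IsDomain R] [Algebra ℚ[X] R] [Module.Finite ℚ[X] R]
  [Module.Free ℚ[X] R]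

theorem aeval_genR (p : ℤ[X]) :
    aeval (genR R) p = algebraMap ℚ[X] R (p.map (Int.castRingHom ℚ)) := by
  rw [← eval_genR, Polynomial.map_map, aeval_def, eval₂_eq_eval_map]
  congr 2
  exact RingHom.ext_int _ _

theorem FormRel.of_int {l : ℕ} [hl : Fact l.Prime] {b₀ : ℤ} (hb : ¬ IsSquare (b₀ : ZMod l))
    {p : ℤ[X]} {m : ℕ} (hm : Even m) (hlm : ¬ l ∣ m) (hp : 2 * p.natDegree < m) :
    FormRel l b₀ (aeval (genR R) p) (cheb R m) := by
  have hinj : Function.Injective (algebraMap ℚ[X] R) := FaithfulSMul.algebraMap_injective _ _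
  have hm0 : m ≠ 0 := by omega
  set Q : ℤ[X] := Chebyshev.C ℤ m + C (l : ℤ) * p ^ 2
  have hdeg : (C (l : ℤ) * p ^ 2).degree < (Chebyshev.C ℤ m).degree := by
    rw [degree_eq_natDegree (Chebyshev.C_ne_zero ℤ m), Chebyshev.natDegree_C]
    refine degree_le_natDegree.trans_lt (Nat.cast_lt.2 ((natDegree_C_mul_le _ _).trans_lt ?_))
    exact natDegree_pow_le.trans_lt hp
  have hQ : Q.Monic := (Chebyshev.monic_C ℤ hm0).add_of_left hdeg
  have hQd : Q.natDegree = m := by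
    rw [natDegree_add_eq_left_of_degree_lt hdeg, Chebyshev.natDegree_C]
  have hQl : Q.map (Int.castRingHom (ZMod l)) = Chebyshev.C (ZMod l) m := by
    simp [Q, Chebyshev.map_C]
  obtain ⟨n, rfl⟩ := hm
  obtain ⟨b, ⟨e, he⟩, x₁, x₂, hd⟩ := exists_dvd_sq_sub_of_separable (l := l) hQ (by
    rw [map_expand, hQl]
    have := Chebyshev.separable_expand_C (A := ZMod l) n (by
      rw [two_mul, ← Nat.cast_add, Ne, ZMod.natCast_eq_zero_iff]
      exact hlm)
    rw [two_mul] at this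
    exact_mod_cast this) b₀
  have hbsq : ¬ IsSquare (b : ℚ) := by
    rw [Rat.isSquare_intCast_iff]
    intro h
    refine hb ?_
    have := h.map (Int.castRingHom (ZMod l))
    have h1 : b₀ = b - l * e := by linarith
    rw [h1]
    simpa using this
  obtain ⟨y, y₁, y₂, y₃, y₄, hy, hE⟩ := exists_mul_sq_eq_of_dvd hbsq (hQ.map _)
    (by rw [hQ.natDegree_map, hQd]; exact ⟨n, rfl⟩) hd
  refine ⟨e, algebraMap _ _ y, algebraMap _ _ y₁, algebraMap _ _ y₂, algebraMap _ _ y₃,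
    algebraMap _ _ y₄, (map_ne_zero_iff _ hinj).2 hy, ?_⟩
  have hE' := congrArg (algebraMap ℚ[X] R) hE
  have h1 : b = b₀ + l * e := by linarith
  rw [aeval_genR, cheb, genR]
  simp only [h1, Q, map_mul, map_pow, map_sub, map_add, Polynomial.map_add, Polynomial.map_mul,
    Polynomial.map_pow, Chebyshev.map_C, Int.cast_add, Int.cast_mul, map_intCast, Int.cast_natCast,
    map_natCast, Polynomial.map_natCast] at hE' ⊢
  exact hE'

end

namespace DiophSys

section

variable {R : Type*} [CommRing R]

open MvPolynomial in
theorem DS.subst {ι ι' : Type} {P : (ι → R) → Prop} (hP : DS P) {F : ι → (ι' → R) → R}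
    (hF : ∀ i, PolyFun (F i)) : DS (fun ρ => P (fun i => F i ρ)) := by
  obtain ⟨m, E, hE⟩ := hP
  choose p hp using hF
  refine ⟨m, E.map (bind₁ (Sum.elim (fun i => rename Sum.inl (p i)) fun j =>
    MvPolynomial.X (Sum.inr j))),
    fun ρ => (hE _).trans (exists_congr fun x => ?_)⟩
  simp only [List.mem_map, forall_exists_index, and_imp, forall_apply_eq_imp_iff₂]
  refine forall₂_congr fun f _ => ?_
  have : (fun i => MvPolynomial.eval (Sum.elim ρ x)
      (Sum.elim (fun i => rename Sum.inl (p i)) (fun j => MvPolynomial.X (Sum.inr j)) i)) =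
      Sum.elim (fun i => F i ρ) x := by
    ext (i | j)
    · simp only [Sum.elim_inl, eval_rename, hp]
      rfl
    · simp
  rw [← this]
  exact Eq.congr_left (eval₂Hom_bind₁ (RingHom.id R) _ _ f).symm

theorem D1.of {P : R → Prop} (h : DS (fun ρ : Fin 1 → R => P (ρ 0))) : D1 P :=
  fun hf => h.subst (F := ![_]) (Fin.forall_fin_one.2 hf)

theorem D2.of {P : R → R → Prop} (h : DS (fun ρ : Fin 2 → R => P (ρ 0) (ρ 1))) : D2 P :=
  fun hf hg => h.subst (F := ![_, _]) (Fin.forall_fin_two.2 ⟨hf, hg⟩)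

theorem D3.of {P : R → R → R → Prop} (h : DS (fun ρ : Fin 3 → R => P (ρ 0) (ρ 1) (ρ 2))) : D3 P :=
  fun hf hg hh => h.subst (F := ![_, _, _]) (by
    intro i
    fin_cases i
    exacts [hf, hg, hh])

theorem D4.of {P : R → R → R → R → Prop}
    (h : DS (fun ρ : Fin 4 → R => P (ρ 0) (ρ 1) (ρ 2) (ρ 3))) : D4 P :=
  fun hf hg hh hk => h.subst (F := ![_, _, _, _]) (by
    intro i
    fin_cases i
    exacts [hf, hg, hh, hk])

end

variable {R K : Type*} [CommRing R] [IsDomain R] [Algebra ℚ[X] R] [Module.Finite ℚ[X] R]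
  [Module.Free ℚ[X] R] [Field K] [CharZero K] [Algebra R K] [Algebra ℚ[X] K]
  [IsScalarTower ℚ[X] R K] [IsFractionRing R K]

variable (R K) in
/-- The data which make the Diophantine degree bounds available. -/
structure Admissible (κ l : ℕ) [Fact l.Prime] (b₀ : ℤ) : Prop where
  oddPoles : OddPoles R K
  d1_int : D1 (fun n : R => ∃ z : ℤ, n = z)
  d1_nat : D1 (fun n : R => ∃ m : ℕ, n = m)
  κ_pos : 0 < κ
  κ_lt : κ < l
  two_lt : 2 < l
  d3_exp : D3 (Exp R κ)
  not_isSquare : ¬ IsSquare (b₀ : ZMod l)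
  exists_residue_map : ∀ v : FFPrime ℚ K, v.ord (genK K) < 0 →
    ∃ φ : v.valuationSubring →+* ℚ_[l], ∀ x : v.valuationSubring, 0 < v.ord (x : K) → φ x = 0

theorem exists_admissible (h : OddPoles R K) :
    ∃ (κ l : ℕ) (_ : Fact l.Prime) (b₀ : ℤ), Admissible R K κ l b₀ := by
  obtain ⟨hZ, hN, κ, hκ, hE⟩ := exists_d3_exp h
  obtain ⟨l, hl, hlκ, hres⟩ := h.isFunctionField.exists_residue_maps
    (h.isFunctionField.finite_poles (genK K)) (κ + 2)
  obtain ⟨b, hb⟩ := FiniteField.exists_nonsquare (F := ZMod l) (by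
    rw [ZMod.ringChar_zmod_n]
    omega)
  obtain ⟨b₀, rfl⟩ := ZMod.intCast_surjective b
  exact ⟨κ, l, hl, b₀, h, hZ, hN, hκ, by omega, by omega, hE, hb, hres⟩

variable (K) in
/-- The pole orders of `x` are at most `n` times those of the distinguished generator. -/
def DegLe (n : ℕ) (x : R) : Prop :=
  ∀ v : FFPrime ℚ K, v.ord (genK K) < 0 → v.Le (n * v.ord (genK K)) (algebraMap R K x)

namespace DegLe

variable {m n : ℕ} {x y : R}

theorem mono (hx : DegLe K m x) (hmn : m ≤ n) : DegLe K n x := fun v hv =>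
  (hx v hv).mono (mul_le_mul_of_nonpos_right (by exact_mod_cast hmn) hv.le)

theorem add (hx : DegLe K n x) (hy : DegLe K n y) : DegLe K n (x + y) := fun v hv => by
  rw [map_add]
  exact (hx v hv).add (hy v hv)

theorem neg (hx : DegLe K n x) : DegLe K n (-x) := fun v hv => by
  rw [map_neg]
  exact (hx v hv).neg

theorem sub (hx : DegLe K n x) (hy : DegLe K n y) : DegLe K n (x - y) := by
  rw [sub_eq_add_neg]
  exact hx.add hy.neg

theorem mul (hx : DegLe K m x) (hy : DegLe K n y) : DegLe K (m + n) (x * y) := fun v hv => by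
  rw [map_mul, Nat.cast_add, add_mul]
  exact (hx v hv).mul (hy v hv)

theorem one (n : ℕ) : DegLe K n (1 : R) := fun v hv => by
  rw [map_one]
  have := v.le_algebraMap 1
  rw [map_one] at this
  exact this.mono (mul_nonpos_of_nonneg_of_nonpos (Nat.cast_nonneg n) hv.le)

theorem pow (hx : DegLe K m x) (n : ℕ) : DegLe K (m * n) (x ^ n) := by
  induction n with
  | zero => simpa using one (m * 0)
  | succ n ih =>
    rw [pow_succ, mul_add, mul_one]
    exact ih.mul hx

theorem of_natDegree_le {p : ℚ[X]} (hp : p.natDegree ≤ n) : DegLe K n (algebraMap ℚ[X] R p) :=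
  fun v hv => by
  rw [← IsScalarTower.algebraMap_apply, OddPoles.algebraMap_eq_aeval]
  exact v.le_aeval hv hp

theorem eq_zero_of_dvd (h : OddPoles R K) {e : ℕ} {u : R} (hx : DegLe K n x) (hne : n < e)
    (hu : ∀ v : FFPrime ℚ K, v.ord (genK K) < 0 → v.ord (algebraMap R K u) ≤ e * v.ord (genK K))
    (hux : u ∣ x) : x = 0 := by
  obtain ⟨q, rfl⟩ := hux
  have hinj := IsFractionRing.injective R K
  by_contra h0
  have hu0 := left_ne_zero_of_mul h0
  have hq0 := right_ne_zero_of_mul h0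
  refine hq0 (h.eq_zero_of_le_one fun v hv => Or.inr ?_)
  have h1 := (hx v hv).ord_le ((map_ne_zero_iff _ hinj).2 h0)
  rw [map_mul, v.ord_mul ((map_ne_zero_iff _ hinj).2 hu0) ((map_ne_zero_iff _ hinj).2 hq0)] at h1
  have h2 := hu v hv
  have h3 : ((n : ℤ) + 1) * -v.ord (genK K) ≤ e * -v.ord (genK K) :=
    mul_le_mul_of_nonneg_right (by exact_mod_cast hne) (by omega)
  linarith

end DegLe

end DiophSys

namespace Polynomial.Chebyshev

theorem two_pow_le_eval_C_three (m : ℕ) : 2 ^ m ≤ (C ℤ m).eval 3 := by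
  have key : ∀ m : ℕ, 2 ^ m ≤ (C ℤ m).eval 3 ∧ 2 ^ (m + 1) ≤ (C ℤ ((m + 1 : ℕ) : ℤ)).eval 3 ∧
      (C ℤ m).eval 3 ≤ (C ℤ ((m + 1 : ℕ) : ℤ)).eval 3 := by
    intro m
    induction m with
    | zero => simp
    | succ m ih =>
      obtain ⟨h1, h2, h3⟩ := ih
      have h4 : (C ℤ ((m + 1 + 1 : ℕ) : ℤ)).eval 3 =
          3 * (C ℤ ((m + 1 : ℕ) : ℤ)).eval 3 - (C ℤ (m : ℤ)).eval 3 := by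
        have := congrArg (Polynomial.eval 3) (C_add_two ℤ (m : ℤ))
        simp only [eval_sub, eval_mul, eval_X] at this
        push_cast
        rw [← this]
        ring_nf
      refine ⟨h2, ?_, ?_⟩
      · rw [pow_succ]
        linarith
      · have : (0 : ℤ) < 2 ^ m := by positivity
        linarith
  exact (key m).1

end Polynomial.Chebyshev

namespace DiophSys

section

variable {R : Type*} [CommRing R]

theorem DS.dvd {ι : Type} {f g : (ι → R) → R} (hf : PolyFun f) (hg : PolyFun g) :
    DS (fun ρ => f ρ ∣ g ρ) :=
  DS.ex (DS.eq hg.lift (hf.lift.mul (PolyFun.proj none)))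

end

variable {R K : Type*} [CommRing R] [IsDomain R] [Algebra ℚ[X] R] [Module.Finite ℚ[X] R]
  [Module.Free ℚ[X] R] [Field K] [CharZero K] [Algebra R K] [Algebra ℚ[X] K]
  [IsScalarTower ℚ[X] R K] [IsFractionRing R K]

theorem algebraMap_C_intCast (z : ℤ) : algebraMap ℚ[X] R (C (z : ℚ)) = z := by
  rw [show (C (z : ℚ) : ℚ[X]) = (z : ℚ[X]) from map_intCast C z, map_intCast]

theorem intCast_eq_of_dvd {b x y : ℤ} (h : genR R - b ∣ (x : R) - y) : x = y := by
  by_contra hxy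
  refine not_isUnit_genR_sub (R := R) b
    (isUnit_of_dvd_unit (algebraMap_C_intCast (R := R) b ▸ h) ?_)
  rw [← algebraMap_C_intCast x, ← algebraMap_C_intCast y, ← map_sub, ← map_sub]
  exact ((isUnit_iff_ne_zero.2 (sub_ne_zero.2 (by exact_mod_cast hxy))).map C).map _

theorem genR_sub_dvd (b : ℤ) (p : ℤ[X]) :
    genR R - b ∣ aeval (genR R) p - (p.eval b : ℤ) := by
  have := map_dvd (aeval (genR R)) (X_sub_C_dvd_sub_C_eval (a := b) (p := p))
  simpa using this

theorem cheb_eq_aeval (m : ℕ) : cheb R m = aeval (genR R) (Chebyshev.C ℤ m) := by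
  rw [aeval_genR, Chebyshev.map_C, cheb]

theorem algebraMap_sub_mk (z r s : R) :
    algebraMap R (QR R) z - ⟨r, s⟩ = ⟨z - r, -s⟩ := QuadraticAlgebra.ext (by simp) (by simp)

/-- `G` is the value at `3` of a Chebyshev polynomial of index proportional to `L`. -/
def BigRel (κ : ℕ) (L G : R) : Prop :=
  (∃ g : ℕ, G = g) ∧ ∃ c, ChebRel κ L c ∧ genR R - 3 ∣ c - G

/-- A bound for the pole orders of `z` proportional to `n`. -/
def DegRel (κ l : ℕ) (b₀ : ℤ) (z n : R) : Prop :=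
  ∃ c, ChebRel κ n c ∧ FormRel l b₀ z c

/-- `Z` is the `A`-th power of a polynomial `z₀` of degree `N` in the distinguished generator. -/
def PowRel (κ l : ℕ) (b₀ : ℤ) (z₀ N A Z : R) : Prop :=
  ∃ n r s r' s' g₀ g₁ : R, DegRel κ l b₀ Z n ∧ Exp R κ (2 * n + 2 * (N * A) + N + 1) r s ∧
    Exp R κ ((2 * n + 2 * (N * A) + N + 1) * A) r' s' ∧
    (⟨Z - r', -s'⟩ : QR R) = ⟨z₀ - r, -s⟩ * ⟨g₀, g₁⟩

namespace Admissible

variable {κ l : ℕ} [Fact l.Prime] {b₀ : ℤ} (h : Admissible R K κ l b₀)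
include h

theorem charZero : CharZero R := (algebraMap R K).charZero

theorem d2_bigRel : D2 (BigRel (R := R) κ) := D2.of <| by
  refine DS.and (h.d1_nat (PolyFun.proj _)) (DS.ex (DS.and
    (d2_chebRel h.d3_exp (PolyFun.proj _) (PolyFun.proj _)) (DS.dvd ?_ ?_)))
  all_goals repeat' first
    | exact PolyFun.proj _ | exact PolyFun.const _ | apply PolyFun.add | apply PolyFun.mul
    | apply PolyFun.sub

theorem d2_degRel : D2 (DegRel (R := R) κ l b₀) := D2.of <| DS.ex <| DS.and
  (d2_chebRel h.d3_exp (PolyFun.proj _) (PolyFun.proj _))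
  (d2_formRel h.d1_int l b₀ (PolyFun.proj _) (PolyFun.proj _))

theorem d4_powRel : D4 (PowRel (R := R) κ l b₀) := D4.of <| by
  simp only [PowRel, QuadraticAlgebra.ext_iff, QuadraticAlgebra.re_mul, QuadraticAlgebra.im_mul]
  refine DS.ex <| DS.ex <| DS.ex <| DS.ex <| DS.ex <| DS.ex <| DS.ex <| DS.and
    (h.d2_degRel ?_ ?_) <| DS.and (h.d3_exp ?_ ?_ ?_) <| DS.and (h.d3_exp ?_ ?_ ?_) <|
    DS.and (DS.eq ?_ ?_) (DS.eq ?_ ?_)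
  all_goals repeat' first
    | exact PolyFun.proj _ | exact PolyFun.const _ | apply PolyFun.add | apply PolyFun.mul
    | apply PolyFun.sub | apply PolyFun.neg

end Admissible

theorem BigRel.two_pow_le {κ n : ℕ} (hκ : 0 < κ) [CharZero R] {G : R} (h : BigRel κ (n : R) G) :
    ∃ g : ℕ, G = g ∧ 2 ^ n ≤ g := by
  obtain ⟨⟨g, rfl⟩, c, ⟨m, hm, rfl⟩, hd⟩ := h
  obtain rfl : n = m := by exact_mod_cast hm
  refine ⟨g, rfl, ?_⟩
  have hd' : genR R - ((3 : ℤ) : R) ∣ cheb R (κ * n) - g := by exact_mod_cast hd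
  have h1 := dvd_sub hd' (genR_sub_dvd (R := R) 3 (Chebyshev.C ℤ ((κ * n : ℕ) : ℤ)))
  rw [← cheb_eq_aeval, sub_sub_sub_cancel_left, ← Int.cast_natCast g] at h1
  have h6 := Chebyshev.two_pow_le_eval_C_three (κ * n)
  rw [intCast_eq_of_dvd h1] at h6
  exact (Nat.pow_le_pow_right two_pos (Nat.le_mul_of_pos_left n hκ)).trans (by exact_mod_cast h6)

theorem BigRel.exists (κ n : ℕ) : ∃ G : ℕ, BigRel κ (n : R) (G : R) := by
  have h6 := Chebyshev.two_pow_le_eval_C_three (κ * n)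
  obtain ⟨g, hg⟩ := Int.eq_ofNat_of_zero_le ((by positivity : (0 : ℤ) ≤ 2 ^ (κ * n)).trans h6)
  refine ⟨g, ⟨g, rfl⟩, _, ⟨n, rfl, rfl⟩, ?_⟩
  have h1 := genR_sub_dvd (R := R) 3 (Chebyshev.C ℤ ((κ * n : ℕ) : ℤ))
  rw [hg, ← cheb_eq_aeval] at h1
  exact_mod_cast h1

theorem DegRel.degLe {κ l : ℕ} [Fact l.Prime] {b₀ : ℤ} (h : Admissible R K κ l b₀) {z : R} {n : R}
    (hz : DegRel κ l b₀ z n) : ∃ m : ℕ, n = m ∧ DegLe K (κ * m) z := by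
  obtain ⟨c, ⟨m, hm, rfl⟩, hf⟩ := hz
  refine ⟨m, hm, fun v hv => hf.ord_le h.oddPoles h.not_isSquare h.exists_residue_map hv ?_⟩
  have : ((κ * m : ℕ) : ℤ) * v.ord (genK K) ≤ 0 :=
    mul_nonpos_of_nonneg_of_nonpos (Nat.cast_nonneg _) hv.le
  linarith

theorem DegRel.exists {κ l : ℕ} [Fact l.Prime] {b₀ : ℤ} (h : Admissible R K κ l b₀) (d B : ℕ) :
    ∃ n : ℕ, B ≤ n ∧ ∀ p : ℤ[X], p.natDegree ≤ d → DegRel κ l b₀ (aeval (genR R) p) (n : R) := by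
  have hl : l.Prime := Fact.out
  have h2 := h.two_lt
  set B' := B + d + 1
  have hB : B' ≤ l * B' := Nat.le_mul_of_pos_left _ hl.pos
  refine ⟨2 * (l * B' + 1), by omega, fun p hp => ⟨_, ⟨_, rfl, rfl⟩,
    FormRel.of_int h.not_isSquare ?_ ?_ ?_⟩⟩
  · exact ((even_two_mul _).mul_left κ)
  · intro hd
    rcases hl.dvd_mul.1 hd with h' | h'
    · exact absurd (Nat.le_of_dvd h.κ_pos h') (by have := h.κ_lt; omega)
    · rcases hl.dvd_mul.1 h' with h' | h'
      · exact absurd (Nat.le_of_dvd two_pos h') (by omega)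
      · exact hl.one_lt.ne' (Nat.dvd_one.1 ((Nat.dvd_add_right (dvd_mul_right l B')).1 h'))
  · have : 2 * (l * B' + 1) ≤ κ * (2 * (l * B' + 1)) := Nat.le_mul_of_pos_left _ h.κ_pos
    omega

theorem algebraMap_norm_sub_w_pow (q : ℚ[X]) (m : ℕ) :
    QuadraticAlgebra.norm (algebraMap R (QR R) (algebraMap ℚ[X] R q) - QR.w R ^ m) =
      algebraMap ℚ[X] R (q ^ 2 - q * Chebyshev.C ℚ m + 1) := by
  have hinj : Function.Injective (algebraMap R (QR R)) := fun x y hxy => by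
    simpa using congrArg QuadraticAlgebra.re hxy
  apply hinj
  have h1 := QR.w_pow_add_star (R := R) m
  have h2 : QR.w R ^ m * star (QR.w R ^ m) = 1 := by
    rw [star_pow, ← mul_pow, QR.w_mul_star, one_pow]
  have h3 : star (algebraMap R (QR R) (algebraMap ℚ[X] R q)) =
      algebraMap R (QR R) (algebraMap ℚ[X] R q) := by
    ext <;> simp
  rw [QuadraticAlgebra.algebraMap_norm_eq_mul_star, star_sub, h3]
  simp only [map_sub, map_add, map_mul, map_pow, map_one, ← h1, star_pow] at h2 ⊢
  linear_combination h2

theorem PowRel.eq_pow {κ l : ℕ} [Fact l.Prime] {b₀ : ℤ} (h : Admissible R K κ l b₀) {q : ℚ[X]}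
    (hq : q.natDegree ≠ 0) {A : ℕ} {Z : R}
    (hZ : PowRel κ l b₀ (algebraMap ℚ[X] R q) (q.natDegree : R) (A : R) Z) :
    Z = algebraMap ℚ[X] R q ^ A := by
  have := h.charZero
  obtain ⟨n, r, s, r', s', g₀, g₁, hd, ⟨m, hm, hr⟩, ⟨m', hm', hr'⟩, hg⟩ := hZ
  obtain ⟨n, rfl, hd'⟩ := hd.degLe h
  set N := q.natDegree with hN
  obtain rfl : 2 * n + 2 * (N * A) + N + 1 = m := by exact_mod_cast hm
  obtain rfl : (2 * n + 2 * (N * A) + N + 1) * A = m' := by exact_mod_cast hm'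
  set m := 2 * n + 2 * (N * A) + N + 1 with hmdef
  set ζ := algebraMap R (QR R) (algebraMap ℚ[X] R q) - QR.w R ^ (κ * m) with hζ
  have h1 : ζ ∣ algebraMap R (QR R) Z - QR.w R ^ (κ * m * A) := by
    refine ⟨⟨g₀, g₁⟩, ?_⟩
    rw [hζ, ← hr, mul_assoc, ← hr']
    rw [algebraMap_sub_mk, algebraMap_sub_mk, hg]
  have h2 : ζ ∣ algebraMap R (QR R) (Z - algebraMap ℚ[X] R q ^ A) := by
    have := dvd_sub h1 (sub_dvd_pow_sub_pow (algebraMap R (QR R) (algebraMap ℚ[X] R q))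
      (QR.w R ^ (κ * m)) A)
    rw [← pow_mul] at this
    simpa [map_sub, map_pow] using this
  have h3 := map_dvd QuadraticAlgebra.norm h2
  rw [algebraMap_norm_sub_w_pow, QuadraticAlgebra.norm_algebraMap] at h3
  have hκm : m ≤ κ * m := Nat.le_mul_of_pos_left _ h.κ_pos
  have hdeg : (q ^ 2 - q * Chebyshev.C ℚ ((κ * m : ℕ) : ℤ) + 1).natDegree = N + κ * m := by
    have hq0 : q ≠ 0 := by
      intro h0
      rw [h0] at hN
      exact hq hN
    have e : (q * Chebyshev.C ℚ ((κ * m : ℕ) : ℤ)).natDegree = N + κ * m := by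
      rw [natDegree_mul hq0 (Chebyshev.C_ne_zero ℚ _), Chebyshev.natDegree_C]
    have e2 : (q ^ 2).natDegree = 2 * N := natDegree_pow q 2
    have e3 : (q ^ 2 + 1).natDegree < (q * Chebyshev.C ℚ ((κ * m : ℕ) : ℤ)).natDegree := by
      refine (natDegree_add_le _ _).trans_lt ?_
      rw [e, e2, natDegree_one]
      omega
    rw [show q ^ 2 - q * Chebyshev.C ℚ ((κ * m : ℕ) : ℤ) + 1 =
      q ^ 2 + 1 - q * Chebyshev.C ℚ ((κ * m : ℕ) : ℤ) by ring,
      natDegree_sub_eq_right_of_natDegree_lt e3, e]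
  have h4 : DegLe K (κ * n + N * A) (Z - algebraMap ℚ[X] R q ^ A) :=
    (hd'.mono (by omega)).sub (((DegLe.of_natDegree_le (n := N) hN.ge).pow A).mono (by omega))
  have h5 := (h4.pow 2).eq_zero_of_dvd h.oddPoles (e := N + κ * m) ?_ ?_ h3
  · exact sub_eq_zero.1 (pow_eq_zero_iff two_ne_zero |>.1 h5)
  · have : κ * m = 2 * (κ * n) + κ * (2 * (N * A) + N + 1) := by rw [hmdef]; ring
    have h6 : 2 * (N * A) + N + 1 ≤ κ * (2 * (N * A) + N + 1) := Nat.le_mul_of_pos_left _ h.κ_pos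
    omega
  · intro v hv
    rw [← IsScalarTower.algebraMap_apply, OddPoles.algebraMap_eq_aeval]
    have h0 : q ^ 2 - q * Chebyshev.C ℚ ((κ * m : ℕ) : ℤ) + 1 ≠ 0 := by
      intro h0
      rw [h0, natDegree_zero] at hdeg
      omega
    rw [(v.ord_aeval hv h0).2, hdeg]

theorem PowRel.pow {κ l : ℕ} [Fact l.Prime] {b₀ : ℤ} (h : Admissible R K κ l b₀) (p : ℤ[X])
    (N A : ℕ) :
    PowRel κ l b₀ (aeval (genR R) p) (N : R) (A : R) (aeval (genR R) p ^ A) := by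
  obtain ⟨n, -, hn⟩ := DegRel.exists (R := R) h (p ^ A).natDegree 0
  replace hn := hn _ le_rfl
  set m := 2 * n + 2 * (N * A) + N + 1 with hm
  obtain ⟨g, hg⟩ := sub_dvd_pow_sub_pow (algebraMap R (QR R) (aeval (genR R) p))
    (QR.w R ^ (κ * m)) A
  refine ⟨n, _, _, _, _, g.re, g.im, by rwa [← map_pow], ⟨m, by simp [hm], rfl⟩,
    ⟨m * A, by simp [hm], rfl⟩, ?_⟩
  rw [← pow_mul, mul_assoc, ← map_pow] at hg
  rwa [← algebraMap_sub_mk, ← algebraMap_sub_mk]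

end DiophSys

namespace Polynomial

/-- The sum of the absolute values of the coefficients. -/
def l1 (p : ℤ[X]) : ℕ := p.sum fun _ c => c.natAbs

theorem l1_eq_sum_range {p : ℤ[X]} {n : ℕ} (hn : p.natDegree < n) :
    l1 p = ∑ i ∈ Finset.range n, (p.coeff i).natAbs :=
  p.sum_over_range' (by simp) n hn

theorem natAbs_coeff_le_l1 (p : ℤ[X]) (i : ℕ) : (p.coeff i).natAbs ≤ l1 p := by
  rw [l1_eq_sum_range (Nat.lt_succ_of_le (le_max_left p.natDegree i))]
  exact Finset.single_le_sum (f := fun i => (p.coeff i).natAbs) (fun _ _ => Nat.zero_le _)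
    (Finset.mem_range.2 (by omega))

theorem l1_le_of_natAbs_coeff_le {p : ℤ[X]} {n G : ℕ} (hn : p.natDegree < n)
    (hG : ∀ i, (p.coeff i).natAbs ≤ G) : l1 p ≤ n * G := by
  rw [l1_eq_sum_range hn]
  exact (Finset.sum_le_card_nsmul _ _ G fun i _ => hG i).trans (by simp)

theorem l1_add_le (p q : ℤ[X]) : l1 (p + q) ≤ l1 p + l1 q := by
  have hn : (p + q).natDegree < max p.natDegree q.natDegree + 1 :=
    Nat.lt_succ_of_le (natDegree_add_le p q)
  rw [l1_eq_sum_range hn, l1_eq_sum_range (Nat.lt_succ_of_le (le_max_left p.natDegree q.natDegree)),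
    l1_eq_sum_range (Nat.lt_succ_of_le (le_max_right p.natDegree q.natDegree)),
    ← Finset.sum_add_distrib]
  refine Finset.sum_le_sum fun i _ => ?_
  rw [coeff_add]
  exact Int.natAbs_add_le _ _

theorem l1_zero : l1 0 = 0 := by simp [l1]

theorem l1_neg (p : ℤ[X]) : l1 (-p) = l1 p := by
  rw [l1_eq_sum_range (p := -p) (n := p.natDegree + 1) (by simp),
    l1_eq_sum_range (Nat.lt_succ_self _)]
  simp

theorem l1_sub_le (p q : ℤ[X]) : l1 (p - q) ≤ l1 p + l1 q := by
  rw [sub_eq_add_neg, ← l1_neg q]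
  exact l1_add_le _ _

theorem l1_sum_le {ι : Type*} (s : Finset ι) (f : ι → ℤ[X]) :
    l1 (∑ i ∈ s, f i) ≤ ∑ i ∈ s, l1 (f i) := by
  classical
  induction s using Finset.induction_on with
  | empty => simp [l1_zero]
  | insert i s hi ih =>
    rw [Finset.sum_insert hi, Finset.sum_insert hi]
    exact (l1_add_le _ _).trans (Nat.add_le_add_left ih _)

theorem l1_C_mul (c : ℤ) (p : ℤ[X]) : l1 (C c * p) = c.natAbs * l1 p := by
  rw [l1_eq_sum_range (Nat.lt_succ_of_le (natDegree_C_mul_le c p)),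
    l1_eq_sum_range (Nat.lt_succ_self p.natDegree), Finset.mul_sum]
  simp [Int.natAbs_mul]

theorem l1_X_mul (p : ℤ[X]) : l1 (X * p) = l1 p := by
  rw [l1_eq_sum_range (p := X * p) (n := p.natDegree + 2)
    (Nat.lt_succ_of_le (natDegree_mul_le.trans (by rw [natDegree_X, add_comm]))),
    l1_eq_sum_range (Nat.lt_succ_self p.natDegree), Finset.sum_range_succ']
  simp

theorem l1_X_pow_mul (n : ℕ) (p : ℤ[X]) : l1 (X ^ n * p) = l1 p := by
  induction n with
  | zero => simp
  | succ n ih => rw [pow_succ', mul_assoc, l1_X_mul, ih]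

theorem l1_C (c : ℤ) : l1 (C c) = c.natAbs := by
  rw [l1, sum_C_index]
  rfl

theorem l1_one : l1 1 = 1 := by
  rw [← C_1, l1_C]
  rfl

theorem l1_mul_le (p q : ℤ[X]) : l1 (p * q) ≤ l1 p * l1 q := by
  conv_lhs => rw [p.as_sum_range_C_mul_X_pow, Finset.sum_mul]
  refine (l1_sum_le _ _).trans ?_
  rw [l1_eq_sum_range (Nat.lt_succ_self p.natDegree), Finset.sum_mul]
  refine Finset.sum_le_sum fun i _ => ?_
  rw [mul_assoc, l1_C_mul, l1_X_pow_mul]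

theorem l1_pow_le (p : ℤ[X]) (n : ℕ) : l1 (p ^ n) ≤ l1 p ^ n := by
  induction n with
  | zero => simp [l1_one]
  | succ n ih =>
    rw [pow_succ, pow_succ]
    exact (l1_mul_le _ _).trans (Nat.mul_le_mul_right _ ih)

theorem l1_comp_le {p q : ℤ[X]} {n L : ℕ} (hn : p.natDegree ≤ n) (hL : l1 q ≤ L) (hL1 : 1 ≤ L) :
    l1 (p.comp q) ≤ l1 p * L ^ n := by
  rw [comp, eval₂_eq_sum_range, l1_eq_sum_range (Nat.lt_succ_self p.natDegree), Finset.sum_mul]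
  refine (l1_sum_le _ _).trans (Finset.sum_le_sum fun i hi => ?_)
  rw [l1_C_mul]
  refine Nat.mul_le_mul_left _ ((l1_pow_le _ _).trans ((Nat.pow_le_pow_left hL i).trans
    (Nat.pow_le_pow_right hL1 ?_)))
  have := Finset.mem_range.1 hi
  omega

theorem eq_zero_of_eval_eq_zero {p : ℤ[X]} {b : ℕ} (hb : l1 p < b) (h : p.eval (b : ℤ) = 0) :
    p = 0 := by
  have hH : ∀ i, (p.coeff i).natAbs < b := fun i => (natAbs_coeff_le_l1 p i).trans_lt hb
  clear hb
  induction hn : p.natDegree generalizing p with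
  | zero =>
    rw [eq_C_of_natDegree_eq_zero hn, eval_C] at h
    rw [eq_C_of_natDegree_eq_zero hn, h, C_0]
  | succ n ih =>
    have h1 : p.divX.eval (b : ℤ) * b + p.coeff 0 = 0 := by
      rw [← divX_mul_X_add p] at h
      simpa using h
    have h2 : p.coeff 0 = 0 := by
      refine Int.eq_zero_of_abs_lt_dvd (m := b) ⟨-p.divX.eval (b : ℤ), by linarith⟩ ?_
      rw [Int.abs_eq_natAbs]
      exact_mod_cast hH 0
    have hb0 : (b : ℤ) ≠ 0 := by
      have := hH 0
      omega
    have h3 : p.divX = 0 := by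
      refine ih ?_ (fun i => ?_) ?_
      · rw [h2, add_zero] at h1
        exact (mul_eq_zero.1 h1).resolve_right hb0
      · rw [coeff_divX]
        exact hH _
      · rw [natDegree_divX_eq_natDegree_tsub_one, hn, Nat.add_sub_cancel]
    rw [← divX_mul_X_add p, h3, h2]
    simp

theorem Chebyshev.l1_C_le (m : ℕ) : l1 (Chebyshev.C ℤ m) ≤ 2 ^ (m + 1) := by
  have key : ∀ m : ℕ, l1 (Chebyshev.C ℤ m) ≤ 2 ^ (m + 1) ∧
      l1 (Chebyshev.C ℤ ((m + 1 : ℕ) : ℤ)) ≤ 2 ^ (m + 2) := by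
    intro m
    induction m with
    | zero =>
      have h2 : l1 (2 : ℤ[X]) = 2 := by
        rw [show (2 : ℤ[X]) = Polynomial.C 2 from rfl, l1_C]
        rfl
      have hX : l1 (X : ℤ[X]) = 1 := by
        rw [← mul_one X, l1_X_mul, l1_one]
      simp [h2, hX]
    | succ m ih =>
      obtain ⟨h1, h2⟩ := ih
      refine ⟨h2, ?_⟩
      have h4 : Chebyshev.C ℤ ((m + 1 + 1 : ℕ) : ℤ) =
          X * Chebyshev.C ℤ ((m + 1 : ℕ) : ℤ) - Chebyshev.C ℤ (m : ℤ) := by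
        have := C_add_two ℤ (m : ℤ)
        push_cast
        rw [← this]
        ring_nf
      rw [h4]
      refine (l1_sub_le _ _).trans ?_
      rw [l1_X_mul]
      have e1 : 2 ^ (m + 1 + 2) = 4 * 2 ^ (m + 1) := by ring
      have e2 : 2 ^ (m + 2) = 2 * 2 ^ (m + 1) := by ring
      omega
  exact (key m).1

/-- A divisor of a power of `1 - X ^ N` with constant coefficient `1` is an integral polynomial
with small coefficients. -/
theorem exists_map_eq_of_dvd {P : ℚ[X]} {N A : ℕ} (hN : N ≠ 0) (hP : P ∣ (1 - X ^ N) ^ A)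
    (hP0 : P.eval 0 = 1) :
    ∃ Q : ℤ[X], Q.map (Int.castRingHom ℚ) = P ∧ ∀ i, (Q.coeff i).natAbs ≤ 2 ^ (N * A) := by
  set F : ℤ[X] := (X ^ N - 1) ^ A with hF
  have hFm : F.Monic := (monic_X_pow_sub_C 1 hN).pow A
  have hdeg : F.natDegree = N * A := by
    rw [hF, natDegree_pow, ← C_1, natDegree_X_pow_sub_C, mul_comm]
  have hPF : P ∣ F.map (algebraMap ℤ ℚ) := by
    have : F.map (algebraMap ℤ ℚ) = (-1) ^ A * (1 - X ^ N) ^ A := by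
      rw [hF, ← mul_pow]
      simp
    rw [this]
    exact hP.mul_left _
  obtain ⟨Q, hQ⟩ := IsIntegrallyClosed.eq_map_mul_C_of_dvd ℚ hFm hPF
  have hPne : P ≠ 0 := by
    rintro rfl
    simp at hP0
  have hlc : P.leadingCoeff ≠ 0 := leadingCoeff_ne_zero.2 hPne
  have hQm : Q.Monic := by
    have h1 := congrArg leadingCoeff hQ
    rw [leadingCoeff_mul, leadingCoeff_C, mul_eq_right₀ hlc,
      leadingCoeff_map_of_injective (algebraMap ℤ ℚ).injective_int] at h1
    exact (algebraMap ℤ ℚ).injective_int (by simpa using h1)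
  have hQF : Q ∣ F := by
    rw [← map_dvd_map (algebraMap ℤ ℚ) (algebraMap ℤ ℚ).injective_int hQm]
    exact (Dvd.intro _ hQ).trans hPF
  have hQ0 : IsUnit (Q.eval 0) := by
    have : IsUnit (F.eval 0) := by
      rw [hF]
      simpa [hN] using isUnit_one.neg.pow A
    exact isUnit_of_dvd_unit (eval_dvd hQF) this
  have h1 : ((Q.eval 0 : ℤ) : ℚ) * P.leadingCoeff = 1 := by
    rw [← hP0, ← hQ, eval_mul, eval_C, leadingCoeff_mul, leadingCoeff_C,
      leadingCoeff_map_of_injective (algebraMap ℤ ℚ).injective_int, hQm.leadingCoeff]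
    simp [eval_zero_map]
  have hcoeff : ∀ i, (Q.coeff i).natAbs ≤ 2 ^ (N * A) := by
    intro i
    have h2 := coeff_le_of_roots_le (f := Int.castRingHom ℂ) (B := 1) i hQm (IsAlgClosed.splits _)
      fun z hz => by
        have hzr : F.eval₂ (Int.castRingHom ℂ) z = 0 := by
          obtain ⟨q, hq⟩ := hQF
          rw [hq, eval₂_mul, ← eval_map, (mem_roots'.1 hz).2.eq_zero, zero_mul]
        have hz1 : z ^ N = 1 := by
          rw [hF, eval₂_pow] at hzr
          have h3 := eq_zero_of_pow_eq_zero hzr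
          simpa [sub_eq_zero] using h3
        exact (Complex.norm_eq_one_of_pow_eq_one hz1 hN).le
    rw [one_pow, one_mul, coeff_map] at h2
    have h3 : ((Q.coeff i).natAbs : ℝ) ≤ Q.natDegree.choose i := by
      rw [Nat.cast_natAbs]
      simpa using h2
    refine (Nat.cast_le.1 h3).trans ((Nat.choose_le_two_pow _ _).trans
      (Nat.pow_le_pow_right two_pos ?_))
    rw [← hdeg]
    exact natDegree_le_of_dvd hQF hFm.ne_zero
  rcases Int.isUnit_iff.1 hQ0 with h2 | h2 <;> rw [h2] at h1
  · refine ⟨Q, ?_, hcoeff⟩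
    rw [← hQ, show P.leadingCoeff = 1 by simpa using h1, C_1, mul_one]
    rfl
  · refine ⟨-Q, ?_, fun i => by simpa using hcoeff i⟩
    rw [← hQ, show P.leadingCoeff = -1 by push_cast at h1; linarith]
    simp

end Polynomial

section

variable {R : Type*} [CommRing R] [IsDomain R] [Algebra ℚ[X] R] [Module.Finite ℚ[X] R]
  [Module.Free ℚ[X] R]

theorem dvd_norm_sub_norm {q : ℚ[X]} {x y : R} (h : algebraMap ℚ[X] R q ∣ x - y) :
    q ∣ Algebra.norm ℚ[X] x - Algebra.norm ℚ[X] y := by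
  obtain ⟨v, hv⟩ := h
  obtain rfl : x = y + q • v := by
    rw [Algebra.smul_def, ← hv]
    ring
  rw [← Ideal.mem_span_singleton, ← Ideal.Quotient.eq,
    Algebra.norm_eq_matrix_det (Module.Free.chooseBasis ℚ[X] R),
    Algebra.norm_eq_matrix_det (Module.Free.chooseBasis ℚ[X] R), RingHom.map_det, RingHom.map_det]
  congr 1
  ext i j
  have hq : Ideal.Quotient.mk (Ideal.span {q}) q = 0 :=
    Ideal.Quotient.eq_zero_iff_mem.2 (Ideal.mem_span_singleton_self q)
  simp [hq]

theorem coeff_eval_mulCharpoly {x : R} {J : ℕ}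
    (hJ : ∀ i, ((mulCharpoly x).coeff i).natDegree < J) {i j : ℕ}
    (hi : i < Module.finrank ℚ[X] R) (hj : j < J) :
    ((mulCharpoly x).eval (X ^ J)).coeff (J * i + j) = ((mulCharpoly x).coeff i).coeff j := by
  rw [eval_eq_sum_range, natDegree_mulCharpoly, finsetSum_coeff,
    Finset.sum_eq_single_of_mem i (Finset.mem_range.2 (by omega))]
  · rw [← pow_mul, coeff_mul_X_pow', if_pos (by omega), Nat.add_sub_cancel_left]
  · intro s _ hs
    rw [← pow_mul, coeff_mul_X_pow']
    split_ifs with h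
    · have h1 : s < i := by
        rcases Nat.lt_or_gt_of_ne hs with h1 | h1
        · exact h1
        · have : J * (i + 1) ≤ J * s := Nat.mul_le_mul_left _ h1
          rw [mul_add] at this
          omega
      have : J * (s + 1) ≤ J * i := Nat.mul_le_mul_left _ h1
      rw [mul_add] at this
      exact coeff_eq_zero_of_natDegree_lt ((hJ s).trans_le (by omega))
    · rfl

theorem map_eval_mulCharpoly {x : R} {β : ℚ} {m : ℚ}
    (h : algebraMap ℚ[X] R (X - C β) ∣ x - algebraMap ℚ[X] R (C m)) :
    (mulCharpoly x).map (evalRingHom β) = (X - C m) ^ Module.finrank ℚ[X] R := by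
  refine Polynomial.funext fun r => ?_
  have h1 : ((mulCharpoly x).map (evalRingHom β)).eval r =
      ((mulCharpoly x).eval (C r)).eval β := by
    rw [eval_map, ← coe_evalRingHom β, ← eval₂_at_apply (evalRingHom β) (C r)]
    simp
  have h2 : X - C β ∣ Algebra.norm ℚ[X] (algebraMap ℚ[X] R (C r) - x) -
      Algebra.norm ℚ[X] (algebraMap ℚ[X] R (C r - C m)) := by
    refine dvd_norm_sub_norm ?_
    rw [map_sub (algebraMap ℚ[X] R) (C r), sub_sub_sub_cancel_left, dvd_sub_comm]
    exact h
  rw [h1, eval_mulCharpoly]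
  rw [dvd_iff_isRoot, IsRoot.def, eval_sub, sub_eq_zero] at h2
  rw [h2, Algebra.norm_algebraMap]
  simp

/-- An element whose characteristic polynomial has small integral coefficients, and which is
congruent to an integer modulo `genR R - β` for a large integer `β`, is an integral polynomial in
the generator. -/
theorem exists_eq_aeval [CharZero R] {x : R} {J G β : ℕ} {m : ℤ} {P : ℤ[X]} (hG : 0 < G)
    (hJ : ∀ i, ((mulCharpoly x).coeff i).natDegree < J) (hP : ∀ i, (P.coeff i).natAbs ≤ G)
    (hPx : X ^ (Module.finrank ℚ[X] R * J + 1) ∣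
      Algebra.norm ℚ[X] (genR R ^ J - x) - P.map (Int.castRingHom ℚ))
    (hβ : Module.finrank ℚ[X] R ^ Module.finrank ℚ[X] R * (J * G) +
      2 ^ Module.finrank ℚ[X] R * (J * G) ^ Module.finrank ℚ[X] R < β)
    (hm : genR R - β ∣ x - m) :
    ∃ f : ℤ[X], x = aeval (genR R) f ∧ f.natDegree < J ∧ l1 f ≤ J * G := by
  set D := Module.finrank ℚ[X] R with hD
  have hD0 : 0 < D := Module.finrank_pos
  have hJ0 : 0 < J := (Nat.zero_le _).trans_lt (hJ 0)
  have hJG : 1 ≤ J * G := Nat.mul_pos hJ0 hG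
  set E := mulCharpoly x with hE
  have hEX : E.eval (X ^ J) = Algebra.norm ℚ[X] (genR R ^ J - x) := by
    rw [hE, eval_mulCharpoly, map_pow, genR]
  have hED : E.coeff D = 1 := by
    have := (mulCharpoly_monic x).coeff_natDegree
    rwa [natDegree_mulCharpoly] at this
  have hdig : ∀ i, ∃ f : ℤ[X], i ≤ D → f.map (Int.castRingHom ℚ) = E.coeff i ∧
      f.natDegree < J ∧ l1 f ≤ J * G := by
    intro i
    rcases lt_trichotomy i D with hi | rfl | hi
    · have hc : ∀ j < J, (E.coeff i).coeff j = P.coeff (J * i + j) := by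
        intro j hj
        have h1 : J * i + j < D * J + 1 := by
          have : J * (i + 1) ≤ J * D := Nat.mul_le_mul_left _ hi
          rw [mul_add, mul_comm J D] at this
          omega
        have h2 := X_pow_dvd_iff.1 hPx _ h1
        rw [← hEX, coeff_sub, coeff_eval_mulCharpoly hJ hi hj, coeff_map, sub_eq_zero] at h2
        exact h2
      refine ⟨∑ j ∈ Finset.range J, C (P.coeff (J * i + j)) * X ^ j, fun _ => ?_⟩
      have hco : ∀ n, (∑ j ∈ Finset.range J, C (P.coeff (J * i + j)) * X ^ j : ℤ[X]).coeff n =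
          if n < J then P.coeff (J * i + n) else 0 := by
        intro n
        simp [finsetSum_coeff, coeff_X_pow]
      have hdeg : (∑ j ∈ Finset.range J, C (P.coeff (J * i + j)) * X ^ j : ℤ[X]).natDegree < J := by
        refine Nat.lt_of_le_pred hJ0 (natDegree_le_iff_coeff_eq_zero.2 fun n hn => ?_)
        rw [hco, if_neg (by rw [Nat.pred_eq_sub_one] at hn; omega)]
      refine ⟨?_, hdeg, l1_le_of_natAbs_coeff_le hdeg fun n => ?_⟩
      · ext n
        rw [coeff_map, hco]
        split_ifs with hn
        · exact (hc n hn).symm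
        · rw [map_zero, coeff_eq_zero_of_natDegree_lt ((hJ i).trans_le (not_lt.1 hn))]
      · rw [hco]
        split_ifs
        · exact hP _
        · simp
    · exact ⟨1, fun _ => ⟨by simp [hED], by simpa, by simpa [l1_one]⟩⟩
    · exact ⟨0, fun h => by omega⟩
  choose f hf using hdig
  have hfβ : ∀ i ≤ D, (f i).eval (β : ℤ) = (-m) ^ (D - i) * D.choose i := by
    intro i hi
    have h1 := congrArg (coeff · i) (map_eval_mulCharpoly (x := x) (β := β) (m := m) (by
      rw [map_sub]
      simpa [genR] using hm))
    simp only [coeff_map, ← hE, ← hD, sub_eq_add_neg, ← C_neg, coeff_X_add_C_pow,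
      ← (hf i hi).1, coe_evalRingHom] at h1
    have h2 : ((f i).map (Int.castRingHom ℚ)).eval ((β : ℤ) : ℚ) = ((f i).eval (β : ℤ) : ℤ) := by
      rw [eval_intCast_map]
      simp
    rw [Int.cast_natCast] at h2
    rw [h2] at h1
    exact_mod_cast h1
  set e := f (D - 1) with he
  have key : ∀ i ≤ D, C ((D : ℤ) ^ (D - i)) * f i = C (D.choose i : ℤ) * e ^ (D - i) := by
    intro i hi
    refine sub_eq_zero.1 (eq_zero_of_eval_eq_zero (b := β) ?_ ?_)
    · refine lt_of_le_of_lt ((l1_sub_le _ _).trans (Nat.add_le_add ?_ ?_)) hβ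
      · rw [l1_C_mul]
        refine Nat.mul_le_mul ?_ (hf i hi).2.2
        rw [Int.natAbs_pow, Int.natAbs_natCast]
        exact Nat.pow_le_pow_right hD0 (Nat.sub_le _ _)
      · rw [l1_C_mul, Int.natAbs_natCast]
        refine Nat.mul_le_mul (Nat.choose_le_two_pow _ _) ((l1_pow_le _ _).trans ?_)
        exact (Nat.pow_le_pow_left (hf (D - 1) (Nat.sub_le _ _)).2.2 _).trans
          (Nat.pow_le_pow_right hJG (Nat.sub_le _ _))
    · rw [eval_sub, eval_mul, eval_mul, eval_C, eval_C, eval_pow, hfβ i hi, he,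
        hfβ (D - 1) (Nat.sub_le _ _), Nat.sub_sub_self hD0, pow_one,
        Nat.choose_symm (show 1 ≤ D from hD0), Nat.choose_one_right]
      ring
  have hroot : (aeval (genR R) e + D * x) ^ D = 0 := by
    have h1 := aeval_mulCharpoly x
    rw [aeval_eq_sum_range, natDegree_mulCharpoly, ← hD, ← hE] at h1
    rw [add_comm, add_pow, ← mul_zero ((D : R) ^ D), ← h1, Finset.mul_sum]
    refine Finset.sum_congr rfl fun i hi => ?_
    have hi' : i ≤ D := by
      have := Finset.mem_range.1 hi
      omega
    have h2 := congrArg (aeval (genR R)) (key i hi')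
    rw [map_mul, map_mul, map_pow, aeval_genR (f i), (hf i hi').1] at h2
    simp only [map_pow, map_natCast] at h2
    rw [Algebra.smul_def, mul_pow, mul_assoc, mul_comm (aeval (genR R) e ^ (D - i)), ← h2]
    rw [← pow_mul_pow_sub (D : R) hi']
    ring
  have hroot' : (D : R) * x = - aeval (genR R) e := by
    rw [eq_neg_iff_add_eq_zero, add_comm]
    exact pow_eq_zero_iff hD0.ne' |>.1 hroot
  have hdvd : C (D : ℤ) ∣ e := by
    rw [← IsIntegrallyClosed.pow_dvd_pow_iff hD0.ne']
    refine ⟨f 0, ?_⟩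
    have := key 0 (Nat.zero_le _)
    rw [Nat.sub_zero, Nat.choose_zero_right, Nat.cast_one, C_1, one_mul, C_pow] at this
    exact this.symm
  obtain ⟨g, hg⟩ := hdvd
  have hDZ : (D : ℤ) ≠ 0 := by exact_mod_cast hD0.ne'
  have hDR : (D : R) ≠ 0 := by exact_mod_cast hD0.ne'
  obtain ⟨-, he1, he2⟩ := hf (D - 1) (Nat.sub_le _ _)
  rw [← he] at he1 he2
  refine ⟨-g, ?_, ?_, ?_⟩
  · refine mul_left_cancel₀ hDR ?_
    rw [hroot', hg]
    simp
  · rwa [natDegree_neg, ← natDegree_C_mul hDZ, ← hg]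
  · rw [l1_neg]
    rw [hg, l1_C_mul, Int.natAbs_natCast] at he2
    exact (Nat.le_mul_of_pos_left _ hD0).trans he2

end

namespace Polynomial

theorem l1_divX_le (p : ℤ[X]) : l1 p.divX ≤ l1 p := by
  rw [l1_eq_sum_range (p := p) (n := p.natDegree + 2) (by omega), Finset.sum_range_succ',
    l1_eq_sum_range (p := p.divX) (n := p.natDegree + 1)
      (by rw [natDegree_divX_eq_natDegree_tsub_one]; omega)]
  simp

/-- An integral power series with constant coefficient `1` is approximated by divisors of powers
of the polynomials `1 - X ^ N`. -/
theorem exists_dvd_one_sub_X_pow_pow (F : ℤ[X]) (hF : F.eval 0 = 1) (d : ℕ) :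
    ∃ (N A : ℕ) (M : ℤ[X]), M ∣ (1 - X ^ (N + 1)) ^ A ∧ X ^ (d + 1) ∣ F - M := by
  induction d with
  | zero =>
    refine ⟨0, 0, 1, one_dvd _, ?_⟩
    rw [zero_add, pow_one, X_dvd_iff, coeff_zero_eq_eval_zero]
    simp [hF]
  | succ d ih =>
    obtain ⟨N, A, M, hM, Q, hQ⟩ := ih
    have hM0 : X ∣ M - 1 := by
      rw [X_dvd_iff, coeff_zero_eq_eval_zero]
      have h1 := congrArg (eval 0) hQ
      simp [hF] at h1
      simp
      linarith
    obtain ⟨M', hM'⟩ := hM0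
    obtain ⟨ε, hε, hc⟩ : ∃ ε : ℤ, ε ^ 2 = 1 ∧ (Q.coeff 0).natAbs * ε = Q.coeff 0 := by
      rcases le_total 0 (Q.coeff 0) with h | h
      · exact ⟨1, by simp, by simp [abs_of_nonneg h]⟩
      · exact ⟨-1, by simp, by simp [abs_of_nonpos h]⟩
    obtain ⟨T, hT⟩ := powAddExpansion (1 : ℤ[X]) (C ε * X ^ (d + 1)) (Q.coeff 0).natAbs
    obtain ⟨Q', hQ'⟩ : X ∣ Q - C (Q.coeff 0) := by
      rw [X_dvd_iff]
      simp
    have hcC : ((Q.coeff 0).natAbs : ℤ[X]) * C ε = C (Q.coeff 0) := by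
      conv_rhs => rw [← hc]
      simp
    refine ⟨2 * (d + 1) * (N + 1) - 1, A + (Q.coeff 0).natAbs,
      M * (1 + C ε * X ^ (d + 1)) ^ (Q.coeff 0).natAbs, ?_, ?_⟩
    · rw [Nat.sub_add_cancel (Nat.succ_le_of_lt (by positivity)), pow_add (1 - X ^ _) A]
      refine mul_dvd_mul (hM.trans (pow_dvd_pow_of_dvd ?_ _)) (pow_dvd_pow_of_dvd ?_ _)
      · rw [mul_comm (2 * (d + 1)), pow_mul]
        exact one_sub_dvd_one_sub_pow _ _
      · rw [pow_mul X]
        refine Dvd.dvd.trans ⟨1 - C ε * X ^ (d + 1), ?_⟩ (one_sub_dvd_one_sub_pow _ _)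
        have : (C ε : ℤ[X]) ^ 2 = 1 := by rw [← C_pow, hε, C_1]
        linear_combination X ^ (2 * (d + 1)) * this
    · rw [hT]
      refine ⟨Q' - M' * C (Q.coeff 0) - M * T * C ε ^ 2 * X ^ d, ?_⟩
      simp only [one_pow, mul_one]
      linear_combination hQ + X ^ (d + 1) * hQ' - C (Q.coeff 0) * X ^ (d + 1) * hM' -
        M * X ^ (d + 1) * hcC

end Polynomial

namespace DiophSys

variable {R K : Type*} [CommRing R] [IsDomain R] [Algebra ℚ[X] R] [Module.Finite ℚ[X] R]
  [Module.Free ℚ[X] R] [Field K] [CharZero K] [Algebra R K] [Algebra ℚ[X] K]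
  [IsScalarTower ℚ[X] R K] [IsFractionRing R K]

/-- A certificate that `y` is an integral polynomial in the generator of degree less than `J` and
with coefficient sum at most `B`. -/
def Cert (κ l : ℕ) (b₀ : ℤ) (y J B : R) : Prop :=
  ∃ n u N A G s m aJ ad aN Z M : R, DegRel κ l b₀ y n ∧ (∃ i : ℕ, u = i) ∧ (∃ i : ℕ, N = i) ∧
    (∃ i : ℕ, A = i) ∧ (∃ i : ℕ, s = i) ∧ (∃ z : ℤ, m = z) ∧
    J = Module.finrank ℚ[X] R * (κ * n + 1) + 1 + u ∧ PowRel κ l b₀ (genR R) 1 J aJ ∧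
    PowRel κ l b₀ (genR R) 1 (Module.finrank ℚ[X] R * J + 1) ad ∧
    PowRel κ l b₀ (genR R) 1 (N + 1) aN ∧ PowRel κ l b₀ (1 - aN) (N + 1) A Z ∧ M ∣ Z ∧
    ad ∣ aJ - (genR R * y - 1) - M ∧ BigRel κ ((N + 1) * (A * Module.finrank ℚ[X] R)) G ∧
    genR R - (Module.finrank ℚ[X] R ^ Module.finrank ℚ[X] R * (J * G) +
      2 ^ Module.finrank ℚ[X] R * (J * G) ^ Module.finrank ℚ[X] R + 1 + s) ∣ genR R * y - 1 - m ∧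
    B = J * G

variable {κ l : ℕ} [Fact l.Prime] {b₀ : ℤ} (h : Admissible R K κ l b₀)
include h

theorem Admissible.d3_cert : D3 (Cert (R := R) κ l b₀) := D3.of <| by
  refine DS.ex <| DS.ex <| DS.ex <| DS.ex <| DS.ex <| DS.ex <| DS.ex <| DS.ex <| DS.ex <| DS.ex <|
    DS.ex <| DS.ex <| DS.and (h.d2_degRel ?_ ?_) <| DS.and (h.d1_nat ?_) <| DS.and (h.d1_nat ?_) <|
    DS.and (h.d1_nat ?_) <| DS.and (h.d1_nat ?_) <| DS.and (h.d1_int ?_) <| DS.and (DS.eq ?_ ?_) <|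
    DS.and (h.d4_powRel ?_ ?_ ?_ ?_) <| DS.and (h.d4_powRel ?_ ?_ ?_ ?_) <|
    DS.and (h.d4_powRel ?_ ?_ ?_ ?_) <| DS.and (h.d4_powRel ?_ ?_ ?_ ?_) <|
    DS.and (DS.dvd ?_ ?_) <| DS.and (DS.dvd ?_ ?_) <| DS.and (h.d2_bigRel ?_ ?_) <|
    DS.and (DS.dvd ?_ ?_) (DS.eq ?_ ?_)
  all_goals repeat' first
    | exact PolyFun.proj _ | exact PolyFun.const _ | apply PolyFun.add | apply PolyFun.mul
    | apply PolyFun.sub | apply PolyFun.pow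

theorem PowRel.eq_genR_pow {A : ℕ} {Z : R} (hZ : PowRel κ l b₀ (genR R) 1 (A : R) Z) :
    Z = genR R ^ A :=
  PowRel.eq_pow h (q := X) (by simp) (by simpa [genR] using hZ)

theorem Cert.exists_eq_aeval {y J B : R} (hy : Cert κ l b₀ y J B) :
    ∃ (j b : ℕ) (p : ℤ[X]), J = j ∧ B = b ∧ y = aeval (genR R) p ∧ p.natDegree < j ∧ l1 p ≤ b := by
  have := h.charZero
  obtain ⟨n, u, N, A, G, s, m, aJ, ad, aN, Z, M, hn, ⟨u, rfl⟩, ⟨N, rfl⟩, ⟨A, rfl⟩, ⟨s, rfl⟩,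
    ⟨m, rfl⟩, hJ, haJ, had, haN, hZ, hMZ, hM, hG, hβ, hB⟩ := hy
  obtain ⟨n, rfl, hy⟩ := hn.degLe h
  set D := Module.finrank ℚ[X] R with hD
  obtain ⟨j, hj⟩ : ∃ j, j = D * (κ * n + 1) + 1 + u := ⟨_, rfl⟩
  have hJj : J = j := by
    rw [hJ, hj]
    push_cast
    ring
  clear hJ
  subst hJj
  obtain rfl := PowRel.eq_genR_pow h haJ
  obtain rfl := PowRel.eq_genR_pow (A := D * j + 1) h (by exact_mod_cast had)
  obtain rfl := PowRel.eq_genR_pow (A := N + 1) h (by exact_mod_cast haN)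
  have hq : (1 - X ^ (N + 1) : ℚ[X]).natDegree = N + 1 := by
    rw [← natDegree_neg, neg_sub, ← C_1, natDegree_X_pow_sub_C]
  obtain rfl := PowRel.eq_pow (A := A) h (q := 1 - X ^ (N + 1)) (by rw [hq]; omega)
    (by simpa [hq, genR] using hZ)
  obtain ⟨g, rfl, hg⟩ := BigRel.two_pow_le (n := (N + 1) * (A * D)) h.κ_pos (by exact_mod_cast hG)
  have hM1 : genR R ∣ M - 1 := by
    have h1 : genR R ∣ genR R ^ j - (genR R * y - 1) - M :=
      (dvd_pow_self _ (Nat.succ_ne_zero _)).trans hM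
    have h2 : genR R ∣ genR R ^ j := dvd_pow_self _ (by omega)
    have h3 : M - 1 = genR R ^ j - genR R * y - (genR R ^ j - (genR R * y - 1) - M) := by ring
    rw [h3]
    exact dvd_sub (dvd_sub h2 (dvd_mul_right _ _)) h1
  obtain ⟨P, hP, hPc⟩ := exists_map_eq_of_dvd (P := Algebra.norm ℚ[X] M) (N := N + 1) (A := A * D)
    (Nat.succ_ne_zero _) (by
      have := map_dvd (Algebra.norm ℚ[X]) hMZ
      rwa [← map_pow, Algebra.norm_algebraMap, ← pow_mul] at this) (by
      have := dvd_norm_sub_norm (q := X) hM1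
      rw [map_one, X_dvd_iff, coeff_zero_eq_eval_zero, eval_sub, eval_one, sub_eq_zero] at this
      exact this)
  have hx : DegLe K (κ * n + 1) (genR R * y - 1) := by
    refine DegLe.sub ?_ (DegLe.one _)
    rw [add_comm]
    exact (DegLe.of_natDegree_le natDegree_X.le).mul hy
  have hdeg : ∀ i, ((mulCharpoly (genR R * y - 1)).coeff i).natDegree < j := by
    intro i
    have h1 : (mulCharpoly (genR R * y - 1)).coeff i ∈
        degreeLE ℚ ((κ * n + 1) * D : ℕ) := by
      refine coeff_mem_of_eval_mem (natDegree_mulCharpoly _).le (fun r _ => ?_) i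
      rw [mem_degreeLE, ← natDegree_le_iff_degree_le, eval_mulCharpoly]
      exact h.oddPoles.natDegree_norm_le
        (((DegLe.of_natDegree_le (by simp)).sub hx : DegLe K (κ * n + 1) _))
    rw [mem_degreeLE, ← natDegree_le_iff_degree_le, mul_comm (κ * n + 1) D] at h1
    omega
  have hgpos : 0 < g := (pow_pos two_pos _).trans_le hg
  obtain ⟨f, hf, hfd, hfl⟩ := _root_.exists_eq_aeval
    (β := D ^ D * (j * g) + 2 ^ D * (j * g) ^ D + 1 + s) (m := m) hgpos hdeg
    (fun i => (hPc i).trans hg) (by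
      rw [hP]
      refine dvd_norm_sub_norm ?_
      rwa [map_pow, ← genR]) (by simp only [← hD]; omega) (by exact_mod_cast hβ)
  have hf0 : f.coeff 0 = -1 := by
    have h1 := genR_sub_dvd (R := R) 0 f
    rw [← hf, Int.cast_zero, sub_zero] at h1
    refine intCast_eq_of_dvd (R := R) (b := 0) ?_
    have h2 := dvd_sub (dvd_mul_right (genR R) y) h1
    convert h2 using 1
    · simp
    · simp [coeff_zero_eq_eval_zero]
      ring
  have hgen : genR R ≠ 0 := by
    have h1 := OddPoles.algebraMap_injective R (K := K)
    intro h0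
    have h2 : algebraMap ℚ[X] K X = 0 := by
      rw [IsScalarTower.algebraMap_apply ℚ[X] R K]
      rw [genR] at h0
      rw [h0, map_zero]
    exact X_ne_zero (h1 (h2.trans (map_zero _).symm))
  refine ⟨j, j * g, f.divX, rfl, by rw [hB]; push_cast; rfl, ?_, ?_, (l1_divX_le f).trans hfl⟩
  · rw [← divX_mul_X_add f, hf0] at hf
    refine mul_left_cancel₀ hgen ?_
    simp only [map_add, map_mul, aeval_X, map_neg, map_one] at hf
    linear_combination hf
  · rw [natDegree_divX_eq_natDegree_tsub_one]
    omega

theorem Cert.exists (p : ℤ[X]) : ∃ J B : ℕ, Cert κ l b₀ (aeval (genR R) p) (J : R) (B : R) := by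
  obtain ⟨n, -, hn⟩ := DegRel.exists (R := R) h p.natDegree 0
  replace hn := hn p le_rfl
  set D := Module.finrank ℚ[X] R with hD
  obtain ⟨j, hj⟩ : ∃ j, j = D * (κ * n + 1) + 1 := ⟨_, rfl⟩
  obtain ⟨N, A, M, hM, hFM⟩ := exists_dvd_one_sub_X_pow_pow (X ^ j - (X * p - 1)) (by
    simp [hj]) (D * j)
  obtain ⟨g, hg⟩ := BigRel.exists (R := R) κ ((N + 1) * (A * D))
  have hpow : ∀ i : ℕ, PowRel κ l b₀ (genR R) 1 (i : R) (genR R ^ i) := fun i => by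
    simpa using PowRel.pow h X 1 i
  refine ⟨j, j * g, n, 0, N, A, g, 0,
    ((X * p - 1).eval ((D ^ D * (j * g) + 2 ^ D * (j * g) ^ D + 1 : ℕ) : ℤ) : ℤ), genR R ^ j,
    genR R ^ (D * j + 1), genR R ^ (N + 1), (1 - genR R ^ (N + 1)) ^ A, aeval (genR R) M, hn,
    ⟨0, by simp⟩, ⟨N, rfl⟩, ⟨A, rfl⟩, ⟨0, by simp⟩, ⟨_, rfl⟩, ?_, hpow j,
    by exact_mod_cast hpow (D * j + 1), by exact_mod_cast hpow (N + 1),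
    ?_, ?_, ?_, by exact_mod_cast hg, ?_, ?_⟩
  · rw [hj]
    push_cast
    ring
  · have e : aeval (genR R) (1 - X ^ (N + 1) : ℤ[X]) = 1 - genR R ^ (N + 1) := by simp
    rw [← e]
    exact_mod_cast PowRel.pow h (1 - X ^ (N + 1)) (N + 1) A
  · simpa using map_dvd (aeval (genR R)) hM
  · simpa using map_dvd (aeval (genR R)) hFM
  · have := genR_sub_dvd (R := R) ((D ^ D * (j * g) + 2 ^ D * (j * g) ^ D + 1 : ℕ) : ℤ) (X * p - 1)
    rw [add_zero]
    convert this using 1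
    · push_cast
      rfl
    · simp
  · push_cast
    rfl

end DiophSys

namespace Polynomial

theorem exists_intCast_smul_eq_map (q : ℕ → ℚ[X]) (j : ℕ) : ∃ c : ℤ, c ≠ 0 ∧ ∀ i < j,
    ∃ r : ℤ[X], r.map (Int.castRingHom ℚ) = C (c : ℚ) * q i := by
  induction j with
  | zero => exact ⟨1, one_ne_zero, by simp⟩
  | succ j ih =>
    obtain ⟨c, hc, h⟩ := ih
    obtain ⟨b, hb, hbq⟩ := IsLocalization.integerNormalization_spec (nonZeroDivisors ℤ) (q j)
    have hbq' : (IsLocalization.integerNormalization (nonZeroDivisors ℤ) (q j)).map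
        (Int.castRingHom ℚ) = C (b : ℚ) * q j := by
      rw [← algebraMap_int_eq, hbq]
      simp
    refine ⟨c * b, mul_ne_zero hc (nonZeroDivisors.ne_zero hb), fun i hi => ?_⟩
    rcases (Nat.lt_succ_iff.1 hi).lt_or_eq with hi | rfl
    · obtain ⟨r, hr⟩ := h i hi
      refine ⟨C b * r, ?_⟩
      rw [Polynomial.map_mul, hr]
      simp
      ring
    · refine ⟨C c * IsLocalization.integerNormalization (nonZeroDivisors ℤ) (q i), ?_⟩
      rw [Polynomial.map_mul, hbq']
      simp
      ring

end Polynomial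

namespace DiophSys

variable {R K : Type*} [CommRing R] [IsDomain R] [Algebra ℚ[X] R] [Module.Finite ℚ[X] R]
  [Module.Free ℚ[X] R] [Field K] [CharZero K] [Algebra R K] [Algebra ℚ[X] K]
  [IsScalarTower ℚ[X] R K] [IsFractionRing R K]

/-- `s` is a combination of the first `j` powers of `T` with coefficients whose pole orders are
bounded in terms of `n`. -/
def PowComb (κ l : ℕ) (b₀ : ℤ) (T : R) : ℕ → R → R → Prop
  | 0, s, _ => s = 0
  | j + 1, s, n => ∃ r s', DegRel κ l b₀ r n ∧ PowComb κ l b₀ T j s' n ∧ s = r + T * s'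

/-- A system of conditions forcing `x` to be an integral polynomial in `T`. -/
def IntPolyRel (κ l : ℕ) (b₀ : ℤ) (T : R) (t₀ : ℕ) (x : R) : Prop :=
  ∃ y J B z J' B' n G s γ m c u : R, Cert κ l b₀ y J B ∧ Cert κ l b₀ z J' B' ∧
    (∃ i : ℕ, n = i) ∧ (∃ i : ℕ, s = i) ∧ (∃ i : ℤ, γ = i) ∧ (∃ i : ℤ, m = i) ∧
    (∃ i : ℤ, c = i) ∧ c ≠ 0 ∧
    ChebRel κ (n + Module.finrank ℚ[X] R * t₀ + J * t₀ + t₀ + 1) u ∧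
    BigRel κ ((κ * (n + Module.finrank ℚ[X] R * t₀ + J * t₀ + t₀ + 1) + 1) * J) G ∧
    genR R - (B' + B * G + 1 + s) ∣ u - γ ∧ genR R - γ ∣ y - m ∧
    genR R - (B' + B * G + 1 + s) ∣ z - m ∧ T - u ∣ x - z ∧
    PowComb κ l b₀ T (Module.finrank ℚ[X] R) (c * x) n

theorem exists_degLe (h : OddPoles R K) (x : R) : ∃ n : ℕ, DegLe K n x := by
  have hfin := h.isFunctionField.finite_poles (genK K)
  have : ∀ v : FFPrime ℚ K, ∃ n : ℕ, v.ord (genK K) < 0 →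
      v.Le (n * v.ord (genK K)) (algebraMap R K x) := fun v => by
    refine ⟨(v.ord (algebraMap R K x)).natAbs, fun hv => Or.inr ?_⟩
    have h1 : -((v.ord (algebraMap R K x)).natAbs : ℤ) ≤ v.ord (algebraMap R K x) := by omega
    nlinarith
  choose f hf using this
  refine ⟨∑ v ∈ hfin.toFinset, f v, fun v hv => (hf v hv).mono ?_⟩
  have : f v ≤ ∑ v ∈ hfin.toFinset, f v :=
    Finset.single_le_sum (f := f) (fun _ _ => Nat.zero_le _) (hfin.mem_toFinset.2 hv)
  exact mul_le_mul_of_nonpos_right (by exact_mod_cast this) hv.le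

variable {κ l : ℕ} [Fact l.Prime] {b₀ : ℤ} (h : Admissible R K κ l b₀)
include h

theorem Admissible.d2_powComb (T : R) (j : ℕ) : D2 (PowComb κ l b₀ T j) := by
  induction j with
  | zero =>
    exact D2.of (P := PowComb κ l b₀ T 0) (DS.eq (PolyFun.proj _) (PolyFun.const 0))
  | succ j ih =>
    exact D2.of <| DS.ex <| DS.ex <| DS.and (h.d2_degRel (PolyFun.proj _) (PolyFun.proj _)) <|
      DS.and (ih (PolyFun.proj _) (PolyFun.proj _)) <|
      DS.eq (PolyFun.proj _) ((PolyFun.proj _).add ((PolyFun.const _).mul (PolyFun.proj _)))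

theorem Admissible.d1_intPolyRel (T : R) (t₀ : ℕ) : D1 (IntPolyRel κ l b₀ T t₀) := D1.of <| by
  refine DS.ex <| DS.ex <| DS.ex <| DS.ex <| DS.ex <| DS.ex <| DS.ex <| DS.ex <| DS.ex <| DS.ex <|
    DS.ex <| DS.ex <| DS.ex <| DS.and (h.d3_cert ?_ ?_ ?_) <| DS.and (h.d3_cert ?_ ?_ ?_) <|
    DS.and (h.d1_nat ?_) <| DS.and (h.d1_nat ?_) <| DS.and (h.d1_int ?_) <|
    DS.and (h.d1_int ?_) <| DS.and (h.d1_int ?_) <| DS.and (d1_ne_zero h.d1_int ?_) <|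
    DS.and (d2_chebRel h.d3_exp ?_ ?_) <| DS.and (h.d2_bigRel ?_ ?_) <| DS.and (DS.dvd ?_ ?_) <|
    DS.and (DS.dvd ?_ ?_) <| DS.and (DS.dvd ?_ ?_) <| DS.and (DS.dvd ?_ ?_) <|
    h.d2_powComb T _ ?_ ?_
  all_goals repeat' first
    | exact PolyFun.proj _ | exact PolyFun.const _ | apply PolyFun.add | apply PolyFun.mul
    | apply PolyFun.sub

theorem PowComb.degLe {T : R} {t₀ : ℕ} (hT : DegLe K t₀ T) {n : ℕ} :
    ∀ {j : ℕ} {s : R}, PowComb κ l b₀ T j s (n : R) → DegLe K (κ * n + j * t₀) s := by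
  have := h.charZero
  intro j
  induction j with
  | zero =>
    rintro s rfl v hv
    exact Or.inl (map_zero _)
  | succ j ih =>
    rintro _ ⟨r, s, hr, hs, rfl⟩
    obtain ⟨m, hm, hr⟩ := hr.degLe h
    obtain rfl : n = m := by exact_mod_cast hm
    exact (hr.mono (Nat.le_add_right _ _)).add ((hT.mul (ih hs)).mono (by ring_nf; omega))

theorem IntPolyRel.exists_eq_aeval {T : R} {t₀ : ℕ} (hT : DegLe K t₀ T) {x : R}
    (hx : IntPolyRel κ l b₀ T t₀ x) : ∃ P : ℤ[X], x = aeval T P := by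
  have := h.charZero
  obtain ⟨y, J, B, z, J', B', n, G, s, γ, m, c, u, hy, hz, ⟨n, rfl⟩, ⟨s, rfl⟩, ⟨γ, rfl⟩, ⟨m, rfl⟩,
    ⟨c, rfl⟩, hc, hu, hG, hγ, hm, hzm, hTu, hcx⟩ := hx
  obtain ⟨J, B, p, rfl, rfl, rfl, hpJ, hpB⟩ := hy.exists_eq_aeval h
  obtain ⟨J', B', q, rfl, rfl, rfl, -, hqB⟩ := hz.exists_eq_aeval h
  set D := Module.finrank ℚ[X] R
  obtain ⟨e, he, rfl⟩ := hu
  obtain rfl : n + D * t₀ + J * t₀ + t₀ + 1 = e := by exact_mod_cast he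
  set e := n + D * t₀ + J * t₀ + t₀ + 1 with hedef
  obtain ⟨G, rfl, hGe⟩ := BigRel.two_pow_le (n := (κ * e + 1) * J) h.κ_pos (by
    exact_mod_cast hG)
  set δ := B' + B * G + 1 + s with hδ
  have hδR : (B' + B * G + 1 + s : R) = (δ : ℤ) := by
    rw [hδ]
    push_cast
    rfl
  rw [hδR] at hγ hzm
  set H := Chebyshev.C ℤ ((κ * e : ℕ) : ℤ) with hH
  rw [cheb_eq_aeval] at hγ hTu
  have h1 := dvd_sub hγ (genR_sub_dvd (R := R) (δ : ℤ) H)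
  rw [sub_sub_sub_cancel_left] at h1
  obtain rfl := (intCast_eq_of_dvd h1).symm
  have h2 := dvd_sub hm (genR_sub_dvd (R := R) (H.eval (δ : ℤ)) p)
  rw [sub_sub_sub_cancel_left] at h2
  obtain rfl := (intCast_eq_of_dvd h2).symm
  have h3 := dvd_sub hzm (genR_sub_dvd (R := R) (δ : ℤ) q)
  rw [sub_sub_sub_cancel_left] at h3
  have h4 := intCast_eq_of_dvd h3
  have hqp : q - p.comp H = 0 := by
    refine eq_zero_of_eval_eq_zero (b := δ) ?_ ?_
    · have h5 : l1 (p.comp H) ≤ l1 p * (2 ^ (κ * e + 1)) ^ J :=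
        l1_comp_le hpJ.le (Chebyshev.l1_C_le _) Nat.one_le_two_pow
      rw [← pow_mul] at h5
      have h6 := h5.trans (Nat.mul_le_mul hpB hGe)
      have h7 := l1_sub_le q (p.comp H)
      omega
    · rw [eval_sub, eval_comp, h4, sub_self]
  rw [sub_eq_zero] at hqp
  subst hqp
  refine ⟨p, ?_⟩
  have h8 : T - aeval (genR R) H ∣ x - aeval T p := by
    have h9 := sub_dvd_eval_sub T (aeval (genR R) H) (p.map (Int.castRingHom R))
    rw [← algebraMap_int_eq, eval_map_algebraMap, eval_map_algebraMap] at h9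
    have h10 := dvd_sub hTu h9
    rw [aeval_comp, sub_sub_sub_cancel_right] at h10
    exact h10
  have h11 : T - aeval (genR R) H ∣ c * (x - aeval T p) := h8.mul_left _
  have hκe : κ * n + (D * t₀ + J * t₀ + t₀ + 1) ≤ κ * e := by
    rw [hedef, show n + D * t₀ + J * t₀ + t₀ + 1 = n + (D * t₀ + J * t₀ + t₀ + 1) by ring, mul_add]
    exact Nat.add_le_add_left (Nat.le_mul_of_pos_left _ h.κ_pos) _
  have h12 : DegLe K (κ * n + D * t₀ + J * t₀) (c * (x - aeval T p)) := by
    rw [mul_sub]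
    refine ((PowComb.degLe h hT hcx).mono (by omega)).sub ?_
    have h13 : DegLe K 0 (c : R) := by
      rw [← algebraMap_C_intCast]
      exact DegLe.of_natDegree_le (by simp)
    refine DegLe.mono (h13.mul (n := J * t₀) ?_) (by omega)
    rw [aeval_eq_sum_range' hpJ]
    refine Finset.sum_induction _ (DegLe K (J * t₀)) (fun _ _ => DegLe.add)
      (fun v hv => Or.inl (map_zero _)) fun i hi => ?_
    rw [zsmul_eq_mul]
    have h14 : DegLe K 0 ((p.coeff i : ℤ) : R) := by
      rw [← algebraMap_C_intCast]
      exact DegLe.of_natDegree_le (by simp)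
    refine (h14.mul (hT.pow i)).mono ?_
    rw [zero_add, mul_comm]
    exact Nat.mul_le_mul_right _ (Finset.mem_range.1 hi).le
  have h15 := h12.eq_zero_of_dvd h.oddPoles (e := κ * e) (by omega) ?_ h11
  · rcases mul_eq_zero.1 h15 with h16 | h16
    · exact absurd h16 hc
    · exact sub_eq_zero.1 h16
  · intro v hv
    have h17 : algebraMap R K (aeval (genR R) H) =
        aeval (genK K) (Chebyshev.C ℚ ((κ * e : ℕ) : ℤ)) := by
      rw [aeval_genR, hH, Chebyshev.map_C, ← IsScalarTower.algebraMap_apply,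
        OddPoles.algebraMap_eq_aeval]
    obtain ⟨h18, h19⟩ := v.ord_aeval hv (Chebyshev.C_ne_zero ℚ (κ * e))
    rw [Chebyshev.natDegree_C] at h19
    rw [map_sub, h17, ← neg_sub, v.ord_neg', sub_eq_add_neg]
    refine ((v.ord_add_eq h18 ?_).2.trans h19).le
    refine ((hT v hv).neg).mono ?_
    rw [h19]
    have h20 : (t₀ : ℤ) + 1 ≤ (κ * e : ℕ) := by exact_mod_cast (by omega : t₀ + 1 ≤ κ * e)
    nlinarith

theorem PowComb.of_sum (T : R) {n : R} {d : ℕ}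
    (hn : ∀ p : ℤ[X], p.natDegree ≤ d → DegRel κ l b₀ (aeval (genR R) p) n) (j : ℕ)
    (r : ℕ → ℤ[X]) (hr : ∀ i < j, (r i).natDegree ≤ d) :
    PowComb κ l b₀ T j (∑ i ∈ Finset.range j, aeval (genR R) (r i) * T ^ i) n := by
  induction j generalizing r with
  | zero => rfl
  | succ j ih =>
    refine ⟨_, _, hn (r 0) (hr 0 j.succ_pos), ih (fun i => r (i + 1))
      (fun i hi => hr _ (Nat.succ_lt_succ hi)), ?_⟩
    rw [Finset.sum_range_succ', Finset.mul_sum, pow_zero, mul_one, add_comm]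
    congr 1
    exact Finset.sum_congr rfl fun i _ => by ring

theorem PowComb.exists (T : R) (P : ℤ[X]) : ∃ (c : ℤ) (n : ℕ), c ≠ 0 ∧
    PowComb κ l b₀ T (Module.finrank ℚ[X] R) (c * aeval T P) (n : R) := by
  set D := Module.finrank ℚ[X] R
  have hD : 0 < D := Module.finrank_pos
  set Q := P.map (algebraMap ℤ ℚ[X]) %ₘ mulCharpoly T with hQ
  have hQT : aeval T Q = aeval T P := by
    rw [hQ, aeval_modByMonic_eq_self_of_root (aeval_mulCharpoly T), aeval_map_algebraMap]
  have hQD : Q.natDegree < D := by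
    rw [show D = (mulCharpoly T).natDegree from (natDegree_mulCharpoly T).symm]
    refine natDegree_modByMonic_lt _ (mulCharpoly_monic T) fun h1 => ?_
    have := natDegree_mulCharpoly T
    rw [h1, natDegree_one] at this
    omega
  obtain ⟨c, hc, hr⟩ := exists_intCast_smul_eq_map Q.coeff D
  have : ∀ i, ∃ r : ℤ[X], i < D → r.map (Int.castRingHom ℚ) = C (c : ℚ) * Q.coeff i := fun i => by
    by_cases hi : i < D
    · obtain ⟨r, hr⟩ := hr i hi
      exact ⟨r, fun _ => hr⟩
    · exact ⟨0, fun h => absurd h hi⟩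
  choose r hr using this
  obtain ⟨n, -, hn⟩ := DegRel.exists (R := R) h (∑ i ∈ Finset.range D, (r i).natDegree) 0
  refine ⟨c, n, hc, ?_⟩
  have := PowComb.of_sum h T hn D r fun i hi =>
    Finset.single_le_sum (f := fun i => (r i).natDegree) (fun _ _ => Nat.zero_le _)
      (Finset.mem_range.2 hi)
  convert this using 1
  rw [← hQT, aeval_eq_sum_range' hQD, Finset.mul_sum]
  refine Finset.sum_congr rfl fun i hi => ?_
  rw [aeval_genR, hr i (Finset.mem_range.1 hi), map_mul, algebraMap_C_intCast, Algebra.smul_def,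
    mul_assoc]

theorem IntPolyRel.of_aeval (T : R) (t₀ : ℕ) (P : ℤ[X]) :
    IntPolyRel κ l b₀ T t₀ (aeval T P) := by
  obtain ⟨J, B, hJB⟩ := Cert.exists h P
  obtain ⟨c, n, hc, hn⟩ := PowComb.exists h T P
  have := h.charZero
  set D := Module.finrank ℚ[X] R with hD
  set e := n + D * t₀ + J * t₀ + t₀ + 1 with he
  set H := Chebyshev.C ℤ ((κ * e : ℕ) : ℤ) with hH
  obtain ⟨J', B', hJB'⟩ := Cert.exists h (P.comp H)
  obtain ⟨G, hG⟩ := BigRel.exists (R := R) κ ((κ * e + 1) * J)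
  set δ : ℤ := B' + B * G + 1 with hδ
  have hδR : (B' + B * G + 1 + (0 : ℕ) : R) = (δ : ℤ) := by
    rw [hδ]
    push_cast
    ring
  refine ⟨aeval (genR R) P, J, B, aeval (genR R) (P.comp H), J', B', n, G, (0 : ℕ),
    (H.eval δ : ℤ), (P.eval (H.eval δ) : ℤ), c, aeval (genR R) H, hJB, hJB', ⟨n, rfl⟩, ⟨0, rfl⟩,
    ⟨_, rfl⟩, ⟨_, rfl⟩, ⟨c, rfl⟩, by exact_mod_cast hc, ⟨e, ?_, ?_⟩, ?_, ?_, genR_sub_dvd _ _, ?_,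
    ?_, hn⟩
  · rw [he]
    push_cast
    rfl
  · rw [cheb_eq_aeval]
  · rw [he] at hG
    exact_mod_cast hG
  · rw [hδR]
    exact genR_sub_dvd _ _
  · rw [hδR, ← eval_comp]
    exact genR_sub_dvd _ _
  · have h9 := sub_dvd_eval_sub T (aeval (genR R) H) (P.map (Int.castRingHom R))
    rwa [← algebraMap_int_eq, eval_map_algebraMap, eval_map_algebraMap, ← aeval_comp] at h9

theorem Admissible.d1_aeval (T : R) : D1 (fun x : R => ∃ P : ℤ[X], x = aeval T P) := by
  obtain ⟨t₀, ht₀⟩ := exists_degLe h.oddPoles T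
  intro ι f hf
  refine DS.congr (h.d1_intPolyRel T t₀ hf) fun ρ => ⟨?_, ?_⟩
  · rintro ⟨P, hP⟩
    rw [hP]
    exact IntPolyRel.of_aeval h T t₀ P
  · exact fun hx => hx.exists_eq_aeval h ht₀

end DiophSys

theorem IsIntegral.of_mem_adjoin_singleton {k K : Type*} [Field k] [NumberField k] [Field K]
    [CharZero K] [Algebra k K] [Algebra ℚ[X] K] {x : K}
    (hx : IsIntegral (Algebra.adjoin k {genK K}) x) : IsIntegral ℚ[X] x := by
  have hk : ∀ c : k, algebraMap k K c ∈ integralClosure ℚ[X] K := fun c => by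
    have h1 := (Algebra.IsIntegral.isIntegral (R := ℚ) c).map_of_comp_eq
      (algebraMap ℚ ℚ[X]) (algebraMap k K) (Subsingleton.elim _ _)
    exact h1
  have hA : ∀ y ∈ Algebra.adjoin k {genK K}, y ∈ integralClosure ℚ[X] K := fun y hy => by
    induction hy using Algebra.adjoin_induction with
    | mem y hy =>
      rw [Set.mem_singleton_iff.1 hy]
      exact isIntegral_algebraMap (R := ℚ[X]) (x := X)
    | algebraMap c => exact hk c
    | add y z _ _ hy hz => exact add_mem hy hz
    | mul y z _ _ hy hz => exact mul_mem hy hz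
  have h2 : IsIntegral (integralClosure ℚ[X] K) x :=
    hx.map_of_comp_eq
      ((algebraMap (Algebra.adjoin k {genK K}) K).codRestrict (integralClosure ℚ[X] K)
        fun y => hA y y.2) (RingHom.id K) rfl
  exact isIntegral_trans x h2

theorem OddPoles.eq_zero_of_sq_eq_mul_sq {R K : Type*} [CommRing R] [IsDomain R] [Algebra ℚ[X] R]
    [Module.Finite ℚ[X] R] [Module.Free ℚ[X] R] [Field K] [CharZero K] [Algebra R K]
    [Algebra ℚ[X] K] [IsScalarTower ℚ[X] R K] [IsFractionRing R K] (h : OddPoles R K) (x y : R)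
    (hxy : x ^ 2 = genR R * y ^ 2) : x = 0 ∧ y = 0 := by
  have hinj := IsFractionRing.injective R K
  suffices hy : y = 0 by
    subst hy
    exact ⟨by simpa using hxy, rfl⟩
  by_contra hy
  obtain ⟨v, hv⟩ := h.exists_pole
  have hg : genK K ≠ 0 := by
    intro h0
    rw [h0, v.ord_zero'] at hv
    exact lt_irrefl _ hv
  have hyK : algebraMap R K y ≠ 0 := (map_ne_zero_iff _ hinj).2 hy
  have h1 := congrArg (algebraMap R K) hxy
  rw [map_mul, map_pow, map_pow, algebraMap_genR] at h1
  have hxK : algebraMap R K x ≠ 0 := by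
    intro h0
    rw [h0, zero_pow two_ne_zero] at h1
    exact mul_ne_zero hg (pow_ne_zero 2 hyK) h1.symm
  have h2 := congrArg v.ord h1
  rw [v.ord_mul hg (pow_ne_zero 2 hyK), v.ord_pow hxK, v.ord_pow hyK] at h2
  obtain ⟨r, hr⟩ := h.odd v hv
  push_cast at h2
  omega

/-- `ℤ[T]` is Diophantine over a ring of `S`-integers of a function
field over a number field. -/
theorem intPolynomialRing_diophantine
    {k K : Type*} [Field k] [NumberField k] [Field K] [Algebra k K]
    (t : K) (ht : Transcendental k t)
    (hfin : FiniteDimensional (IntermediateField.adjoin k {t}) K)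
    (S : Set (FFPrime k K)) (hSfin : S.Finite) (hSne : S.Nonempty)
    (T : ↥(SIntegers S)) (hT : Transcendental k (T : K)) :
    IsDiophantine {x : Fin 1 → ↥(SIntegers S) |
      ∃ P : Polynomial ℤ, (x 0 : K) = Polynomial.aeval (T : K) P} := by
  have : CharZero K := charZero_of_injective_algebraMap (algebraMap k K).injective
  have hk := IsFunctionField.of_finiteDimensional ht hfin
  have hQ : IsFunctionField ℚ K := hk.restrictScalars
  obtain ⟨a, ha, hat, hodd, hint⟩ := hk.exists_generator S hSfin T T.2 hT
  have hmem : ∀ p : ℚ[X], (aeval a : ℚ[X] →ₐ[ℚ] K) p ∈ SIntegers S := fun p v hv =>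
    (v.restrict ℚ).ord_nonneg_of_mem_adjoin (ha v hv) (aeval_mem_adjoin_singleton ℚ a)
  letI : Algebra ℚ[X] K := (aeval a : ℚ[X] →ₐ[ℚ] K).toRingHom.toAlgebra
  letI : Algebra ℚ[X] (SIntegers S) :=
    ((aeval a : ℚ[X] →ₐ[ℚ] K).toRingHom.codRestrict (SIntegers S) hmem).toAlgebra
  have : IsScalarTower ℚ[X] (SIntegers S) K := IsScalarTower.of_algebraMap_eq fun _ => rfl
  have hgen : genK K = a := aeval_X a
  have htr : Transcendental ℚ (genK K) := by
    rw [hgen]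
    exact hat.restrictScalars (algebraMap ℚ k).injective
  have : IsIntegralClosure (SIntegers S) ℚ[X] K := by
    refine ⟨Subtype.val_injective, fun {x} => ⟨fun hx => ?_, ?_⟩⟩
    · refine ⟨⟨x, fun v hv => ?_⟩, rfl⟩
      exact v.ord_nonneg_of_isIntegral (A := ℚ[X]) (fun p => hmem p v hv) hx
    · rintro ⟨y, rfl⟩
      refine IsIntegral.of_mem_adjoin_singleton (k := k) ?_
      rw [hgen]
      exact (hint y).1 y.2
  have : Module.Finite ℚ[X] (SIntegers S) := hQ.module_finite htr _
  have : IsFractionRing (SIntegers S) K := hQ.isFractionRing htr _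
  have : FaithfulSMul ℚ[X] (SIntegers S) :=
    (faithfulSMul_iff_algebraMap_injective ℚ[X] (SIntegers S)).2 fun p q hpq =>
      IsFunctionField.injective_algebraMap_polynomial htr (congrArg Subtype.val hpq)
  have : Module.IsTorsionFree ℚ[X] (SIntegers S) := inferInstance
  have hO : OddPoles (SIntegers S) K := ⟨hQ, fun v hv => by
    rw [hgen] at hv ⊢
    exact hodd (v.extend k) hv⟩
  obtain ⟨κ, l, hl, b₀, h⟩ := DiophSys.exists_admissible hO
  refine DiophSys.DS.isDiophantine (genR (SIntegers S)) hO.eq_zero_of_sq_eq_mul_sq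
    (DiophSys.DS.congr (h.d1_aeval T (DiophSys.PolyFun.proj 0)) fun ρ => exists_congr fun P => ?_)
  rw [Subtype.ext_iff]
  have : ((aeval T P : SIntegers S) : K) = aeval (T : K) P := by
    exact (aeval_algebraMap_apply K T P).symm
  rw [this]
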